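/- Regularity of local minimizers for power-law repulsion: Let N ≥ 1, 0 < s ≤ 1 with 2s < N, and a > 0, and let W(x) = |x|^a/a − |x|^{2s−N}/(2s−N). Then every d₂-local minimizer μ ∈ 𝒫₂(ℝ^N) of the interaction energy E is absolutely continuous with respect to Lebesgue measure, and its density function ρ satisfies: ρ ∈ L^∞_loc(ℝ^N) if s = 1, and ρ has a representative in C^α_loc(ℝ^N) for some α ∈ (0,1) if 0 < s < 1. -/

import Mathlib

open MeasureTheory Real Set Filter ENNReal

noncomputable section

/-- `ℝ^N` as a Euclidean space. -/
abbrev Euc (N : ℕ) := EuclideanSpace ℝ (Fin N)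

/-- `μ ∈ 𝒫₂(ℝ^N)`: a Borel probability measure with finite second moment. -/
def IsProb2 (N : ℕ) (μ : Measure (Euc N)) : Prop :=
  IsProbabilityMeasure μ ∧ (∫⁻ x : Euc N, ENNReal.ofReal (‖x‖ ^ 2) ∂μ) < ⊤

/-- The 2-Wasserstein distance `d₂(μ,ν)` (valued in `[0,∞]`), defined as the infimum
over transference plans `π` with marginals `μ` and `ν` of `(∬ |x−y|² dπ)^{1/2}`. -/
noncomputable def wass2 (N : ℕ) (μ ν : Measure (Euc N)) : ℝ≥0∞ :=
  ⨅ pl ∈ {pl : Measure (Euc N × Euc N) |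
      IsProbabilityMeasure pl ∧ pl.map Prod.fst = μ ∧ pl.map Prod.snd = ν},
    (∫⁻ p : Euc N × Euc N, ENNReal.ofReal (‖p.1 - p.2‖ ^ 2) ∂pl) ^ (1/2 : ℝ)

/-- The interaction energy `E[μ] = (1/2) ∬ W(x−y) dμ(x) dμ(y)` for a nonnegative
(possibly infinite-valued) interaction potential `W`. -/
noncomputable def interE (N : ℕ) (W : Euc N → ℝ≥0∞) (μ : Measure (Euc N)) : ℝ≥0∞ :=
  (1/2 : ℝ≥0∞) * ∫⁻ x : Euc N, ∫⁻ y : Euc N, W (x - y) ∂μ ∂μ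

/-- The potential `ψ = W ∗ μ` associated to `μ`. -/
noncomputable def potential (N : ℕ) (W : Euc N → ℝ≥0∞) (μ : Measure (Euc N)) (x : Euc N) :
    ℝ≥0∞ :=
  ∫⁻ y : Euc N, W (x - y) ∂μ

/-- The support of a measure: points all of whose balls have positive measure. -/
def msupport (N : ℕ) (μ : Measure (Euc N)) : Set (Euc N) :=
  {x : Euc N | ∀ ε : ℝ, 0 < ε → 0 < μ (Metric.ball x ε)}

/-- `μ` is a `d₂`-local minimizer of the interaction energy at scale `ε`. -/
def IsLocalMinAt (N : ℕ) (W : Euc N → ℝ≥0∞) (μ : Measure (Euc N)) (ε : ℝ) : Prop :=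
  IsProb2 N μ ∧ interE N W μ < ⊤ ∧
    ∀ ν : Measure (Euc N), IsProb2 N ν → wass2 N ν μ ≤ ENNReal.ofReal ε →
      interE N W μ ≤ interE N W ν

/-- `μ` is a `d₂`-local minimizer of the interaction energy. -/
def IsLocalMin2 (N : ℕ) (W : Euc N → ℝ≥0∞) (μ : Measure (Euc N)) : Prop :=
  ∃ ε : ℝ, 0 < ε ∧ IsLocalMinAt N W μ ε

end


/-- The power-law repulsive/attractive potential
`W(x) = |x|^a/a + |x|^{2s−N}/(N−2s)`, valued in `[0,∞]` (equal to `∞` at `x = 0`). -/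
noncomputable def powerLawW (N : ℕ) (s a : ℝ) (x : Euc N) : ℝ≥0∞ :=
  ENNReal.ofReal (‖x‖ ^ a / a) +
    (ENNReal.ofReal ‖x‖) ^ (2 * s - (N : ℝ)) / ENNReal.ofReal ((N : ℝ) - 2 * s)

open scoped Topology

/-! ### Gaussian kernel -/

/-- heat kernel -/
noncomputable def gk (N : ℕ) (t : ℝ) (x : Euc N) : ℝ :=
  (4 * π * t) ^ (-(N : ℝ) / 2) * Real.exp (-‖x‖ ^ 2 / (4 * t))

/-- heat kernel, extended nonnegative valued -/
noncomputable def gE (N : ℕ) (t : ℝ) (x : Euc N) : ℝ≥0∞ := ENNReal.ofReal (gk N t x)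

lemma gk_pos {N : ℕ} {t : ℝ} (ht : 0 < t) (x : Euc N) : 0 < gk N t x := by
  unfold gk; positivity

lemma gk_neg {N : ℕ} (t : ℝ) (x : Euc N) : gk N t (-x) = gk N t x := by
  simp [gk]

lemma gE_neg {N : ℕ} (t : ℝ) (x : Euc N) : gE N t (-x) = gE N t x := by
  simp [gE, gk_neg]

lemma gE_sub_comm {N : ℕ} (t : ℝ) (x y : Euc N) : gE N t (x - y) = gE N t (y - x) := by
  rw [← neg_sub, gE_neg]

lemma measurable_gk (N : ℕ) : Measurable (fun p : ℝ × Euc N => gk N p.1 p.2) := by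
  unfold gk
  exact ((measurable_const.mul measurable_fst).pow_const _).mul
    (Real.measurable_exp.comp (((measurable_snd.norm.pow_const 2).neg).div
      (measurable_const.mul measurable_fst)))

lemma measurable_gE (N : ℕ) : Measurable (fun p : ℝ × Euc N => gE N p.1 p.2) :=
  (measurable_gk N).ennreal_ofReal

lemma measurable_gE' (N : ℕ) (t : ℝ) : Measurable (gE N t) :=
  (measurable_gE N).comp (measurable_const.prodMk measurable_id)

lemma gk_le {N : ℕ} {t : ℝ} (ht : 0 < t) (x : Euc N) : gk N t x ≤ t ^ (-(N : ℝ) / 2) := by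
  unfold gk
  have h1 : Real.exp (-‖x‖ ^ 2 / (4 * t)) ≤ 1 := by
    rw [Real.exp_le_one_iff]
    apply div_nonpos_of_nonpos_of_nonneg <;> nlinarith [sq_nonneg ‖x‖]
  have h2 : (4 * π * t) ^ (-(N : ℝ) / 2) ≤ t ^ (-(N : ℝ) / 2) := by
    apply Real.rpow_le_rpow_of_nonpos ht
    · nlinarith [Real.pi_gt_three]
    · have : (0:ℝ) ≤ N := Nat.cast_nonneg N
      linarith
  calc _ ≤ (4 * π * t) ^ (-(N : ℝ) / 2) * 1 := by gcongr
    _ ≤ _ := by simpa using h2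

lemma gk_lower {N : ℕ} {t R : ℝ} (ht : 0 < t) (x : Euc N) (hx : ‖x‖ ^ 2 ≤ R * t) :
    (4 * π) ^ (-(N : ℝ) / 2) * Real.exp (-R / 4) * t ^ (-(N : ℝ) / 2) ≤ gk N t x := by
  unfold gk
  rw [Real.mul_rpow (by positivity) ht.le]
  have : Real.exp (-R / 4) ≤ Real.exp (-‖x‖ ^ 2 / (4 * t)) := by
    rw [Real.exp_le_exp, div_le_div_iff₀ (by positivity) (by positivity)]
    nlinarith
  calc _ = (4 * π) ^ (-(N : ℝ) / 2) * t ^ (-(N : ℝ) / 2) * Real.exp (-R / 4) := by ring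
    _ ≤ _ := by gcongr

lemma integral_gk {N : ℕ} {t : ℝ} (ht : 0 < t) : ∫ x, gk N t x = 1 := by
  unfold gk
  rw [integral_const_mul]
  have := GaussianFourier.integral_rexp_neg_mul_sq_norm (V := Euc N) (b := 1 / (4 * t))
    (by positivity)
  have h2 : ∀ x : Euc N, Real.exp (-‖x‖ ^ 2 / (4 * t)) = Real.exp (-(1 / (4 * t)) * ‖x‖ ^ 2) := by
    intro x; congr 1; ring
  simp_rw [h2]
  rw [this]
  simp only [finrank_euclideanSpace, Fintype.card_fin]
  have h3 : π / (1 / (4 * t)) = 4 * π * t := by field_simp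
  rw [h3, ← Real.rpow_add (by positivity)]
  simp [neg_div]

lemma integrable_gk {N : ℕ} {t : ℝ} (ht : 0 < t) : Integrable (gk N t) := by
  by_contra h
  have := integral_gk (N := N) ht
  rw [integral_undef h] at this
  norm_num at this

lemma lintegral_gE {N : ℕ} {t : ℝ} (ht : 0 < t) : ∫⁻ x, gE N t x = 1 := by
  unfold gE
  rw [← ofReal_integral_eq_lintegral_ofReal (integrable_gk ht)
    (Eventually.of_forall fun x => (gk_pos ht x).le), integral_gk ht]
  simp

lemma gk_mul {N : ℕ} {s t : ℝ} (hs : 0 < s) (ht : 0 < t) (x y : Euc N) :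
    gk N s (x - y) * gk N t y =
      gk N (s + t) x * gk N (s * t / (s + t)) (y - (t / (s + t)) • x) := by
  unfold gk
  have hst : 0 < s + t := by positivity
  have e1 : (4 * π * s) ^ (-(N : ℝ) / 2) * (4 * π * t) ^ (-(N : ℝ) / 2)
      = (4 * π * (s + t)) ^ (-(N : ℝ) / 2) * (4 * π * (s * t / (s + t))) ^ (-(N : ℝ) / 2) := by
    rw [← Real.mul_rpow (by positivity) (by positivity),
      ← Real.mul_rpow (by positivity) (by positivity)]
    congr 1; field_simp
  have e2 : -‖x - y‖ ^ 2 / (4 * s) + -‖y‖ ^ 2 / (4 * t)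
      = -‖x‖ ^ 2 / (4 * (s + t)) + -‖y - (t / (s + t)) • x‖ ^ 2 / (4 * (s * t / (s + t))) := by
    rw [@norm_sub_sq_real, @norm_sub_sq_real, norm_smul, inner_smul_right, real_inner_comm x y]
    rw [mul_pow, Real.norm_eq_abs, sq_abs]
    field_simp
    ring
  calc _ = ((4 * π * s) ^ (-(N : ℝ) / 2) * (4 * π * t) ^ (-(N : ℝ) / 2)) *
        (Real.exp (-‖x - y‖ ^ 2 / (4 * s)) * Real.exp (-‖y‖ ^ 2 / (4 * t))) := by ring
    _ = _ := by rw [e1, ← Real.exp_add, e2, Real.exp_add]; ring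

lemma gE_conv {N : ℕ} {s t : ℝ} (hs : 0 < s) (ht : 0 < t) (x : Euc N) :
    ∫⁻ y, gE N s (x - y) * gE N t y = gE N (s + t) x := by
  have hst : 0 < s + t := by positivity
  have : ∀ y : Euc N, gE N s (x - y) * gE N t y =
      gE N (s + t) x * gE N (s * t / (s + t)) (y - (t / (s + t)) • x) := by
    intro y
    unfold gE
    rw [← ENNReal.ofReal_mul (gk_pos hs _).le, ← ENNReal.ofReal_mul (gk_pos hst _).le,
      gk_mul hs ht]
  simp_rw [this]
  have hm : Measurable fun y : Euc N => gE N (s * t / (s + t)) (y - (t / (s + t)) • x) :=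
    (measurable_gE' N _).comp (measurable_id.sub_const _)
  rw [lintegral_const_mul _ hm,
    lintegral_sub_right_eq_self (fun y => gE N (s * t / (s + t)) y), lintegral_gE (by positivity), mul_one]

/-- gaussian law with density `gE N t` -/
noncomputable def gam (N : ℕ) (t : ℝ) : Measure (Euc N) := volume.withDensity (gE N t)

lemma gam_prob (N : ℕ) {t : ℝ} (ht : 0 < t) : IsProbabilityMeasure (gam N t) := by
  constructor
  rw [gam, withDensity_apply _ MeasurableSet.univ, Measure.restrict_univ, lintegral_gE ht]

lemma lintegral_gam {N : ℕ} {t : ℝ} (f : Euc N → ℝ≥0∞) (hf : Measurable f) :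
    ∫⁻ z, f z ∂(gam N t) = ∫⁻ z, gE N t z * f z := by
  rw [gam, lintegral_withDensity_eq_lintegral_mul _ (measurable_gE' N t) hf]
  rfl

lemma gk_scale {N : ℕ} {t : ℝ} (ht : 0 < t) (τ : ℝ) (hτ : 0 < τ) (x : Euc N) :
    gk N (t * τ) (Real.sqrt t • x) = t ^ (-(N : ℝ) / 2) * gk N τ x := by
  unfold gk
  rw [norm_smul, mul_pow, Real.norm_eq_abs, sq_abs, Real.sq_sqrt ht.le]
  have : 4 * π * (t * τ) = t * (4 * π * τ) := by ring
  rw [this, Real.mul_rpow ht.le (by positivity)]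
  have : -(t * ‖x‖ ^ 2) / (4 * (t * τ)) = -‖x‖ ^ 2 / (4 * τ) := by
    field_simp
  rw [this]; ring

lemma gam_scale {N : ℕ} {t : ℝ} (ht : 0 < t) (f : Euc N → ℝ≥0∞) (hf : Measurable f) :
    ∫⁻ z, f z ∂(gam N t) = ∫⁻ z, f (Real.sqrt t • z) ∂(gam N 1) := by
  have hst : Real.sqrt t ≠ 0 := (Real.sqrt_pos.2 ht).ne'
  have hfm : Measurable fun z : Euc N => f (Real.sqrt t • z) :=
    hf.comp (measurable_const_smul _)
  rw [lintegral_gam f hf, lintegral_gam _ hfm]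
  have key := Measure.map_addHaar_smul (volume : Measure (Euc N)) hst
  have h1 : ∫⁻ z, gE N t z * f z ∂(Measure.map (fun x : Euc N => Real.sqrt t • x) volume)
      = ∫⁻ z, gE N t (Real.sqrt t • z) * f (Real.sqrt t • z) := by
    have hm : Measurable fun z => gE N t z * f z := (measurable_gE' N t).mul hf
    rw [lintegral_map hm (measurable_const_smul _)]
  have key2 : Measure.map (fun x : Euc N => Real.sqrt t • x) volume =
      ENNReal.ofReal (t ^ (-(N : ℝ) / 2)) • (volume : Measure (Euc N)) := by
    rw [show (fun x : Euc N => Real.sqrt t • x) = (Real.sqrt t • ·) from rfl, key]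
    congr 2
    simp only [finrank_euclideanSpace, Fintype.card_fin]
    rw [abs_of_nonneg (by positivity), Real.sqrt_eq_rpow, ← Real.rpow_natCast,
      ← Real.rpow_mul ht.le, ← Real.rpow_neg ht.le]
    congr 1; ring
  rw [key2, lintegral_smul_measure] at h1
  have h3 : ∀ z : Euc N, gE N t (Real.sqrt t • z) * f (Real.sqrt t • z)
      = ENNReal.ofReal (t ^ (-(N : ℝ) / 2)) * (gE N 1 z * f (Real.sqrt t • z)) := by
    intro z
    have := gk_scale ht 1 one_pos z
    rw [mul_one] at this
    unfold gE
    rw [this, ENNReal.ofReal_mul (by positivity), mul_assoc]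
  simp_rw [h3] at h1
  have hm : Measurable fun z => gE N 1 z * f (Real.sqrt t • z) := (measurable_gE' N 1).mul hfm
  rw [lintegral_const_mul _ hm, smul_eq_mul] at h1
  refine (ENNReal.mul_right_inj ?_ ENNReal.ofReal_ne_top).1 h1
  simp only [ne_eq, ENNReal.ofReal_eq_zero, not_le]; positivity

lemma gam_neg {N : ℕ} {t : ℝ} (f : Euc N → ℝ≥0∞) (hf : Measurable f) :
    ∫⁻ z, f (-z) ∂(gam N t) = ∫⁻ z, f z ∂(gam N t) := by
  have hm : Measurable fun z => f (-z) := hf.comp measurable_neg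
  rw [lintegral_gam f hf, lintegral_gam _ hm,
    ← lintegral_neg_eq_self (fun z => gE N t z * f z)]
  simp_rw [gE_neg]

lemma gam_map_neg (N : ℕ) (t : ℝ) : Measure.map (fun z => -z) (gam N t) = gam N t := by
  ext A hA
  have := gam_neg (N := N) (t := t) (A.indicator 1) (measurable_one.indicator hA)
  rw [Measure.map_apply measurable_neg hA]
  rw [lintegral_indicator_one hA] at this
  rw [← this, ← lintegral_indicator_one (measurable_neg hA)]
  rfl

lemma gam_map_scale (N : ℕ) {t : ℝ} (ht : 0 < t) :
    Measure.map (fun z => Real.sqrt t • z) (gam N 1) = gam N t := by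
  ext A hA
  have := gam_scale (N := N) ht (A.indicator 1) (measurable_one.indicator hA)
  rw [Measure.map_apply (measurable_const_smul _) hA]
  rw [lintegral_indicator_one hA] at this
  rw [this, ← lintegral_indicator_one ((measurable_const_smul _) hA)]
  rfl

/-- moments of the standard Gaussian are finite -/
lemma gam_moment (N : ℕ) {p : ℝ} (hp : 0 ≤ p) :
    ∫⁻ z, ENNReal.ofReal (‖z‖ ^ p) ∂(gam N 1) < ⊤ := by
  rw [lintegral_gam _ (by fun_prop)]
  -- bound r^p exp(-r²/4) ≤ C exp(-r²/8)
  obtain ⟨C, hC0, hC⟩ : ∃ C : ℝ, 0 ≤ C ∧ ∀ r : ℝ, 0 ≤ r → r ^ p ≤ C * Real.exp (r ^ 2 / 8) := by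
    obtain ⟨n, hn⟩ := exists_nat_ge p
    refine ⟨1 + 8 ^ n * (n.factorial : ℝ), by positivity, fun r hr => ?_⟩
    have he : 1 ≤ Real.exp (r ^ 2 / 8) := Real.one_le_exp (by positivity)
    rcases le_total r 1 with h | h
    · have : r ^ p ≤ 1 := Real.rpow_le_one hr h hp
      have h3 : (0:ℝ) ≤ 8 ^ n * (n.factorial : ℝ) := by positivity
      nlinarith
    · have h1 : r ^ p ≤ r ^ (2 * n) := by
        rw [← Real.rpow_natCast]
        apply Real.rpow_le_rpow_of_exponent_le h
        push_cast
        have : (0:ℝ) ≤ n := Nat.cast_nonneg n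
        linarith
      have h2 := Real.pow_div_factorial_le_exp (r ^ 2 / 8) (by positivity) n
      have h3 : r ^ (2 * n) ≤ 8 ^ n * (n.factorial : ℝ) * Real.exp (r ^ 2 / 8) := by
        rw [div_le_iff₀ (by positivity), div_pow, div_le_iff₀ (by positivity)] at h2
        rw [pow_mul]; linarith
      nlinarith
  have hb : ∀ z : Euc N, gE N 1 z * ENNReal.ofReal (‖z‖ ^ p) ≤
      ENNReal.ofReal (C * 2 ^ ((N : ℝ) / 2)) * gE N 2 z := by
    intro z
    unfold gE
    rw [← ENNReal.ofReal_mul (gk_pos one_pos _).le, ← ENNReal.ofReal_mul (by positivity)]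
    apply ENNReal.ofReal_le_ofReal
    have h1 := hC ‖z‖ (norm_nonneg _)
    have h2 : gk N 1 z * Real.exp (‖z‖ ^ 2 / 8) = 2 ^ ((N : ℝ) / 2) * gk N 2 z := by
      unfold gk
      rw [show (4 * π * 2) = (4 * π * 1) * 2 by ring, Real.mul_rpow (x := 4 * π * 1) (by positivity) (by positivity),
        mul_assoc, ← Real.exp_add]
      have : (2:ℝ) ^ ((N : ℝ) / 2) * (2:ℝ) ^ (-(N : ℝ) / 2) = 1 := by
        rw [← Real.rpow_add (by positivity)]; simp [neg_div]
      have e : -‖z‖ ^ 2 / (4 * 1) + ‖z‖ ^ 2 / 8 = -‖z‖ ^ 2 / (4 * 2) := by ring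
      rw [e]
      linear_combination -(4 * π * 1) ^ (-(N : ℝ) / 2) * rexp (-‖z‖ ^ 2 / (4 * 2)) * this
    calc gk N 1 z * ‖z‖ ^ p ≤ gk N 1 z * (C * Real.exp (‖z‖ ^ 2 / 8)) := by
          have := (gk_pos (N := N) one_pos z).le
          gcongr
      _ = C * 2 ^ ((N : ℝ) / 2) * gk N 2 z := by linear_combination C * h2
  calc _ ≤ ∫⁻ z : Euc N, ENNReal.ofReal (C * 2 ^ ((N : ℝ) / 2)) * gE N 2 z := lintegral_mono hb
    _ = ENNReal.ofReal (C * 2 ^ ((N : ℝ) / 2)) := by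
      rw [lintegral_const_mul _ (measurable_gE' N 2), lintegral_gE two_pos, mul_one]
    _ < ⊤ := ENNReal.ofReal_lt_top

/-! ### Subordinated kernels -/

/-- Gaussian mixture with time weight `w` -/
noncomputable def Tk (N : ℕ) (w : ℝ → ℝ≥0∞) (x : Euc N) : ℝ≥0∞ :=
  ∫⁻ τ in Ioi (0:ℝ), w τ * gE N τ x

/-- heat flow of a function -/
noncomputable def heat (N : ℕ) (t : ℝ) (f : Euc N → ℝ≥0∞) (x : Euc N) : ℝ≥0∞ :=
  ∫⁻ z, f (x - z) ∂(gam N t)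

/-- heat flow of a measure -/
noncomputable def pm (N : ℕ) (μ : Measure (Euc N)) (t : ℝ) (x : Euc N) : ℝ≥0∞ :=
  ∫⁻ y, gE N t (x - y) ∂μ

/-- mixture kernel convolved with a measure -/
noncomputable def Tm (N : ℕ) (w : ℝ → ℝ≥0∞) (μ : Measure (Euc N)) (x : Euc N) : ℝ≥0∞ :=
  ∫⁻ y, Tk N w (x - y) ∂μ

lemma measurable_Tk {N : ℕ} {w : ℝ → ℝ≥0∞} (hw : Measurable w) : Measurable (Tk N w) := by
  unfold Tk
  apply Measurable.lintegral_prod_right' (f := fun p : Euc N × ℝ => w p.2 * gE N p.2 p.1)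
  exact (hw.comp measurable_snd).mul ((measurable_gE N).comp measurable_swap)

lemma measurable_pm {N : ℕ} (μ : Measure (Euc N)) [SFinite μ] :
    Measurable (fun p : ℝ × Euc N => pm N μ p.1 p.2) := by
  unfold pm
  apply Measurable.lintegral_prod_right'
    (f := fun p : (ℝ × Euc N) × Euc N => gE N p.1.1 (p.1.2 - p.2))
  exact (measurable_gE N).comp (by fun_prop : Measurable fun p : (ℝ × Euc N) × Euc N =>
    (p.1.1, p.1.2 - p.2))

lemma measurable_Tm {N : ℕ} {w : ℝ → ℝ≥0∞} (hw : Measurable w) (μ : Measure (Euc N))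
    [SFinite μ] : Measurable (Tm N w μ) := by
  unfold Tm
  apply Measurable.lintegral_prod_right' (f := fun p : Euc N × Euc N => Tk N w (p.1 - p.2))
  exact (measurable_Tk hw).comp (measurable_fst.sub measurable_snd)

lemma Tm_eq {N : ℕ} {w : ℝ → ℝ≥0∞} (hw : Measurable w) (μ : Measure (Euc N))
    [SFinite μ] (x : Euc N) : Tm N w μ x = ∫⁻ τ in Ioi (0:ℝ), w τ * pm N μ τ x := by
  unfold Tm Tk pm
  rw [lintegral_lintegral_swap]
  · refine lintegral_congr fun τ => ?_
    have : Measurable fun y : Euc N => gE N τ (x - y) :=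
      (measurable_gE' N τ).comp (measurable_const.sub measurable_id)
    rw [lintegral_const_mul _ this]
  · apply Measurable.aemeasurable
    exact (hw.comp measurable_snd).mul ((measurable_gE N).comp
      (by fun_prop : Measurable fun p : Euc N × ℝ => (p.2, x - p.1)))

lemma heat_pm {N : ℕ} (μ : Measure (Euc N)) [SFinite μ] {τ h : ℝ} (hτ : 0 < τ) (hh : 0 < h)
    (x : Euc N) : heat N h (pm N μ τ) x = pm N μ (τ + h) x := by
  unfold heat
  have hm : Measurable fun z => pm N μ τ (x - z) :=
    (measurable_pm μ).comp (by fun_prop : Measurable fun z : Euc N => (τ, x - z))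
  rw [lintegral_gam _ hm]
  unfold pm
  have : ∀ z : Euc N, gE N h z * ∫⁻ y, gE N τ (x - z - y) ∂μ
      = ∫⁻ y, gE N h z * gE N τ (x - z - y) ∂μ := by
    intro z
    have : Measurable fun y : Euc N => gE N τ (x - z - y) :=
      (measurable_gE' N τ).comp (measurable_const.sub measurable_id)
    rw [lintegral_const_mul _ this]
  simp_rw [this]
  rw [lintegral_lintegral_swap]
  · refine lintegral_congr fun y => ?_
    rw [← gE_conv hτ hh]
    refine lintegral_congr fun z => ?_
    rw [mul_comm, sub_right_comm]
  · apply Measurable.aemeasurable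
    exact ((measurable_gE' N h).comp measurable_fst).mul ((measurable_gE' N τ).comp
      (by fun_prop : Measurable fun p : Euc N × Euc N => (x - p.1 - p.2)))

lemma heat_Tm {N : ℕ} {w : ℝ → ℝ≥0∞} (hw : Measurable w) (μ : Measure (Euc N)) [SFinite μ]
    {h : ℝ} (hh : 0 < h) (x : Euc N) :
    heat N h (Tm N w μ) x
      = ∫⁻ τ in Ioi (0:ℝ), (Ioi h).indicator (fun τ => w (τ - h)) τ * pm N μ τ x := by
  have := gam_prob N hh
  have e1 : heat N h (Tm N w μ) x = ∫⁻ τ in Ioi (0:ℝ), w τ * pm N μ (τ + h) x := by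
    unfold heat
    simp_rw [Tm_eq hw μ]
    rw [lintegral_lintegral_swap]
    · refine setLIntegral_congr_fun measurableSet_Ioi fun τ (hτ : 0 < τ) => ?_
      have hm : Measurable fun z => pm N μ τ (x - z) :=
        (measurable_pm μ).comp (by fun_prop : Measurable fun z : Euc N => (τ, x - z))
      rw [lintegral_const_mul _ hm, ← heat_pm μ hτ hh]; rfl
    · apply Measurable.aemeasurable
      exact (hw.comp measurable_snd).mul ((measurable_pm μ).comp
        (by fun_prop : Measurable fun p : Euc N × ℝ => (p.2, x - p.1)))
  rw [e1, ← lintegral_indicator measurableSet_Ioi, ← lintegral_indicator measurableSet_Ioi,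
    ← lintegral_sub_right_eq_self _ h]
  refine lintegral_congr fun τ => ?_
  by_cases h1 : h < τ
  · have h2 : 0 < τ := hh.trans h1
    simp [h1, h2]
  · simp [h1, indicator]

/-- weight of the Riesz kernel -/
noncomputable def pw (s : ℝ) (τ : ℝ) : ℝ≥0∞ := ENNReal.ofReal (τ ^ (s - 1))

/-- weight of the averaging kernel, real version -/
noncomputable def mr (s H τ : ℝ) : ℝ := H ^ (-s) * τ⁻¹ * (τ ^ s - (max (τ - H) 0) ^ s)

/-- weight of the averaging kernel -/
noncomputable def mw (s H : ℝ) (τ : ℝ) : ℝ≥0∞ := ENNReal.ofReal (mr s H τ)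

lemma measurable_pw (s : ℝ) : Measurable (pw s) := by unfold pw; fun_prop
lemma measurable_mw (s H : ℝ) : Measurable (mw s H) := by unfold mw mr; fun_prop

lemma mr_nonneg {s H τ : ℝ} (hs : 0 < s) (hH : 0 < H) (hτ : 0 < τ) : 0 ≤ mr s H τ := by
  unfold mr
  have : (max (τ - H) 0) ^ s ≤ τ ^ s :=
    Real.rpow_le_rpow (le_max_right _ _) (max_le (by linarith) hτ.le) hs.le
  have h2 : 0 ≤ τ ^ s - (max (τ - H) 0) ^ s := by linarith
  positivity

lemma mr_le {s H τ : ℝ} (hH : 0 < H) (hτ : 0 < τ) :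
    mr s H τ ≤ H ^ (-s) * τ ^ (s - 1) := by
  unfold mr
  have : 0 ≤ (max (τ - H) 0) ^ s := Real.rpow_nonneg (le_max_right _ _) _
  have e : τ ^ (s - 1) = τ⁻¹ * τ ^ s := by
    rw [Real.rpow_sub_one hτ.ne', div_eq_mul_inv, mul_comm]
  rw [e, mul_assoc]
  gcongr
  linarith

lemma mr_eq {s H τ : ℝ} (hs : 0 < s) (hτ : 0 < τ) (h : τ ≤ H) :
    mr s H τ = H ^ (-s) * τ ^ (s - 1) := by
  unfold mr
  rw [max_eq_right (by linarith), Real.zero_rpow hs.ne', Real.rpow_sub_one hτ.ne']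
  field_simp; simp

lemma mr_scale {s H τ : ℝ} (hH : 0 < H) (hτ : 0 < τ) :
    mr s H (H * τ) = H⁻¹ * mr s 1 τ := by
  unfold mr
  have : max (H * τ - H) 0 = H * max (τ - 1) 0 := by
    rw [mul_max_of_nonneg _ _ hH.le]; ring_nf
  rw [this, Real.mul_rpow hH.le hτ.le, Real.mul_rpow hH.le (le_max_right _ _), Real.one_rpow,
    Real.rpow_neg hH.le, mul_inv]
  have : H ^ s ≠ 0 := (Real.rpow_pos_of_pos hH s).ne'
  field_simp

/-- FTC for lower integrals -/
lemma lint_deriv {F f : ℝ → ℝ} {a b : ℝ} (hab : a ≤ b) (hc : ContinuousOn F (Icc a b))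
    (hd : ∀ x ∈ Ioo a b, HasDerivAt F (f x) x) (hnn : ∀ x ∈ Ioo a b, 0 ≤ f x) :
    ∫⁻ x in Ioo a b, ENNReal.ofReal (f x) = ENNReal.ofReal (F b - F a) := by
  have hio : IntegrableOn f (Ioc a b) := intervalIntegral.integrableOn_deriv_of_nonneg hc hd hnn
  have hIntv : IntervalIntegrable f volume a b :=
    (intervalIntegrable_iff_integrableOn_Ioc_of_le hab).2 hio
  have hI := intervalIntegral.integral_eq_sub_of_hasDerivAt_of_le hab hc hd hIntv
  rw [intervalIntegral.integral_of_le hab, integral_Ioc_eq_integral_Ioo] at hI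
  rw [← hI, ofReal_integral_eq_lintegral_ofReal]
  · exact hio.mono_set Ioo_subset_Ioc_self
  · exact (ae_restrict_iff' measurableSet_Ioo).2 (Eventually.of_forall hnn)

/-- integrated weight, primitive -/
lemma weight_integral {s ε H τ : ℝ} (hs : 0 < s) (hε : 0 < ε) (hH : ε ≤ H) (hHτ : H ≤ τ) :
    ∫⁻ h in Ioo ε H, ENNReal.ofReal (s * h ^ (-1 - s)) * ENNReal.ofReal ((τ - h) ^ (s - 1))
      = ENNReal.ofReal (τ⁻¹ * (((τ - ε) / ε) ^ s - ((τ - H) / H) ^ s)) := by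
  have hτ : 0 < τ := by linarith
  set F : ℝ → ℝ := fun h => -(τ⁻¹ * ((τ - h) / h) ^ s) with hF
  set f : ℝ → ℝ := fun h => s * h ^ (-1 - s) * (τ - h) ^ (s - 1) with hf
  have hc : ContinuousOn F (Icc ε H) := by
    apply ContinuousOn.neg
    apply ContinuousOn.mul continuousOn_const
    apply ContinuousOn.rpow_const
    · apply ContinuousOn.div (by fun_prop) (by fun_prop)
      intro x hx; have := hx.1; linarith
    · intro x hx; right; exact hs.le
  have hd : ∀ x ∈ Ioo ε H, HasDerivAt F (f x) x := by
    intro x hx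
    have hx0 : 0 < x := hε.trans hx.1
    have hx1 : 0 < τ - x := by linarith [hx.2]
    have h1 : HasDerivAt (fun h => (τ - h) / h) ((-1 * x - (τ - x) * 1) / x ^ 2) x :=
      ((hasDerivAt_id x).const_sub τ).div (hasDerivAt_id x) hx0.ne'
    have h2 := ((h1.rpow_const (p := s) (Or.inl (by positivity))).const_mul τ⁻¹).neg
    refine h2.congr_deriv ?_
    rw [hf]
    beta_reduce
    have e : x ^ (-1 - s) = (x ^ (s - 1))⁻¹ / x ^ 2 := by
      rw [show (-1 - s) = -(s-1) - 2 by ring, Real.rpow_sub hx0, Real.rpow_neg hx0.le,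
        Real.rpow_two]
    rw [Real.div_rpow hx1.le hx0.le, e]
    have : x ^ (s-1) ≠ 0 := (Real.rpow_pos_of_pos hx0 _).ne'
    field_simp
    ring
  have hnn : ∀ x ∈ Ioo ε H, 0 ≤ f x := by
    intro x hx
    have hx0 : 0 < x := hε.trans hx.1
    have hx1 : 0 < τ - x := by linarith [hx.2]
    rw [hf]; positivity
  have := lint_deriv hH hc hd hnn
  rw [show τ⁻¹ * (((τ - ε) / ε) ^ s - ((τ - H) / H) ^ s) = F H - F ε by rw [hF]; ring, ← this]
  refine setLIntegral_congr_fun measurableSet_Ioo fun x hx => ?_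
  have hx0 : 0 < x := hε.trans hx.1
  rw [← ENNReal.ofReal_mul (by positivity)]

lemma weight_integral0 {s ε H : ℝ} (hs : 0 < s) (hε : 0 < ε) (hH : ε ≤ H) :
    ∫⁻ h in Ioo ε H, ENNReal.ofReal (s * h ^ (-1 - s)) = ENNReal.ofReal (ε ^ (-s) - H ^ (-s)) := by
  have hc : ContinuousOn (fun h : ℝ => - h ^ (-s)) (Icc ε H) := by
    apply ContinuousOn.neg
    apply ContinuousOn.rpow_const (by fun_prop)
    intro x hx; left; have := hx.1; linarith
  have := lint_deriv (f := fun h => s * h ^ (-1 - s)) hH hc (fun x hx => by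
    have hx0 : 0 < x := hε.trans hx.1
    have h := (Real.hasDerivAt_rpow_const (x := x) (p := -s) (Or.inl hx0.ne')).neg
    refine h.congr_deriv ?_
    rw [show -1 - s = -s - 1 by ring]; ring) (fun x hx => by
    have hx0 : 0 < x := hε.trans hx.1
    positivity)
  rw [this]; congr 1; ring

lemma weight_id {s ε H τ : ℝ} (hs : 0 < s) (hε : 0 < ε) (hH : ε ≤ H) (hτ : 0 < τ) :
    mw s ε τ + ∫⁻ h in Ioo ε H, ENNReal.ofReal (s * h ^ (-1 - s)) *
        (Ioi h).indicator (fun τ => pw s (τ - h)) τ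
      = mw s H τ + ∫⁻ h in Ioo ε H, ENNReal.ofReal (s * h ^ (-1 - s)) * pw s τ := by
  have hH0 : 0 < H := by linarith
  have hmono : H ^ (-s) ≤ ε ^ (-s) := Real.rpow_le_rpow_of_nonpos hε hH (by linarith)
  have eR : mw s H τ + ∫⁻ h in Ioo ε H, ENNReal.ofReal (s * h ^ (-1 - s)) * pw s τ
      = ENNReal.ofReal (mr s H τ + (ε ^ (-s) - H ^ (-s)) * τ ^ (s - 1)) := by
    rw [lintegral_mul_const _ (by fun_prop), weight_integral0 hs hε hH, mw, pw,
      ← ENNReal.ofReal_mul (by linarith), ← ENNReal.ofReal_add (mr_nonneg hs hH0 hτ)]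
    exact mul_nonneg (by linarith) (by positivity)
  have eL : ∫⁻ h in Ioo ε H, ENNReal.ofReal (s * h ^ (-1 - s)) *
        (Ioi h).indicator (fun τ => pw s (τ - h)) τ
      = ENNReal.ofReal (τ⁻¹ * (((max (τ - ε) 0) / ε) ^ s - ((max (τ - H) 0) / H) ^ s)) := by
    have e0 : ∫⁻ h in Ioo ε H, ENNReal.ofReal (s * h ^ (-1 - s)) *
        (Ioi h).indicator (fun τ => pw s (τ - h)) τ
        = ∫⁻ h in Ioo ε (min H τ), ENNReal.ofReal (s * h ^ (-1 - s)) *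
          ENNReal.ofReal ((τ - h) ^ (s - 1)) := by
      rw [← lintegral_indicator measurableSet_Ioo, ← lintegral_indicator measurableSet_Ioo]
      refine lintegral_congr fun h => ?_
      by_cases h1 : h < τ <;> by_cases h2 : ε < h <;> by_cases h3 : h < H <;>
        simp [indicator, h1, h2, h3, pw]
    rw [e0]
    rcases le_total τ ε with h | h
    · rw [Ioo_eq_empty (by simp; intro _; exact h)]
      rw [max_eq_right (by linarith), max_eq_right (by linarith)]
      simp [Real.zero_rpow hs.ne']
    · rw [max_eq_left (by linarith)]
      rcases le_total τ H with h' | h'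
      · rw [min_eq_right h', weight_integral hs hε h le_rfl, max_eq_right (by linarith)]
        simp
      · rw [min_eq_left h', weight_integral hs hε hH h', max_eq_left (by linarith)]
  rw [eR, eL, mw, ← ENNReal.ofReal_add (mr_nonneg hs hε hτ)]
  · congr 1
    unfold mr
    rw [Real.div_rpow (le_max_right _ _) hε.le, Real.div_rpow (le_max_right _ _) hH0.le,
      Real.rpow_neg hε.le, Real.rpow_neg hH0.le, Real.rpow_sub_one hτ.ne']
    have : ε ^ s ≠ 0 := (Real.rpow_pos_of_pos hε s).ne'
    have : H ^ s ≠ 0 := (Real.rpow_pos_of_pos hH0 s).ne'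
    field_simp
    ring
  · apply mul_nonneg (by positivity)
    rw [sub_nonneg]
    apply Real.rpow_le_rpow (div_nonneg (le_max_right _ _) hH0.le) _ hs.le
    apply div_le_div₀ (le_max_right _ _) _ hε hH
    apply max_le_max _ le_rfl
    linarith

lemma measurable_heat {N : ℕ} {f : Euc N → ℝ≥0∞} (hf : Measurable f) (x : Euc N) :
    Measurable (fun h => heat N h f x) := by
  have e : (fun h => heat N h f x) = fun h => ∫⁻ z, gE N h z * f (x - z) := by
    funext h
    have : Measurable fun z => f (x - z) := hf.comp (measurable_const.sub measurable_id)
    rw [heat, lintegral_gam _ this]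
  rw [e]
  apply Measurable.lintegral_prod_right' (f := fun p : ℝ × Euc N => gE N p.1 p.2 * f (x - p.2))
  exact (measurable_gE N).mul (hf.comp (measurable_const.sub measurable_snd))

/-- the key identity -/
lemma ID {N : ℕ} {s ε H : ℝ} (hs : 0 < s) (hε : 0 < ε) (hH : ε ≤ H) (μ : Measure (Euc N))
    [SFinite μ] (x : Euc N) :
    Tm N (mw s ε) μ x + ∫⁻ h in Ioo ε H, ENNReal.ofReal (s * h ^ (-1 - s)) *
        heat N h (Tm N (pw s) μ) x
      = Tm N (mw s H) μ x + ∫⁻ h in Ioo ε H, ENNReal.ofReal (s * h ^ (-1 - s)) *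
        Tm N (pw s) μ x := by
  have hpm : Measurable fun τ => pm N μ τ x :=
    (measurable_pm μ).comp (by fun_prop : Measurable fun τ : ℝ => (τ, x))
  have hmA : Measurable fun p : ℝ × ℝ => ENNReal.ofReal (s * p.1 ^ (-1 - s)) *
      ((Ioi p.1).indicator (fun τ => pw s (τ - p.1)) p.2) := by
    have : (fun p : ℝ × ℝ => ((Ioi p.1).indicator (fun τ => pw s (τ - p.1)) p.2))
        = {p : ℝ × ℝ | p.1 < p.2}.indicator (fun p => pw s (p.2 - p.1)) := by
      funext p; simp [indicator]
    apply Measurable.mul (by fun_prop)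
    rw [this]
    exact ((measurable_pw s).comp (by fun_prop)).indicator
      (measurableSet_lt measurable_fst measurable_snd)
  have e1 : ∫⁻ h in Ioo ε H, ENNReal.ofReal (s * h ^ (-1 - s)) *
        heat N h (Tm N (pw s) μ) x = ∫⁻ τ in Ioi (0:ℝ), (∫⁻ h in Ioo ε H,
          ENNReal.ofReal (s * h ^ (-1 - s)) * (Ioi h).indicator (fun τ => pw s (τ - h)) τ) *
          pm N μ τ x := by
    have : ∫⁻ h in Ioo ε H, ENNReal.ofReal (s * h ^ (-1 - s)) * heat N h (Tm N (pw s) μ) x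
        = ∫⁻ h in Ioo ε H, ∫⁻ τ in Ioi (0:ℝ), (ENNReal.ofReal (s * h ^ (-1 - s)) *
          (Ioi h).indicator (fun τ => pw s (τ - h)) τ) * pm N μ τ x := by
      refine setLIntegral_congr_fun measurableSet_Ioo fun h hh => ?_
      have hh0 : 0 < h := hε.trans hh.1
      have hm : Measurable fun τ => (Ioi h).indicator (fun τ => pw s (τ - h)) τ * pm N μ τ x :=
        (((measurable_pw s).comp (measurable_id.sub_const h)).indicator measurableSet_Ioi).mul hpm
      rw [heat_Tm (measurable_pw s) μ hh0, ← lintegral_const_mul _ hm]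
      simp_rw [mul_assoc]
    rw [this, lintegral_lintegral_swap]
    · refine lintegral_congr fun τ => ?_
      have hm : Measurable fun h => ENNReal.ofReal (s * h ^ (-1 - s)) *
          (Ioi h).indicator (fun τ => pw s (τ - h)) τ :=
        hmA.comp (by fun_prop : Measurable fun h : ℝ => (h, τ))
      rw [lintegral_mul_const _ hm]
    · exact (hmA.mul (hpm.comp measurable_snd)).aemeasurable
  have e2 : ∫⁻ h in Ioo ε H, ENNReal.ofReal (s * h ^ (-1 - s)) * Tm N (pw s) μ x
      = ∫⁻ τ in Ioi (0:ℝ), (∫⁻ h in Ioo ε H, ENNReal.ofReal (s * h ^ (-1 - s)) * pw s τ) *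
          pm N μ τ x := by
    have hw : Measurable fun h : ℝ => ENNReal.ofReal (s * h ^ (-1 - s)) := by fun_prop
    have hm : Measurable fun τ => pw s τ * pm N μ τ x := (measurable_pw s).mul hpm
    rw [lintegral_mul_const _ hw, Tm_eq (measurable_pw s), ← lintegral_const_mul _ hm]
    refine lintegral_congr fun τ => ?_
    rw [lintegral_mul_const _ hw, mul_assoc]
  rw [e1, e2, Tm_eq (measurable_mw s ε), Tm_eq (measurable_mw s H), ← lintegral_add_left,
    ← lintegral_add_left]
  · refine setLIntegral_congr_fun measurableSet_Ioi fun τ (hτ : 0 < τ) => ?_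
    rw [← add_mul, ← add_mul, weight_id hs hε hH hτ]
  · exact (measurable_mw s H).mul hpm
  · exact (measurable_mw s ε).mul hpm

lemma ID_cmp {N : ℕ} {s ε H : ℝ} (hs : 0 < s) (hε : 0 < ε) (hH : ε ≤ H) (μ : Measure (Euc N))
    [SFinite μ] (x : Euc N) (hfin : Tm N (pw s) μ x < ⊤) (χ φ : ℝ → ℝ≥0∞) (hχ : Measurable χ)
    (hφ : Measurable φ)
    (h : ∀ h ∈ Ioo ε H, Tm N (pw s) μ x + χ h ≤ heat N h (Tm N (pw s) μ) x + φ h) :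
    Tm N (mw s ε) μ x + ∫⁻ h in Ioo ε H, ENNReal.ofReal (s * h ^ (-1 - s)) * χ h
      ≤ Tm N (mw s H) μ x + ∫⁻ h in Ioo ε H, ENNReal.ofReal (s * h ^ (-1 - s)) * φ h := by
  have hid := ID hs hε hH μ x
  set J := ∫⁻ h in Ioo ε H, ENNReal.ofReal (s * h ^ (-1 - s)) * Tm N (pw s) μ x with hJ
  have hw : Measurable fun h : ℝ => ENNReal.ofReal (s * h ^ (-1 - s)) := by fun_prop
  have hJt : J ≠ ⊤ := by
    rw [hJ, lintegral_mul_const _ hw, weight_integral0 hs hε hH]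
    exact (ENNReal.mul_lt_top ENNReal.ofReal_lt_top hfin).ne
  have h1 : J + ∫⁻ h in Ioo ε H, ENNReal.ofReal (s * h ^ (-1 - s)) * χ h ≤
      (∫⁻ h in Ioo ε H, ENNReal.ofReal (s * h ^ (-1 - s)) * heat N h (Tm N (pw s) μ) x) +
      ∫⁻ h in Ioo ε H, ENNReal.ofReal (s * h ^ (-1 - s)) * φ h := by
    have m1 : Measurable fun h => ENNReal.ofReal (s * h ^ (-1 - s)) * χ h := hw.mul hχ
    have m2 : Measurable fun h => ENNReal.ofReal (s * h ^ (-1 - s)) * φ h := hw.mul hφ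
    rw [hJ, ← lintegral_add_right _ m1, ← lintegral_add_right _ m2]
    refine setLIntegral_mono' measurableSet_Ioo fun t ht => ?_
    rw [← mul_add, ← mul_add]
    exact mul_le_mul_right (h t ht) _
  rw [← ENNReal.add_le_add_iff_right hJt]
  calc _ = Tm N (mw s ε) μ x + (J + ∫⁻ h in Ioo ε H, ENNReal.ofReal (s * h ^ (-1 - s)) * χ h) := by
        ring
    _ ≤ Tm N (mw s ε) μ x + ((∫⁻ h in Ioo ε H, ENNReal.ofReal (s * h ^ (-1 - s)) *
        heat N h (Tm N (pw s) μ) x) +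
      ∫⁻ h in Ioo ε H, ENNReal.ofReal (s * h ^ (-1 - s)) * φ h) := by gcongr
    _ = _ := by rw [← add_assoc, hid]; ring

lemma ID_ge {N : ℕ} {s ε H : ℝ} (hs : 0 < s) (hε : 0 < ε) (hH : ε ≤ H) (μ : Measure (Euc N))
    [SFinite μ] (x : Euc N) (hfin : Tm N (pw s) μ x < ⊤) (χ φ : ℝ → ℝ≥0∞) (hχ : Measurable χ)
    (hφ : Measurable φ)
    (h : ∀ h ∈ Ioo ε H, heat N h (Tm N (pw s) μ) x + χ h ≤ Tm N (pw s) μ x + φ h) :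
    Tm N (mw s H) μ x + ∫⁻ h in Ioo ε H, ENNReal.ofReal (s * h ^ (-1 - s)) * χ h
      ≤ Tm N (mw s ε) μ x + ∫⁻ h in Ioo ε H, ENNReal.ofReal (s * h ^ (-1 - s)) * φ h := by
  have hid := ID hs hε hH μ x
  set J := ∫⁻ h in Ioo ε H, ENNReal.ofReal (s * h ^ (-1 - s)) * Tm N (pw s) μ x with hJ
  have hw : Measurable fun h : ℝ => ENNReal.ofReal (s * h ^ (-1 - s)) := by fun_prop
  have hJt : J ≠ ⊤ := by
    rw [hJ, lintegral_mul_const _ hw, weight_integral0 hs hε hH]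
    exact (ENNReal.mul_lt_top ENNReal.ofReal_lt_top hfin).ne
  have h1 : (∫⁻ h in Ioo ε H, ENNReal.ofReal (s * h ^ (-1 - s)) * heat N h (Tm N (pw s) μ) x) +
      ∫⁻ h in Ioo ε H, ENNReal.ofReal (s * h ^ (-1 - s)) * χ h ≤
      J + ∫⁻ h in Ioo ε H, ENNReal.ofReal (s * h ^ (-1 - s)) * φ h := by
    have m1 : Measurable fun h => ENNReal.ofReal (s * h ^ (-1 - s)) * χ h := hw.mul hχ
    have m2 : Measurable fun h => ENNReal.ofReal (s * h ^ (-1 - s)) * φ h := hw.mul hφ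
    rw [hJ, ← lintegral_add_right _ m1, ← lintegral_add_right _ m2]
    refine setLIntegral_mono' measurableSet_Ioo fun t ht => ?_
    rw [← mul_add, ← mul_add]
    exact mul_le_mul_right (h t ht) _
  rw [← ENNReal.add_le_add_iff_right hJt]
  calc _ = (Tm N (mw s H) μ x + J) + ∫⁻ h in Ioo ε H, ENNReal.ofReal (s * h ^ (-1 - s)) * χ h := by
        ring
    _ = Tm N (mw s ε) μ x + ((∫⁻ h in Ioo ε H, ENNReal.ofReal (s * h ^ (-1 - s)) *
        heat N h (Tm N (pw s) μ) x) +
      ∫⁻ h in Ioo ε H, ENNReal.ofReal (s * h ^ (-1 - s)) * χ h) := by rw [← hid]; ring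
    _ ≤ Tm N (mw s ε) μ x + (J + ∫⁻ h in Ioo ε H, ENNReal.ofReal (s * h ^ (-1 - s)) * φ h) := by
        gcongr
    _ = _ := by ring

/-- one-dimensional scaling -/
lemma lint_Ioi_scale {t : ℝ} (ht : 0 < t) (f : ℝ → ℝ≥0∞) (hf : Measurable f) :
    ∫⁻ τ in Ioi (0:ℝ), f τ = ENNReal.ofReal t * ∫⁻ τ in Ioi (0:ℝ), f (t * τ) := by
  rw [← lintegral_indicator measurableSet_Ioi, ← lintegral_indicator measurableSet_Ioi]
  conv_lhs => rw [← Real.smul_map_volume_mul_left ht.ne']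
  rw [lintegral_smul_measure, lintegral_map (hf.indicator measurableSet_Ioi) (by fun_prop),
    abs_of_pos ht, smul_eq_mul]
  congr 1
  refine lintegral_congr fun τ => ?_
  simp [indicator, ht]

lemma Tk_scale {N : ℕ} {w : ℝ → ℝ≥0∞} (hw : Measurable w) {t : ℝ} (ht : 0 < t) (x : Euc N) :
    Tk N w (Real.sqrt t • x) = ENNReal.ofReal (t ^ (1 - (N : ℝ) / 2)) * Tk N (fun τ => w (t * τ)) x := by
  unfold Tk
  have hm : Measurable fun τ => w τ * gE N τ (Real.sqrt t • x) :=
    hw.mul ((measurable_gE N).comp (by fun_prop : Measurable fun τ : ℝ => (τ, Real.sqrt t • x)))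
  have hm2 : Measurable fun τ => w (t * τ) * gE N τ x :=
    (hw.comp (by fun_prop)).mul ((measurable_gE N).comp (by fun_prop : Measurable fun τ : ℝ => (τ, x)))
  rw [lint_Ioi_scale ht _ hm]
  have : ∫⁻ τ in Ioi (0:ℝ), w (t * τ) * gE N (t * τ) (Real.sqrt t • x)
      = ∫⁻ τ in Ioi (0:ℝ), ENNReal.ofReal (t ^ (-(N : ℝ) / 2)) * (w (t * τ) * gE N τ x) := by
    refine setLIntegral_congr_fun measurableSet_Ioi fun τ (hτ : 0 < τ) => ?_
    simp only [gE]
    rw [gk_scale ht τ hτ, ENNReal.ofReal_mul (by positivity)]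
    ring
  rw [this, lintegral_const_mul _ hm2, ← mul_assoc, ← ENNReal.ofReal_mul ht.le]
  congr 2
  rw [show 1 - (N:ℝ) / 2 = 1 + (-(N:ℝ)/2) by ring, Real.rpow_add ht, Real.rpow_one]

lemma Tk_congr {N : ℕ} {w w' : ℝ → ℝ≥0∞} (h : ∀ τ, 0 < τ → w τ = w' τ) (x : Euc N) :
    Tk N w x = Tk N w' x := by
  unfold Tk
  refine setLIntegral_congr_fun measurableSet_Ioi fun τ (hτ : 0 < τ) => ?_
  simp only [h τ hτ]

lemma Tk_mono {N : ℕ} {w w' : ℝ → ℝ≥0∞} (h : ∀ τ, 0 < τ → w τ ≤ w' τ) (x : Euc N) :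
    Tk N w x ≤ Tk N w' x := by
  unfold Tk
  refine setLIntegral_mono' measurableSet_Ioi fun τ (hτ : 0 < τ) => ?_
  gcongr
  exact h τ hτ

lemma Tk_const_mul {N : ℕ} {w : ℝ → ℝ≥0∞} (hw : Measurable w) (c : ℝ≥0∞) (x : Euc N) :
    Tk N (fun τ => c * w τ) x = c * Tk N w x := by
  unfold Tk
  have hm2 : Measurable fun τ => w τ * gE N τ x :=
    hw.mul ((measurable_gE N).comp (by fun_prop : Measurable fun τ : ℝ => (τ, x)))
  rw [← lintegral_const_mul _ hm2]
  simp_rw [mul_assoc]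

lemma Tk_norm {N : ℕ} (w : ℝ → ℝ≥0∞) {x y : Euc N} (h : ‖x‖ = ‖y‖) : Tk N w x = Tk N w y := by
  unfold Tk gE gk; rw [h]

lemma Tk_pw_scale {N : ℕ} {s t : ℝ} (ht : 0 < t) (x : Euc N) :
    Tk N (pw s) (Real.sqrt t • x) = ENNReal.ofReal (t ^ (s - (N : ℝ) / 2)) * Tk N (pw s) x := by
  rw [Tk_scale (measurable_pw s) ht]
  have : ∀ τ, 0 < τ → pw s (t * τ) = ENNReal.ofReal (t ^ (s - 1)) * pw s τ := by
    intro τ hτ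
    unfold pw
    rw [Real.mul_rpow ht.le hτ.le, ENNReal.ofReal_mul (by positivity)]
  rw [Tk_congr this, Tk_const_mul (measurable_pw s), ← mul_assoc, ← ENNReal.ofReal_mul (by positivity),
    ← Real.rpow_add ht]
  congr 3; ring

lemma Tk_mw_scale {N : ℕ} {s H : ℝ} (hH : 0 < H) (x : Euc N) :
    Tk N (mw s H) (Real.sqrt H • x) = ENNReal.ofReal (H ^ (-(N : ℝ) / 2)) * Tk N (mw s 1) x := by
  rw [Tk_scale (measurable_mw s H) hH]
  have : ∀ τ, 0 < τ → mw s H (H * τ) = ENNReal.ofReal (H⁻¹) * mw s 1 τ := by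
    intro τ hτ
    unfold mw
    rw [mr_scale hH hτ, ENNReal.ofReal_mul (by positivity)]
  rw [Tk_congr this, Tk_const_mul (measurable_mw s 1), ← mul_assoc, ← ENNReal.ofReal_mul (by positivity)]
  congr 2
  rw [show 1 - (N:ℝ) / 2 = 1 + (-(N:ℝ)/2) by ring, Real.rpow_add hH, Real.rpow_one]
  field_simp

lemma Tk_mw_le {N : ℕ} {s H : ℝ} (hH : 0 < H) (x : Euc N) :
    Tk N (mw s H) x ≤ ENNReal.ofReal (H ^ (-s)) * Tk N (pw s) x := by
  rw [← Tk_const_mul (measurable_pw s)]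
  refine Tk_mono (fun τ hτ => ?_) x
  unfold mw pw
  rw [← ENNReal.ofReal_mul (by positivity)]
  exact ENNReal.ofReal_le_ofReal (mr_le hH hτ)

lemma Tk_pos {N : ℕ} {s : ℝ} (x : Euc N) : Tk N (pw s) x ≠ 0 := by
  unfold Tk
  have hm : Measurable fun τ => pw s τ * gE N τ x :=
    (measurable_pw s).mul ((measurable_gE N).comp (by fun_prop : Measurable fun τ : ℝ => (τ, x)))
  rw [← pos_iff_ne_zero, setLIntegral_pos_iff hm]
  have : Ioi (0:ℝ) ⊆ (Function.support fun τ => pw s τ * gE N τ x) ∩ Ioi 0 := by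
    intro τ (hτ : 0 < τ)
    refine ⟨?_, hτ⟩
    simp only [Function.mem_support, pw, gE, ne_eq, mul_eq_zero, ENNReal.ofReal_eq_zero, not_or, not_le]
    exact ⟨by positivity, gk_pos hτ x⟩
  refine lt_of_lt_of_le ?_ (measure_mono this)
  simp

lemma Tk_lt_top {N : ℕ} {s : ℝ} (hsN : 2 * s < N) {x : Euc N} (hs : 0 < s) (hx : ‖x‖ = 1) :
    Tk N (pw s) x < ⊤ := by
  unfold Tk
  have hsplit : Ioi (0:ℝ) = Ioc 0 1 ∪ Ioi 1 := (Ioc_union_Ioi_eq_Ioi zero_le_one).symm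
  rw [hsplit]
  refine lt_of_le_of_lt (lintegral_union_le _ _ _) (ENNReal.add_lt_top.2 ⟨?_, ?_⟩)
  · obtain ⟨k, hk⟩ := exists_nat_ge ((N:ℝ) / 2 + 1)
    calc _ ≤ ∫⁻ τ in Ioc (0:ℝ) 1, ENNReal.ofReal (k.factorial * 4 ^ k) := by
          refine setLIntegral_mono' measurableSet_Ioc fun τ hτ => ?_
          have hτ0 := hτ.1
          unfold pw gE
          rw [← ENNReal.ofReal_mul (by positivity)]
          apply ENNReal.ofReal_le_ofReal
          unfold gk
          rw [hx]
          have h1 := Real.pow_div_factorial_le_exp (1 / (4 * τ)) (by positivity) k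
          have h2 : Real.exp (-1 ^ 2 / (4 * τ)) ≤ k.factorial * (4 * τ) ^ k := by
            rw [show (-1 ^ 2 / (4 * τ)) = -(1 / (4 * τ)) by ring, Real.exp_neg]
            rw [div_pow, one_pow] at h1
            calc _ ≤ (1 / (4 * τ) ^ k / (k.factorial : ℝ))⁻¹ := inv_anti₀ (by positivity) h1
              _ = _ := by field_simp
          have h3 : (4 * π * τ) ^ (-(N : ℝ) / 2) ≤ τ ^ (-(N : ℝ) / 2) := by
            apply Real.rpow_le_rpow_of_nonpos hτ0
            · nlinarith [Real.pi_gt_three]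
            · have : (0:ℝ) ≤ N := Nat.cast_nonneg N
              linarith
          calc _ ≤ τ ^ (s-1) * (τ ^ (-(N : ℝ) / 2) * (k.factorial * (4 * τ) ^ k)) := by gcongr
            _ = (k.factorial * 4 ^ k) * (τ ^ (s - 1 + (-(N : ℝ) / 2) + k)) := by
              rw [Real.rpow_add hτ0, Real.rpow_add hτ0, Real.rpow_natCast]; ring
            _ ≤ (k.factorial * 4 ^ k) * 1 := by
              gcongr
              exact Real.rpow_le_one hτ0.le hτ.2 (by linarith)
            _ = _ := mul_one _
      _ < ⊤ := by simp [ENNReal.mul_lt_top_iff]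
  · calc _ ≤ ∫⁻ τ in Ioi (1:ℝ), ENNReal.ofReal (τ ^ (s - 1 - (N:ℝ)/2)) := by
          refine setLIntegral_mono' measurableSet_Ioi fun τ (hτ : 1 < τ) => ?_
          have hτ0 : 0 < τ := by linarith
          unfold pw gE
          rw [← ENNReal.ofReal_mul (by positivity)]
          apply ENNReal.ofReal_le_ofReal
          rw [show s - 1 - (N:ℝ)/2 = (s-1) + (-(N:ℝ)/2) by ring, Real.rpow_add hτ0]
          gcongr
          exact gk_le hτ0 x
      _ < ⊤ := by
        have := integrableOn_Ioi_rpow_of_lt (a := s - 1 - (N:ℝ)/2) (c := 1) (by linarith) one_pos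
        exact Integrable.lintegral_lt_top this

/-- Riesz kernel constant -/
noncomputable def cK (N : ℕ) (s : ℝ) : ℝ≥0∞ :=
  ∫⁻ τ in Ioi (0:ℝ), pw s τ * ENNReal.ofReal ((4 * π * τ) ^ (-(N : ℝ) / 2) * Real.exp (-1 ^ 2 / (4 * τ)))

lemma cK_eq {N : ℕ} {s : ℝ} {x : Euc N} (hx : ‖x‖ = 1) : Tk N (pw s) x = cK N s := by
  unfold Tk cK gE gk; rw [hx]

lemma exists_unit {N : ℕ} (hN : 1 ≤ N) : ∃ x : Euc N, ‖x‖ = 1 :=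
  ⟨EuclideanSpace.single ⟨0, hN⟩ 1, by simp⟩

lemma cK_ne_zero {N : ℕ} (hN : 1 ≤ N) (s : ℝ) : cK N s ≠ 0 := by
  obtain ⟨x, hx⟩ := exists_unit hN
  rw [← cK_eq hx]; exact Tk_pos x

lemma cK_ne_top {N : ℕ} (hN : 1 ≤ N) {s : ℝ} (hs : 0 < s) (hsN : 2 * s < N) : cK N s ≠ ⊤ := by
  obtain ⟨x, hx⟩ := exists_unit hN
  rw [← cK_eq hx]; exact (Tk_lt_top hsN hs hx).ne

lemma Tk_pw {N : ℕ} (hN : 1 ≤ N) {s : ℝ} (hs : 0 < s) (hsN : 2 * s < N) (x : Euc N) :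
    Tk N (pw s) x = cK N s * (ENNReal.ofReal ‖x‖) ^ (2 * s - (N:ℝ)) := by
  by_cases hx : x = 0
  · subst hx
    rw [norm_zero, ENNReal.ofReal_zero, ENNReal.zero_rpow_of_neg (by linarith),
      ENNReal.mul_top (cK_ne_zero hN s)]
    by_contra hne
    have h := Tk_pw_scale (N := N) (s := s) (t := 2) two_pos 0
    rw [smul_zero] at h
    have h2 : ENNReal.ofReal ((2:ℝ) ^ (s - (N : ℝ) / 2)) < 1 := by
      rw [ENNReal.ofReal_lt_one]
      exact Real.rpow_lt_one_of_one_lt_of_neg one_lt_two (by linarith)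
    have h3 : ENNReal.ofReal ((2:ℝ) ^ (s - (N : ℝ) / 2)) * Tk N (pw s) (0 : Euc N) <
        1 * Tk N (pw s) (0 : Euc N) := by
      exact (ENNReal.mul_lt_mul_iff_left (Tk_pos 0) hne).2 h2
    rw [← h, one_mul] at h3
    exact lt_irrefl _ h3
  · have hr : 0 < ‖x‖ := norm_pos_iff.2 hx
    have e : Real.sqrt (‖x‖ ^ 2) • (‖x‖⁻¹ • x) = x := by
      rw [Real.sqrt_sq hr.le, smul_smul, mul_inv_cancel₀ hr.ne', one_smul]
    have hn : ‖(‖x‖⁻¹ • x)‖ = 1 := by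
      rw [norm_smul, norm_inv, norm_norm, inv_mul_cancel₀ hr.ne']
    have h := Tk_pw_scale (N := N) (s := s) (t := ‖x‖ ^ 2) (by positivity) (‖x‖⁻¹ • x)
    rw [e, cK_eq hn] at h
    rw [h, mul_comm, ENNReal.ofReal_rpow_of_pos hr, ← Real.rpow_natCast, ← Real.rpow_mul hr.le]
    congr 3; push_cast; ring

lemma Tk_mw_lower {N : ℕ} {s : ℝ} (hs : 0 < s) (hs1 : s ≤ 1) {R : ℝ} (hR : 0 ≤ R) :
    ∃ c : ℝ, 0 < c ∧ ∀ H : ℝ, 0 < H → ∀ z : Euc N, ‖z‖ ^ 2 ≤ R * H →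
      ENNReal.ofReal (c * H ^ (-(N:ℝ)/2)) ≤ Tk N (mw s H) z := by
  set c : ℝ := (4 * π) ^ (-(N : ℝ) / 2) * Real.exp (-(2 * R) / 4) / 2 with hc
  have hc0 : 0 < c := by positivity
  refine ⟨c, hc0, fun H hH z hz => ?_⟩
  have hsq : 0 < Real.sqrt H := Real.sqrt_pos.2 hH
  have e : z = Real.sqrt H • ((Real.sqrt H)⁻¹ • z) := by
    rw [smul_smul, mul_inv_cancel₀ hsq.ne', one_smul]
  set x := (Real.sqrt H)⁻¹ • z with hx
  have hxn : ‖x‖ ^ 2 ≤ R := by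
    rw [hx, norm_smul, mul_pow, norm_inv, Real.norm_eq_abs, inv_pow, sq_abs, Real.sq_sqrt hH.le]
    rw [inv_mul_le_iff₀ hH]; linarith
  rw [e, Tk_mw_scale hH, mul_comm c, ENNReal.ofReal_mul (by positivity)]
  gcongr
  calc ENNReal.ofReal c = ∫⁻ τ in Ioo (1/2:ℝ) 1, ENNReal.ofReal (2 * c) := by
        rw [setLIntegral_const, Real.volume_Ioo, ← ENNReal.ofReal_mul (by positivity)]
        congr 1; ring
    _ ≤ ∫⁻ τ in Ioo (1/2:ℝ) 1, mw s 1 τ * gE N τ x := by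
        refine setLIntegral_mono' measurableSet_Ioo fun τ hτ => ?_
        have hτ0 : 0 < τ := by linarith [hτ.1]
        unfold mw gE
        rw [mr_eq hs hτ0 hτ.2.le, Real.one_rpow, one_mul, ← ENNReal.ofReal_mul (by positivity)]
        apply ENNReal.ofReal_le_ofReal
        have h1 : 1 ≤ τ ^ (s - 1) :=
          Real.one_le_rpow_of_pos_of_le_one_of_nonpos hτ0 hτ.2.le (by linarith)
        have h2 := gk_lower (R := 2 * R) hτ0 x (by nlinarith [hτ.1])
        have h3 : 1 ≤ τ ^ (-(N:ℝ)/2) := by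
          apply Real.one_le_rpow_of_pos_of_le_one_of_nonpos hτ0 hτ.2.le
          have : (0:ℝ) ≤ N := Nat.cast_nonneg N
          linarith
        calc 2 * c = ((4 * π) ^ (-(N : ℝ) / 2) * Real.exp (-(2 * R) / 4)) * 1 := by rw [hc]; ring
          _ ≤ ((4 * π) ^ (-(N : ℝ) / 2) * Real.exp (-(2 * R) / 4)) * τ ^ (-(N:ℝ)/2) := by gcongr
          _ ≤ gk N τ x := h2
          _ = 1 * gk N τ x := (one_mul _).symm
          _ ≤ _ := by
            have := (gk_pos (N := N) hτ0 x).le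
            gcongr
    _ ≤ _ := lintegral_mono_set (fun τ hτ => by
        have := hτ.1
        simp only [mem_Ioi]; linarith)

/-! ### Euler-Lagrange -/

/-- bilinear energy -/
noncomputable def bil (N : ℕ) (W : Euc N → ℝ≥0∞) (μ ν : Measure (Euc N)) : ℝ≥0∞ :=
  ∫⁻ x, ∫⁻ y, W (x - y) ∂ν ∂μ

lemma meas_pot {N : ℕ} {W : Euc N → ℝ≥0∞} (hW : Measurable W) (μ : Measure (Euc N)) [SFinite μ] :
    Measurable fun x => ∫⁻ y, W (x - y) ∂μ := by
  apply Measurable.lintegral_prod_right' (f := fun p : Euc N × Euc N => W (p.1 - p.2))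
  exact hW.comp (measurable_fst.sub measurable_snd)

lemma bil_add_left {N : ℕ} {W : Euc N → ℝ≥0∞} (μ μ' ν : Measure (Euc N)) :
    bil N W (μ + μ') ν = bil N W μ ν + bil N W μ' ν := by
  unfold bil; rw [lintegral_add_measure]

lemma bil_add_right {N : ℕ} {W : Euc N → ℝ≥0∞} (hW : Measurable W) (μ ν ν' : Measure (Euc N))
    [SFinite ν] [SFinite ν'] :
    bil N W μ (ν + ν') = bil N W μ ν + bil N W μ ν' := by
  unfold bil
  rw [← lintegral_add_left (meas_pot hW ν)]
  simp_rw [lintegral_add_measure]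

lemma bil_smul_left {N : ℕ} {W : Euc N → ℝ≥0∞} (c : ℝ≥0∞) (μ ν : Measure (Euc N)) :
    bil N W (c • μ) ν = c * bil N W μ ν := by
  unfold bil; rw [lintegral_smul_measure, smul_eq_mul]

lemma bil_smul_right {N : ℕ} {W : Euc N → ℝ≥0∞} (hW : Measurable W) (c : ℝ≥0∞)
    (μ ν : Measure (Euc N)) [SFinite ν] :
    bil N W μ (c • ν) = c * bil N W μ ν := by
  unfold bil
  rw [← lintegral_const_mul _ (meas_pot hW ν)]
  simp_rw [lintegral_smul_measure, smul_eq_mul]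

lemma bil_symm {N : ℕ} {W : Euc N → ℝ≥0∞} (hW : Measurable W) (hs : ∀ x, W (-x) = W x)
    (μ ν : Measure (Euc N)) [SFinite μ] [SFinite ν] : bil N W μ ν = bil N W ν μ := by
  unfold bil
  rw [lintegral_lintegral_swap]
  · refine lintegral_congr fun x => lintegral_congr fun y => ?_
    rw [← hs, neg_sub]
  · exact (hW.comp (measurable_fst.sub measurable_snd)).aemeasurable

lemma bil_mono_left {N : ℕ} {W : Euc N → ℝ≥0∞} {μ μ' : Measure (Euc N)} (h : μ ≤ μ')
    (ν : Measure (Euc N)) : bil N W μ ν ≤ bil N W μ' ν := by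
  unfold bil; exact lintegral_mono' h le_rfl

lemma bil_mono_right {N : ℕ} {W : Euc N → ℝ≥0∞} {ν ν' : Measure (Euc N)} (μ : Measure (Euc N))
    (h : ν ≤ ν') : bil N W μ ν ≤ bil N W μ ν' := by
  unfold bil; exact lintegral_mono fun x => lintegral_mono' h le_rfl

lemma sq_norm_sub_le {N : ℕ} (x y : Euc N) : ENNReal.ofReal (‖x - y‖ ^ 2) ≤
    2 * ENNReal.ofReal (‖x‖ ^ 2) + 2 * ENNReal.ofReal (‖y‖ ^ 2) := by
  calc _ ≤ ENNReal.ofReal (2 * ‖x‖ ^ 2 + 2 * ‖y‖ ^ 2) := by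
        apply ENNReal.ofReal_le_ofReal
        have := norm_sub_le x y
        nlinarith [sq_nonneg (‖x‖ - ‖y‖), norm_nonneg (x - y), norm_nonneg x, norm_nonneg y]
    _ = _ := by
        rw [ENNReal.ofReal_add (by positivity) (by positivity), ENNReal.ofReal_mul (by norm_num),
          ENNReal.ofReal_mul (by norm_num), ENNReal.ofReal_ofNat]

/-- the variation -/
lemma variation {N : ℕ} {W : Euc N → ℝ≥0∞} (hW : Measurable W) (hsym : ∀ x, W (-x) = W x)
    {μ : Measure (Euc N)} (hmin : IsLocalMin2 N W μ) {A : Set (Euc N)} (hA : MeasurableSet A)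
    {τ : Measure (Euc N)} (hτ : IsProb2 N τ) (hττ : bil N W τ τ < ⊤) :
    bil N W (μ.restrict A) μ ≤ μ A * bil N W τ μ := by
  obtain ⟨ε, hε, hμ2, hE, hmin⟩ := hmin
  have := hμ2.1
  have := hτ.1
  set μA := μ.restrict A with hμA
  have hμA1 : μA ≤ μ := Measure.restrict_le_self
  have hBμ : bil N W μ μ ≠ ⊤ := by
    intro h
    unfold interE at hE
    unfold bil at h
    rw [h, ENNReal.mul_top (by simp)] at hE
    exact lt_irrefl _ hE
  have hAA : bil N W μA μA ≠ ⊤ :=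
    ne_top_of_le_ne_top hBμ ((bil_mono_left hμA1 _).trans (bil_mono_right _ hμA1))
  have hA1 : μ A ≤ 1 := prob_le_one
  -- finite cost
  set D : ℝ≥0∞ := ∫⁻ p : Euc N × Euc N, ENNReal.ofReal (‖p.1 - p.2‖ ^ 2) ∂(τ.prod μA) with hD
  have hDt : D < ⊤ := by
    have hm : Measurable fun p : Euc N × Euc N => ENNReal.ofReal (‖p.1 - p.2‖ ^ 2) := by fun_prop
    have hm1 : Measurable fun p : Euc N => ENNReal.ofReal (‖p‖ ^ 2) := by fun_prop
    rw [hD, lintegral_prod _ hm.aemeasurable]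
    calc _ ≤ ∫⁻ x, ∫⁻ y, (2 * ENNReal.ofReal (‖x‖ ^ 2) + 2 * ENNReal.ofReal (‖y‖ ^ 2)) ∂μA ∂τ :=
          lintegral_mono fun x => lintegral_mono fun y => sq_norm_sub_le x y
      _ ≤ ∫⁻ x, ∫⁻ y, (2 * ENNReal.ofReal (‖x‖ ^ 2) + 2 * ENNReal.ofReal (‖y‖ ^ 2)) ∂μ ∂τ :=
          lintegral_mono fun x => lintegral_mono' hμA1 le_rfl
      _ = ∫⁻ x, (2 * ENNReal.ofReal (‖x‖ ^ 2) + 2 * ∫⁻ y, ENNReal.ofReal (‖y‖ ^ 2) ∂μ) ∂τ := by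
          refine lintegral_congr fun x => ?_
          rw [lintegral_add_left measurable_const, lintegral_const, measure_univ, mul_one,
            lintegral_const_mul _ hm1]
      _ = 2 * (∫⁻ x, ENNReal.ofReal (‖x‖ ^ 2) ∂τ) + 2 * ∫⁻ y, ENNReal.ofReal (‖y‖ ^ 2) ∂μ := by
          rw [lintegral_add_right _ measurable_const, lintegral_const, measure_univ, mul_one,
            lintegral_const_mul _ hm1]
      _ < ⊤ := by
          have h1 := hτ.2
          have h2 := hμ2.2
          exact ENNReal.add_lt_top.2 ⟨ENNReal.mul_lt_top (by simp) h1, ENNReal.mul_lt_top (by simp) h2⟩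
  have key : ∀ t : ℝ, 0 < t → t ≤ 1 → ENNReal.ofReal t * D ≤ ENNReal.ofReal (ε ^ 2) →
      bil N W μA μ ≤ μ A * bil N W τ μ + ENNReal.ofReal t * (bil N W τ τ + bil N W μA μA) := by
    intro t ht0 ht1 htD
    set T := ENNReal.ofReal t with hT
    have hT0 : T ≠ 0 := by simp [hT, ht0]
    have hTt : T ≠ ⊤ := ENNReal.ofReal_ne_top
    set η : Measure (Euc N) := μ.restrict Aᶜ + ENNReal.ofReal (1 - t) • μA with hη
    have hsum : η + T • μA = μ := by
      rw [hη, add_assoc, ← add_smul, hT, ← ENNReal.ofReal_add (by linarith) ht0.le]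
      simp only [sub_add_cancel, ENNReal.ofReal_one, one_smul]
      rw [add_comm, Measure.restrict_add_restrict_compl hA]
    have hημ : η ≤ μ := by
      conv_rhs => rw [← hsum]
      exact Measure.le_add_right le_rfl
    have : IsFiniteMeasure η := isFiniteMeasure_of_le μ hημ
    clear_value η
    obtain ⟨ν, hν⟩ : ∃ ν, ν = η + (T * μ A) • τ := ⟨_, rfl⟩
    have hTA : T * μ A ≠ ⊤ := ENNReal.mul_ne_top hTt (measure_ne_top _ _)
    have : IsFiniteMeasure ((T * μ A) • τ) := by
      constructor; rw [Measure.smul_apply, smul_eq_mul]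
      exact ENNReal.mul_lt_top hTA.lt_top (measure_lt_top _ _)
    have : IsFiniteMeasure (T • μA) := by
      constructor; rw [Measure.smul_apply, smul_eq_mul]
      exact ENNReal.mul_lt_top hTt.lt_top (measure_lt_top _ _)
    -- the plan
    set pl : Measure (Euc N × Euc N) := η.map (fun x => (x, x)) + T • (τ.prod μA) with hpl
    have hdm : Measurable fun x : Euc N => (x, x) := by fun_prop
    have hf : pl.map Prod.fst = ν := by
      rw [hpl, Measure.map_add _ _ measurable_fst, Measure.map_map measurable_fst hdm,
        Measure.map_smul, Measure.map_fst_prod, hν, hμA, Measure.restrict_apply_univ, smul_smul]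
      congr 1
      exact Measure.map_id
    have hsn : pl.map Prod.snd = μ := by
      rw [hpl, Measure.map_add _ _ measurable_snd, Measure.map_map measurable_snd hdm,
        Measure.map_smul, Measure.map_snd_prod, measure_univ, one_smul]
      conv_rhs => rw [← hsum]
      congr 1
      exact Measure.map_id
    have hplp : IsProbabilityMeasure pl := by
      constructor
      rw [← Set.preimage_univ (f := Prod.snd), ← Measure.map_apply measurable_snd MeasurableSet.univ,
        hsn, measure_univ]
    have hνp : IsProbabilityMeasure ν := by
      rw [← hf]; exact Measure.isProbabilityMeasure_map measurable_fst.aemeasurable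
    have hν2 : IsProb2 N ν := by
      refine ⟨hνp, ?_⟩
      rw [hν, lintegral_add_measure, lintegral_smul_measure, smul_eq_mul]
      refine ENNReal.add_lt_top.2 ⟨lt_of_le_of_lt (lintegral_mono' hημ le_rfl) hμ2.2, ?_⟩
      exact ENNReal.mul_lt_top hTA.lt_top hτ.2
    have hw : wass2 N ν μ ≤ ENNReal.ofReal ε := by
      unfold wass2
      refine (iInf₂_le pl ⟨hplp, hf, hsn⟩).trans ?_
      have hm : Measurable fun p : Euc N × Euc N => ENNReal.ofReal (‖p.1 - p.2‖ ^ 2) := by fun_prop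
      have : ∫⁻ p : Euc N × Euc N, ENNReal.ofReal (‖p.1 - p.2‖ ^ 2) ∂pl = T * D := by
        rw [hpl, lintegral_add_measure, lintegral_smul_measure, smul_eq_mul, lintegral_map hm hdm]
        simp [hD]
      rw [this]
      calc (T * D) ^ (1/2:ℝ) ≤ (ENNReal.ofReal (ε ^ 2)) ^ (1/2:ℝ) := by gcongr
        _ = ENNReal.ofReal ε := by
          rw [ENNReal.ofReal_rpow_of_pos (by positivity), ← Real.sqrt_eq_rpow, Real.sqrt_sq hε.le]
    have hEE := hmin ν hν2 hw
    have hEE' : bil N W μ μ ≤ bil N W ν ν := by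
      unfold interE at hEE
      exact (ENNReal.mul_le_mul_iff_right (by simp) (by simp)).1 hEE
    have e1 : bil N W μ μ = bil N W η η + 2 * T * bil N W μA η + T ^ 2 * bil N W μA μA := by
      conv_lhs => rw [← hsum]
      rw [bil_add_left, bil_add_right hW, bil_add_right hW, bil_smul_left, bil_smul_left,
        bil_smul_right hW, bil_smul_right hW, bil_symm hW hsym η μA]
      ring
    have e2 : bil N W ν ν = bil N W η η + 2 * T * (μ A * bil N W τ η) +
        T ^ 2 * (μ A ^ 2 * bil N W τ τ) := by
      rw [hν, bil_add_left, bil_add_right hW, bil_add_right hW, bil_smul_left, bil_smul_left,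
        bil_smul_right hW, bil_smul_right hW, bil_symm hW hsym η τ]
      ring
    have hηη : bil N W η η ≠ ⊤ :=
      ne_top_of_le_ne_top hBμ ((bil_mono_left hημ _).trans (bil_mono_right _ hημ))
    rw [e1, e2, add_assoc, add_assoc, ENNReal.add_le_add_iff_left hηη] at hEE'
    have h3 : T * (2 * bil N W μA η) ≤ T * (2 * (μ A * bil N W τ η) + T * (μ A ^ 2 * bil N W τ τ)) := by
      calc _ ≤ 2 * T * bil N W μA η + T ^ 2 * bil N W μA μA := by
            rw [show T * (2 * bil N W μA η) = 2 * T * bil N W μA η by ring]; exact le_self_add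
        _ ≤ _ := hEE'
        _ = _ := by ring
    rw [ENNReal.mul_le_mul_iff_right hT0 hTt] at h3
    have h4 : 2 * bil N W μA η ≤ 2 * (μ A * bil N W τ μ + T * bil N W τ τ) := by
      calc _ ≤ _ := h3
        _ ≤ 2 * (μ A * bil N W τ μ) + T * (1 ^ 2 * bil N W τ τ) := by
          gcongr
          exact bil_mono_right _ hημ
        _ ≤ 2 * (μ A * bil N W τ μ) + 2 * (T * bil N W τ τ) := by
          rw [one_pow, one_mul]
          refine add_le_add le_rfl ?_
          rw [two_mul (T * bil N W τ τ)]; exact le_self_add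
        _ = _ := by ring
    rw [ENNReal.mul_le_mul_iff_right (by simp) (by simp)] at h4
    calc bil N W μA μ = bil N W μA η + T * bil N W μA μA := by
          conv_lhs => rw [← hsum]
          rw [bil_add_right hW, bil_smul_right hW]
      _ ≤ (μ A * bil N W τ μ + T * bil N W τ τ) + T * bil N W μA μA := by gcongr
      _ = _ := by ring
  -- t → 0
  have hC : bil N W τ τ + bil N W μA μA ≠ ⊤ := ENNReal.add_ne_top.2 ⟨hττ.ne, hAA⟩
  have hlim : Tendsto (fun t : ℝ => μ A * bil N W τ μ + ENNReal.ofReal t * (bil N W τ τ + bil N W μA μA))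
      (𝓝[>] 0) (𝓝 (μ A * bil N W τ μ + ENNReal.ofReal 0 * (bil N W τ τ + bil N W μA μA))) := by
    refine Tendsto.const_add _ (ENNReal.Tendsto.mul_const ?_ (Or.inr hC))
    exact (ENNReal.continuous_ofReal.tendsto 0).mono_left nhdsWithin_le_nhds
  have hlim2 : Tendsto (fun t : ℝ => ENNReal.ofReal t * D) (𝓝[>] 0) (𝓝 (ENNReal.ofReal 0 * D)) := by
    refine ENNReal.Tendsto.mul_const ?_ (Or.inr hDt.ne)
    exact (ENNReal.continuous_ofReal.tendsto 0).mono_left nhdsWithin_le_nhds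
  simp only [ENNReal.ofReal_zero, zero_mul, add_zero] at hlim hlim2
  refine ge_of_tendsto hlim ?_
  have ev1 : ∀ᶠ t in 𝓝[>] (0:ℝ), ENNReal.ofReal t * D < ENNReal.ofReal (ε ^ 2) :=
    hlim2.eventually_lt_const (by simp; positivity)
  have ev2 : ∀ᶠ t in 𝓝[>] (0:ℝ), t ≤ 1 :=
    nhdsWithin_le_nhds (Iic_mem_nhds zero_lt_one)
  filter_upwards [ev1, ev2, self_mem_nhdsWithin] with t h1 h2 h3
  exact key t h3 h2 h1.le

/-- attractive potential -/
noncomputable def Ua (N : ℕ) (a : ℝ) (μ : Measure (Euc N)) (x : Euc N) : ℝ≥0∞ :=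
  ∫⁻ y, ENNReal.ofReal (‖x - y‖ ^ a / a) ∂μ

/-- constant linking `u` and the Riesz potential -/
noncomputable def c0 (N : ℕ) (s : ℝ) : ℝ≥0∞ := (cK N s * ENNReal.ofReal ((N:ℝ) - 2 * s))⁻¹

lemma c0_ne_top {N : ℕ} (hN : 1 ≤ N) {s : ℝ} (hsN : 2 * s < N) : c0 N s ≠ ⊤ := by
  unfold c0
  rw [ENNReal.inv_ne_top]
  refine mul_ne_zero (cK_ne_zero hN s) ?_
  simp; linarith

lemma c0_ne_zero {N : ℕ} (hN : 1 ≤ N) {s : ℝ} (hs : 0 < s) (hsN : 2 * s < N) : c0 N s ≠ 0 := by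
  unfold c0
  rw [ENNReal.inv_ne_zero]
  exact ENNReal.mul_ne_top (cK_ne_top hN hs hsN) ENNReal.ofReal_ne_top

lemma W_eq {N : ℕ} (hN : 1 ≤ N) {s a : ℝ} (hs : 0 < s) (hsN : 2 * s < N) (x : Euc N) :
    powerLawW N s a x = ENNReal.ofReal (‖x‖ ^ a / a) + c0 N s * Tk N (pw s) x := by
  unfold powerLawW c0
  rw [Tk_pw hN hs hsN]
  congr 1
  rw [ENNReal.mul_inv (Or.inl (cK_ne_zero hN s)) (Or.inl (cK_ne_top hN hs hsN)),
    div_eq_mul_inv]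
  calc _ = 1 * ((ENNReal.ofReal ‖x‖) ^ (2 * s - (N:ℝ)) * (ENNReal.ofReal ((N:ℝ) - 2 * s))⁻¹) := by
        rw [one_mul]
    _ = ((cK N s)⁻¹ * cK N s) * ((ENNReal.ofReal ‖x‖) ^ (2 * s - (N:ℝ)) *
          (ENNReal.ofReal ((N:ℝ) - 2 * s))⁻¹) := by
        rw [ENNReal.inv_mul_cancel (cK_ne_zero hN s) (cK_ne_top hN hs hsN)]
    _ = _ := by ring

lemma W_cont {N : ℕ} {s a : ℝ} (hsN : 2 * s < N) (ha : 0 < a) : Continuous (powerLawW N s a) := by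
  unfold powerLawW
  have h1 : Continuous fun x : Euc N => ENNReal.ofReal (‖x‖ ^ a / a) := by
    refine ENNReal.continuous_ofReal.comp ?_
    exact (continuous_norm.rpow_const (fun x => Or.inr ha.le)).div_const a
  have h2 : Continuous fun x : Euc N => (ENNReal.ofReal ‖x‖) ^ (2 * s - (N : ℝ)) / ENNReal.ofReal ((N : ℝ) - 2 * s) := by
    simp_rw [div_eq_mul_inv]
    refine ENNReal.continuous_mul_const ?_ |>.comp ?_
    · rw [ENNReal.inv_ne_top]; simp; linarith
    · exact ENNReal.continuous_rpow_const.comp (ENNReal.continuous_ofReal.comp continuous_norm)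
  exact h1.add h2

lemma W_neg {N : ℕ} {s a : ℝ} (x : Euc N) : powerLawW N s a (-x) = powerLawW N s a x := by
  simp [powerLawW]

lemma measurable_Ua {N : ℕ} (a : ℝ) (μ : Measure (Euc N)) [SFinite μ] : Measurable (Ua N a μ) := by
  unfold Ua
  apply Measurable.lintegral_prod_right' (f := fun p : Euc N × Euc N => ENNReal.ofReal (‖p.1 - p.2‖ ^ a / a))
  fun_prop

lemma pot_eq {N : ℕ} (hN : 1 ≤ N) {s a : ℝ} (hs : 0 < s) (hsN : 2 * s < N) (μ : Measure (Euc N))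
    (x : Euc N) :
    ∫⁻ y, powerLawW N s a (x - y) ∂μ = Ua N a μ x + c0 N s * Tm N (pw s) μ x := by
  simp_rw [W_eq hN hs hsN]
  unfold Ua Tm
  have hm : Measurable fun y => Tk N (pw s) (x - y) :=
    (measurable_Tk (measurable_pw s)).comp (measurable_const.sub measurable_id)
  rw [lintegral_add_left (by fun_prop), lintegral_const_mul _ hm]

lemma heat_add {N : ℕ} {f g : Euc N → ℝ≥0∞} (hf : Measurable f) (h : ℝ) (x : Euc N) :
    heat N h (fun y => f y + g y) x = heat N h f x + heat N h g x := by
  unfold heat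
  exact lintegral_add_left (hf.comp (measurable_const.sub measurable_id)) _

lemma heat_const_mul {N : ℕ} {f : Euc N → ℝ≥0∞} (hf : Measurable f) (c : ℝ≥0∞) (h : ℝ) (x : Euc N) :
    heat N h (fun y => c * f y) x = c * heat N h f x := by
  unfold heat
  exact lintegral_const_mul _ (hf.comp (measurable_const.sub measurable_id))

lemma heat_mono {N : ℕ} {f g : Euc N → ℝ≥0∞} (hfg : ∀ x, f x ≤ g x) (h : ℝ) (x : Euc N) :
    heat N h f x ≤ heat N h g x := lintegral_mono fun _ => hfg _

lemma rpow_add_le' {x y a : ℝ} (hx : 0 ≤ x) (hy : 0 ≤ y) (ha : 0 ≤ a) :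
    (x + y) ^ a ≤ 2 ^ a * (x ^ a + y ^ a) := by
  have h1 : x + y ≤ 2 * max x y := by
    have := le_max_left x y
    have := le_max_right x y
    linarith
  calc (x + y) ^ a ≤ (2 * max x y) ^ a := Real.rpow_le_rpow (by positivity) h1 ha
    _ = 2 ^ a * (max x y) ^ a := Real.mul_rpow (by norm_num) (le_max_of_le_left hx)
    _ ≤ _ := by
      gcongr
      rcases max_cases x y with h | h <;> rw [h.1]
      · have := Real.rpow_nonneg hy a; linarith
      · have := Real.rpow_nonneg hx a; linarith

lemma norm_rpow_le {N : ℕ} {a : ℝ} (ha : 0 < a) (x y : Euc N) :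
    ENNReal.ofReal (‖x - y‖ ^ a / a) ≤ ENNReal.ofReal (2 ^ a / a) *
      (ENNReal.ofReal (‖x‖ ^ a) + ENNReal.ofReal (‖y‖ ^ a)) := by
  rw [← ENNReal.ofReal_add (by positivity) (by positivity), ← ENNReal.ofReal_mul (by positivity)]
  apply ENNReal.ofReal_le_ofReal
  calc ‖x - y‖ ^ a / a ≤ (‖x‖ + ‖y‖) ^ a / a := by
        gcongr; exact norm_sub_le x y
    _ ≤ (2 ^ a * (‖x‖ ^ a + ‖y‖ ^ a)) / a := by
        gcongr; exact rpow_add_le' (norm_nonneg _) (norm_nonneg _) ha.le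
    _ = _ := by ring

lemma gam_moment' (N : ℕ) {p h : ℝ} (hp : 0 ≤ p) (hh : 0 < h) :
    ∫⁻ z, ENNReal.ofReal (‖z‖ ^ p) ∂(gam N h) < ⊤ := by
  rw [gam_scale hh _ (by fun_prop)]
  have : ∀ z : Euc N, ENNReal.ofReal (‖Real.sqrt h • z‖ ^ p)
      = ENNReal.ofReal (Real.sqrt h ^ p) * ENNReal.ofReal (‖z‖ ^ p) := by
    intro z
    rw [norm_smul, Real.norm_of_nonneg (Real.sqrt_nonneg _),
      Real.mul_rpow (Real.sqrt_nonneg _) (norm_nonneg _), ENNReal.ofReal_mul (by positivity)]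
  simp_rw [this]
  rw [lintegral_const_mul _ (by fun_prop)]
  exact ENNReal.mul_lt_top ENNReal.ofReal_lt_top (gam_moment N hp)

/-- sup bound of `heat h u` -/
noncomputable def Cb (N : ℕ) (s h : ℝ) : ℝ≥0∞ :=
  ∫⁻ τ in Ioi (0:ℝ), (Ioi h).indicator (fun τ => pw s (τ - h)) τ * ENNReal.ofReal (τ ^ (-(N:ℝ)/2))

lemma Cb_lt_top {N : ℕ} {s h : ℝ} (hs : 0 < s) (hs1 : s ≤ 1) (hsN : 2 * s < N) (hh : 0 < h) :
    Cb N s h < ⊤ := by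
  have hN0 : (0:ℝ) ≤ N := Nat.cast_nonneg N
  have e : Cb N s h = ∫⁻ τ in Ioi h, pw s (τ - h) * ENNReal.ofReal (τ ^ (-(N:ℝ)/2)) := by
    unfold Cb
    rw [← lintegral_indicator measurableSet_Ioi, ← lintegral_indicator measurableSet_Ioi]
    refine lintegral_congr fun τ => ?_
    by_cases h1 : h < τ
    · have h2 : 0 < τ := hh.trans h1
      simp [h1, h2]
    · simp [h1, indicator]
  rw [e, ← Ioc_union_Ioi_eq_Ioi (by linarith : h ≤ h + 1)]
  refine lt_of_le_of_lt (lintegral_union_le _ _ _) (ENNReal.add_lt_top.2 ⟨?_, ?_⟩)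
  · have h1 : ∫⁻ τ in Ioo h (h+1), ENNReal.ofReal ((τ - h) ^ (s - 1)) < ⊤ := by
      rw [lint_deriv (F := fun τ => (τ - h) ^ s / s) (by linarith)]
      · exact ENNReal.ofReal_lt_top
      · apply ContinuousOn.div_const
        apply ContinuousOn.rpow_const (by fun_prop)
        intro x _; right; exact hs.le
      · intro x hx
        have hx0 : 0 < x - h := by linarith [hx.1]
        have := (((hasDerivAt_id x).sub_const h).rpow_const (p := s) (Or.inl hx0.ne')).div_const s
        refine this.congr_deriv ?_
        simp only [id]
        field_simp
      · intro x hx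
        have hx0 : 0 < x - h := by linarith [hx.1]
        positivity
    rw [setLIntegral_congr Ioo_ae_eq_Ioc.symm]
    calc _ ≤ ∫⁻ τ in Ioo h (h+1), ENNReal.ofReal ((τ - h) ^ (s - 1)) * ENNReal.ofReal (h ^ (-(N:ℝ)/2)) := by
          refine setLIntegral_mono' measurableSet_Ioo fun τ hτ => ?_
          unfold pw
          exact mul_le_mul_right (ENNReal.ofReal_le_ofReal (Real.rpow_le_rpow_of_nonpos hh hτ.1.le (by linarith))) _
      _ < ⊤ := by
        rw [lintegral_mul_const _ (by fun_prop)]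
        exact ENNReal.mul_lt_top h1 ENNReal.ofReal_lt_top
  · calc _ ≤ ∫⁻ τ in Ioi (h+1), ENNReal.ofReal (((h+1)⁻¹) ^ (s-1)) * ENNReal.ofReal (τ ^ (s - 1 - (N:ℝ)/2)) := by
          refine setLIntegral_mono' measurableSet_Ioi fun τ (hτ : h + 1 < τ) => ?_
          have hτ0 : 0 < τ := by linarith
          unfold pw
          have hth : 0 < τ - h := by linarith
          have hh1 : 0 < h + 1 := by linarith
          rw [← ENNReal.ofReal_mul (by positivity), ← ENNReal.ofReal_mul (by positivity)]
          apply ENNReal.ofReal_le_ofReal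
          rw [show s - 1 - (N:ℝ)/2 = (s-1) + (-(N:ℝ)/2) by ring, Real.rpow_add hτ0, ← mul_assoc,
            ← Real.mul_rpow (by positivity) hτ0.le]
          refine mul_le_mul_of_nonneg_right (Real.rpow_le_rpow_of_nonpos (by positivity) ?_ (by linarith)) (by positivity)
          rw [inv_mul_le_iff₀ (by positivity)]
          nlinarith
      _ < ⊤ := by
        rw [lintegral_const_mul _ (by fun_prop)]
        refine ENNReal.mul_lt_top ENNReal.ofReal_lt_top ?_
        have := integrableOn_Ioi_rpow_of_lt (a := s - 1 - (N:ℝ)/2) (c := h + 1) (by linarith) (by linarith)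
        exact Integrable.lintegral_lt_top this

lemma heat_u_le {N : ℕ} {s h : ℝ} (hh : 0 < h) (μ : Measure (Euc N)) [IsProbabilityMeasure μ]
    (x : Euc N) : heat N h (Tm N (pw s) μ) x ≤ Cb N s h := by
  rw [heat_Tm (measurable_pw s) μ hh]
  refine setLIntegral_mono' measurableSet_Ioi fun τ (hτ : 0 < τ) => ?_
  gcongr
  unfold pm
  calc _ ≤ ∫⁻ y, ENNReal.ofReal (τ ^ (-(N:ℝ)/2)) ∂μ :=
        lintegral_mono fun y => ENNReal.ofReal_le_ofReal (gk_le hτ _)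
    _ = _ := by simp

lemma heat_U_lt_top {N : ℕ} {a h : ℝ} (ha : 0 < a) (hh : 0 < h) (μ : Measure (Euc N))
    [IsProbabilityMeasure μ] (hμ : ∫⁻ y, ENNReal.ofReal (‖y‖ ^ a) ∂μ < ⊤) (x : Euc N) :
    heat N h (Ua N a μ) x < ⊤ := by
  have := gam_prob N hh
  unfold heat Ua
  have h1 := gam_moment' N ha.le hh
  calc _ ≤ ∫⁻ z, ∫⁻ y, ENNReal.ofReal (2 ^ a / a) * ((ENNReal.ofReal (2 ^ a / a * a) *
      (ENNReal.ofReal (‖x‖ ^ a) + ENNReal.ofReal (‖z‖ ^ a))) + ENNReal.ofReal (‖y‖ ^ a)) ∂μ ∂(gam N h) := by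
        refine lintegral_mono fun z => lintegral_mono fun y => (norm_rpow_le ha _ y).trans ?_
        gcongr
        have := norm_rpow_le ha x z
        calc _ = ENNReal.ofReal (‖x - z‖ ^ a / a) * ENNReal.ofReal a := by
              rw [← ENNReal.ofReal_mul (by positivity)]; congr 1; field_simp
          _ ≤ _ := mul_le_mul_left this _
          _ = _ := by rw [ENNReal.ofReal_mul (p := 2 ^ a / a) (by positivity)]; ring
    _ = ENNReal.ofReal (2 ^ a / a) * (ENNReal.ofReal (2 ^ a / a * a) * (ENNReal.ofReal (‖x‖ ^ a) +
        ∫⁻ z, ENNReal.ofReal (‖z‖ ^ a) ∂(gam N h)) + ∫⁻ y, ENNReal.ofReal (‖y‖ ^ a) ∂μ) := by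
        have : ∀ z : Euc N, ∫⁻ y, ENNReal.ofReal (2 ^ a / a) * ((ENNReal.ofReal (2 ^ a / a * a) *
          (ENNReal.ofReal (‖x‖ ^ a) + ENNReal.ofReal (‖z‖ ^ a))) + ENNReal.ofReal (‖y‖ ^ a)) ∂μ =
          ENNReal.ofReal (2 ^ a / a) * ((ENNReal.ofReal (2 ^ a / a * a) *
          (ENNReal.ofReal (‖x‖ ^ a) + ENNReal.ofReal (‖z‖ ^ a))) + ∫⁻ y, ENNReal.ofReal (‖y‖ ^ a) ∂μ) := by
          intro z
          rw [lintegral_const_mul _ (by fun_prop), lintegral_add_left measurable_const, lintegral_const,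
            measure_univ, mul_one]
        simp_rw [this]
        rw [lintegral_const_mul _ (by fun_prop), lintegral_add_right _ measurable_const, lintegral_const,
          measure_univ, mul_one, lintegral_const_mul _ (by fun_prop), lintegral_add_left measurable_const,
          lintegral_const, measure_univ, mul_one]
    _ < ⊤ := by
        refine ENNReal.mul_lt_top ENNReal.ofReal_lt_top (ENNReal.add_lt_top.2 ⟨?_, hμ⟩)
        exact ENNReal.mul_lt_top ENNReal.ofReal_lt_top (ENNReal.add_lt_top.2 ⟨ENNReal.ofReal_lt_top, h1⟩)

/-- law of `x - z` with `z` Gaussian -/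
noncomputable def gat (N : ℕ) (x : Euc N) (h : ℝ) : Measure (Euc N) := (gam N h).map (fun z => x - z)

lemma lint_gat {N : ℕ} {x : Euc N} {h : ℝ} {f : Euc N → ℝ≥0∞} (hf : Measurable f) :
    ∫⁻ z, f z ∂(gat N x h) = heat N h f x := by
  unfold gat heat
  rw [lintegral_map hf (by fun_prop)]

lemma gat_prob {N : ℕ} {x : Euc N} {h : ℝ} (hh : 0 < h) : IsProbabilityMeasure (gat N x h) := by
  have := gam_prob N hh
  exact Measure.isProbabilityMeasure_map (by fun_prop)

lemma gat_moment {N : ℕ} {x : Euc N} {h p : ℝ} (hh : 0 < h) (hp : 0 < p) :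
    ∫⁻ z, ENNReal.ofReal (‖z‖ ^ p) ∂(gat N x h) < ⊤ := by
  have := gam_prob N hh
  have hd : IsProbabilityMeasure (Measure.dirac (0 : Euc N)) := inferInstance
  have h1 := heat_U_lt_top hp hh (Measure.dirac (0 : Euc N)) (by simp) x
  have e : ∫⁻ z, ENNReal.ofReal (‖z‖ ^ p) ∂(gat N x h) = ENNReal.ofReal p * heat N h (Ua N p (Measure.dirac 0)) x := by
    rw [← heat_const_mul (measurable_Ua p _), ← lint_gat ((measurable_Ua p _).const_mul _)]
    refine lintegral_congr fun z => ?_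
    unfold Ua
    rw [lintegral_dirac' _ (by fun_prop), ← ENNReal.ofReal_mul hp.le, sub_zero]
    congr 1; field_simp
  rw [e]
  exact ENNReal.mul_lt_top ENNReal.ofReal_lt_top h1

lemma gat_energy {N : ℕ} (hN : 1 ≤ N) {s a : ℝ} (hs : 0 < s) (hs1 : s ≤ 1) (hsN : 2 * s < N) (ha : 0 < a)
    {x : Euc N} {h : ℝ} (hh : 0 < h) :
    bil N (powerLawW N s a) (gat N x h) (gat N x h) < ⊤ := by
  have := gat_prob (N := N) (x := x) hh
  unfold bil
  simp_rw [pot_eq hN hs hsN]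
  have m1 := measurable_Ua a (gat N x h)
  have m2 := measurable_Tm (measurable_pw s) (gat N x h)
  rw [lintegral_add_left m1, lintegral_const_mul _ m2, lint_gat m1, lint_gat m2]
  refine ENNReal.add_lt_top.2 ⟨heat_U_lt_top ha hh _ (gat_moment hh ha) x, ?_⟩
  refine ENNReal.mul_lt_top (c0_ne_top hN hsN).lt_top ?_
  exact (heat_u_le hh _ x).trans_lt (Cb_lt_top hs hs1 hsN hh)

/-- Euler–Lagrange condition -/
lemma EL {N : ℕ} (hN : 1 ≤ N) {s a : ℝ} (hs : 0 < s) (hs1 : s ≤ 1) (hsN : 2 * s < N) (ha : 0 < a)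
    {μ : Measure (Euc N)} (hmin : IsLocalMin2 N (powerLawW N s a) μ) {x0 : Euc N}
    (hx0 : x0 ∈ msupport N μ) {h : ℝ} (hh : 0 < h) (x : Euc N) :
    Ua N a μ x0 + c0 N s * Tm N (pw s) μ x0 ≤
      heat N h (Ua N a μ) x + c0 N s * heat N h (Tm N (pw s) μ) x := by
  have hμp : IsProbabilityMeasure μ := by obtain ⟨_, _, h, _⟩ := hmin; exact h.1
  set W := powerLawW N s a with hW
  have hWc : Continuous W := W_cont hsN ha
  set ψ : Euc N → ℝ≥0∞ := fun x => ∫⁻ y, W (x - y) ∂μ with hψ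
  have hψm : Measurable ψ := meas_pot hWc.measurable μ
  have hψe : ∀ x, ψ x = Ua N a μ x + c0 N s * Tm N (pw s) μ x := fun x => pot_eq hN hs hsN μ x
  set K := heat N h ψ x with hK
  have hKe : K = heat N h (Ua N a μ) x + c0 N s * heat N h (Tm N (pw s) μ) x := by
    rw [hK, ← heat_const_mul (measurable_Tm (measurable_pw s) μ), ← heat_add (measurable_Ua a μ)]
    congr 1; funext y; exact hψe y
  rw [← hKe, ← hψe]
  have hτ2 : IsProb2 N (gat N x h) := by
    refine ⟨gat_prob hh, ?_⟩
    have := gat_moment (N := N) (x := x) hh two_pos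
    simpa using this
  have hy : ∀ n : ℕ, ∃ y ∈ Metric.ball x0 (1 / ((n:ℝ) + 1)), ψ y ≤ K := by
    intro n
    have hr : 0 < 1 / ((n:ℝ) + 1) := by positivity
    have hpos := hx0 _ hr
    have hv := variation hWc.measurable W_neg hmin (Metric.isOpen_ball (x := x0)
      (ε := 1 / ((n:ℝ) + 1))).measurableSet hτ2 (gat_energy hN hs hs1 hsN ha hh)
    obtain ⟨y, hy, hle⟩ := exists_le_setLAverage (f := ψ) (μ := μ) hpos.ne' (measure_ne_top _ _)
      hψm.aemeasurable
    refine ⟨y, hy, hle.trans ?_⟩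
    rw [setLAverage_eq]
    refine ENNReal.div_le_of_le_mul ?_
    rw [mul_comm]
    have e2 : bil N W (gat N x h) μ = K := lint_gat hψm
    rw [e2] at hv
    exact hv
  choose y hyb hyK using hy
  have hyl : Tendsto y atTop (𝓝 x0) := by
    rw [tendsto_iff_dist_tendsto_zero]
    refine squeeze_zero (fun n => dist_nonneg) (fun n => (Metric.mem_ball.1 (hyb n)).le) ?_
    exact tendsto_one_div_add_atTop_nhds_zero_nat
  calc ψ x0 = ∫⁻ z, liminf (fun n => W (y n - z)) atTop ∂μ := by
        refine lintegral_congr fun z => ?_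
        refine (Tendsto.liminf_eq ?_).symm
        exact (hWc.tendsto _).comp (hyl.sub_const z)
    _ ≤ liminf (fun n => ψ (y n)) atTop := by
        refine lintegral_liminf_le fun n => ?_
        exact hWc.measurable.comp (measurable_const.sub measurable_id)
    _ ≤ K := by
        refine liminf_le_of_frequently_le' (Frequently.of_forall hyK)

lemma moment_a {N : ℕ} {s a : ℝ} (ha : 0 < a)
    {μ : Measure (Euc N)} (hmin : IsLocalMin2 N (powerLawW N s a) μ) :
    ∫⁻ y, ENNReal.ofReal (‖y‖ ^ a) ∂μ < ⊤ := by
  obtain ⟨_, _, ⟨hp, _⟩, hE, _⟩ := hmin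
  unfold interE at hE
  have h1 : ∫⁻ x, Ua N a μ x ∂μ < ⊤ := by
    refine lt_of_le_of_lt ?_ (lt_top_of_mul_ne_top_right hE.ne (by simp))
    refine lintegral_mono fun x => lintegral_mono fun y => ?_
    exact le_self_add
  obtain ⟨x, hx⟩ := (ae_lt_top (measurable_Ua a μ) h1.ne).exists
  calc _ ≤ ∫⁻ y, ENNReal.ofReal a * (ENNReal.ofReal (2 ^ a / a) * (ENNReal.ofReal (‖x‖ ^ a) +
        ENNReal.ofReal a * ENNReal.ofReal (‖x - y‖ ^ a / a))) ∂μ := by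
        refine lintegral_mono fun y => ?_
        have := norm_rpow_le ha x (x - y)
        rw [show x - (x - y) = y by abel] at this
        calc _ = ENNReal.ofReal a * ENNReal.ofReal (‖y‖ ^ a / a) := by
              rw [← ENNReal.ofReal_mul ha.le]; congr 1; field_simp
          _ ≤ _ := by
              have e : ENNReal.ofReal a * ENNReal.ofReal (‖x - y‖ ^ a / a) = ENNReal.ofReal (‖x - y‖ ^ a) := by
                rw [← ENNReal.ofReal_mul ha.le]; congr 1; field_simp
              rw [e]
              exact mul_le_mul_right this _
    _ = ENNReal.ofReal a * (ENNReal.ofReal (2 ^ a / a) * (ENNReal.ofReal (‖x‖ ^ a) +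
        ENNReal.ofReal a * Ua N a μ x)) := by
        unfold Ua
        rw [lintegral_const_mul _ (by fun_prop), lintegral_const_mul _ (by fun_prop),
          lintegral_add_left measurable_const, lintegral_const, measure_univ, mul_one,
          lintegral_const_mul _ (by fun_prop)]
    _ < ⊤ := by
        refine ENNReal.mul_lt_top ENNReal.ofReal_lt_top (ENNReal.mul_lt_top ENNReal.ofReal_lt_top
          (ENNReal.add_lt_top.2 ⟨ENNReal.ofReal_lt_top, ENNReal.mul_lt_top ENNReal.ofReal_lt_top hx⟩))

/-- bundle of facts about a local minimizer -/
structure SU (N : ℕ) (s a : ℝ) (μ : Measure (Euc N)) (S : Set (Euc N)) : Prop where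
  hN : 1 ≤ N
  hs : 0 < s
  hs1 : s ≤ 1
  hsN : 2 * s < (N:ℝ)
  ha : 0 < a
  prob : IsProbabilityMeasure μ
  mom : ∫⁻ y, ENNReal.ofReal (‖y‖ ^ a) ∂μ < ⊤
  cpt : IsCompact S
  null : μ Sᶜ = 0
  EL : ∀ x0 ∈ S, ∀ h : ℝ, 0 < h → ∀ x, Ua N a μ x0 + c0 N s * Tm N (pw s) μ x0 ≤
      heat N h (Ua N a μ) x + c0 N s * heat N h (Tm N (pw s) μ) x
  ub : ∃ C : ℝ, 0 < C ∧ ∀ x ∈ S, Tm N (pw s) μ x ≤ ENNReal.ofReal C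

lemma msupport_eq {N : ℕ} (μ : Measure (Euc N)) : msupport N μ = μ.support := by
  ext x
  rw [Measure.mem_support_iff_forall]
  constructor
  · intro h U hU
    obtain ⟨ε, hε, hs⟩ := Metric.mem_nhds_iff.1 hU
    exact (h ε hε).trans_le (measure_mono hs)
  · intro h ε hε
    exact h _ (Metric.ball_mem_nhds x hε)

lemma SU_of_min {N : ℕ} (hN : 1 ≤ N) {s a : ℝ} (hs : 0 < s) (hs1 : s ≤ 1) (hsN : 2 * s < N) (ha : 0 < a)
    {μ : Measure (Euc N)} (hmin : IsLocalMin2 N (powerLawW N s a) μ) :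
    SU N s a μ (msupport N μ) := by
  have hp : IsProbabilityMeasure μ := by obtain ⟨_, _, h, _⟩ := hmin; exact h.1
  have hmom := moment_a ha hmin
  set m := heat N 1 (Ua N a μ) 0 + c0 N s * heat N 1 (Tm N (pw s) μ) 0 with hm
  have hmt : m < ⊤ := by
    refine ENNReal.add_lt_top.2 ⟨heat_U_lt_top ha one_pos μ hmom 0, ?_⟩
    exact ENNReal.mul_lt_top (c0_ne_top hN hsN).lt_top
      ((heat_u_le one_pos μ 0).trans_lt (Cb_lt_top hs hs1 hsN one_pos))
  have hle : ∀ x ∈ msupport N μ, Ua N a μ x + c0 N s * Tm N (pw s) μ x ≤ m :=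
    fun x hx => EL hN hs hs1 hsN ha hmin hx one_pos 0
  refine ⟨hN, hs, hs1, hsN, ha, hp, hmom, ?_, ?_, fun x0 hx0 h hh x => EL hN hs hs1 hsN ha hmin hx0 hh x, ?_⟩
  · rw [msupport_eq]
    refine Metric.isCompact_of_isClosed_isBounded (Measure.isClosed_support) ?_
    rw [← msupport_eq]
    -- ball of mass ≥ 1/2
    obtain ⟨n, hn⟩ : ∃ n : ℕ, (1/2 : ℝ≥0∞) < μ (Metric.ball (0:Euc N) n) := by
      have h1 : Tendsto (fun n : ℕ => μ (Metric.ball (0:Euc N) n)) atTop (𝓝 (μ (⋃ n : ℕ, Metric.ball (0:Euc N) n))) := by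
        apply tendsto_measure_iUnion_atTop
        intro i j hij
        exact Metric.ball_subset_ball (by exact_mod_cast hij)
      rw [Metric.iUnion_ball_nat, measure_univ] at h1
      exact (h1.eventually (lt_mem_nhds (by simp : (1/2:ℝ≥0∞) < 1))).exists
    have key : ∀ x ∈ msupport N μ, (n:ℝ) ≤ ‖x‖ → (‖x‖ - n) ^ a ≤ a * (2 * m).toReal := by
      intro x hx hxn
      have h1 : ENNReal.ofReal ((‖x‖ - n) ^ a / a) * (1/2) ≤ m := by
        calc _ ≤ ENNReal.ofReal ((‖x‖ - n) ^ a / a) * μ (Metric.ball (0:Euc N) n) := mul_le_mul_right hn.le _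
          _ = ∫⁻ y in Metric.ball (0:Euc N) n, ENNReal.ofReal ((‖x‖ - n) ^ a / a) ∂μ := by
              rw [setLIntegral_const]
          _ ≤ ∫⁻ y in Metric.ball (0:Euc N) n, ENNReal.ofReal (‖x - y‖ ^ a / a) ∂μ := by
              refine setLIntegral_mono' measurableSet_ball fun y hy => ENNReal.ofReal_le_ofReal ?_
              have : ‖y‖ < n := by simpa using hy
              have h2 := norm_sub_norm_le x y
              gcongr
              · linarith
          _ ≤ Ua N a μ x := setLIntegral_le_lintegral _ _
          _ ≤ m := le_self_add.trans (hle x hx)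
      have h2 : ENNReal.ofReal ((‖x‖ - n) ^ a / a) ≤ 2 * m := by
        calc _ = 2 * (ENNReal.ofReal ((‖x‖ - n) ^ a / a) * (1/2)) := by
              rw [one_div, mul_left_comm, ENNReal.mul_inv_cancel (by simp) (by simp), mul_one]
          _ ≤ _ := mul_le_mul_right h1 _
      have h3 := (ENNReal.ofReal_le_iff_le_toReal (ENNReal.mul_ne_top (by simp) hmt.ne)).1 h2
      rwa [div_le_iff₀ ha, mul_comm] at h3
    rw [Metric.isBounded_iff_subset_closedBall 0]
    refine ⟨n + (a * (2 * m).toReal) ^ (1/a), fun x hx => ?_⟩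
    rw [mem_closedBall_zero_iff]
    have h0 : 0 ≤ (a * (2 * m).toReal) ^ (1/a) := by positivity
    by_cases hxn : (n:ℝ) ≤ ‖x‖
    · have h1 := Real.rpow_le_rpow (z := 1/a) (Real.rpow_nonneg (by linarith) _) (key x hx hxn) (by positivity)
      rw [← Real.rpow_mul (by linarith), mul_one_div_cancel ha.ne', Real.rpow_one] at h1
      linarith
    · push Not at hxn; linarith
  · rw [msupport_eq]; exact Measure.measure_compl_support
  · refine ⟨((c0 N s)⁻¹ * m).toReal + 1, by positivity, fun x hx => ?_⟩
    have h1 : Tm N (pw s) μ x ≤ (c0 N s)⁻¹ * m := by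
      have := le_add_self.trans (hle x hx)
      rw [mul_comm] at this
      have := (ENNReal.le_div_iff_mul_le (Or.inl (c0_ne_zero hN hs hsN)) (Or.inl (c0_ne_top hN hsN))).2 this
      rwa [div_eq_mul_inv, mul_comm] at this
    refine h1.trans ?_
    have h2 : (c0 N s)⁻¹ * m ≠ ⊤ := ENNReal.mul_ne_top (ENNReal.inv_ne_top.2 (c0_ne_zero hN hs hsN)) hmt.ne
    rw [← ENNReal.ofReal_toReal h2]
    apply ENNReal.ofReal_le_ofReal
    simp

lemma tangent_pow {q X Y : ℝ} (hq : 1 ≤ q) (hX : 0 ≤ X) (hY : 0 ≤ Y) :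
    X ^ q - Y ^ q ≤ q * X ^ (q - 1) * (X - Y) := by
  rcases hX.eq_or_lt with h | h
  · subst h
    rw [Real.zero_rpow (by linarith)]
    rcases hq.eq_or_lt with h1 | h1
    · subst h1; simp
    · rw [Real.zero_rpow (by linarith : q - 1 ≠ 0)]
      have := Real.rpow_nonneg hY q
      simp; linarith
  · have h1 := one_add_mul_self_le_rpow_one_add (s := Y / X - 1) (by
      have : 0 ≤ Y / X := by positivity
      linarith) hq
    rw [show 1 + (Y / X - 1) = Y / X by ring, Real.div_rpow hY hX, le_div_iff₀ (by positivity)] at h1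
    have h2 : X ^ q = X ^ (q-1) * X := by
      rw [← Real.rpow_add_one h.ne']; ring_nf
    have h3 : (1 + q * (Y / X - 1)) * X ^ q = X ^ q + q * X ^ (q-1) * (Y - X) := by
      rw [h2]; field_simp
    rw [h3] at h1
    linarith

lemma par_law {N : ℕ} (z w : Euc N) : ‖z + w‖ ^ 2 + ‖z - w‖ ^ 2 = 2 * (‖z‖ ^ 2 + ‖w‖ ^ 2) := by
  have := parallelogram_law_with_norm ℝ z w
  nlinarith

lemma prod_ge {N : ℕ} (z w : Euc N) : |‖z‖ ^ 2 - ‖w‖ ^ 2| ≤ ‖z + w‖ * ‖z - w‖ := by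
  have h1 : inner ℝ (z + w) (z - w) = ‖z‖ ^ 2 - ‖w‖ ^ 2 := by
    rw [inner_add_left, inner_sub_right, inner_sub_right, real_inner_comm z w, real_inner_self_eq_norm_sq,
      real_inner_self_eq_norm_sq]; ring
  rw [← h1]
  exact abs_real_inner_le_norm _ _

lemma rpow_sq {x a : ℝ} (hx : 0 ≤ x) : (x ^ 2) ^ (a / 2) = x ^ a := by
  rw [← Real.rpow_natCast, ← Real.rpow_mul hx]; congr 1; push_cast; ring

/-- interpolation -/
lemma interp_le {Z W a q : ℝ} (hZ : 0 < Z) (hW : 0 ≤ W) (h : W ≤ Z) (hq : 0 ≤ q) (ha : 0 < a)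
    (hb : a + q ≤ 2) : Z ^ (a - 2) * W ^ 2 ≤ W ^ (a + q) * Z ^ (-q) := by
  rcases hW.eq_or_lt with h0 | h0
  · subst h0; rw [Real.zero_rpow (by linarith)]; simp
  · have e1 : W ^ 2 = W ^ (a + q) * W ^ (2 - (a+q)) := by
      rw [← Real.rpow_add h0, show a + q + (2 - (a+q)) = (2:ℕ) by push_cast; ring, Real.rpow_natCast]
    have e2 : Z ^ (-q) = Z ^ (a - 2) * Z ^ (2 - (a+q)) := by
      rw [← Real.rpow_add hZ]; congr 1; ring
    have e3 : W ^ (2 - (a+q)) ≤ Z ^ (2 - (a+q)) := Real.rpow_le_rpow hW h (by linarith)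
    rw [e1, e2]
    calc _ = W ^ (a+q) * Z ^ (a-2) * W ^ (2 - (a+q)) := by ring
      _ ≤ W ^ (a+q) * Z ^ (a-2) * Z ^ (2 - (a+q)) := by gcongr
      _ = _ := by ring

lemma sd_upper_small {N : ℕ} {a q : ℝ} (ha : 0 < a) (ha2 : a ≤ 2) (hq : 0 ≤ q) (hb : a + q ≤ 2)
    (z w : Euc N) (hz : z ≠ 0) :
    ‖z + w‖ ^ a + ‖z - w‖ ^ a ≤ 2 * ‖z‖ ^ a + 2 * (‖w‖ ^ (a + q) * ‖z‖ ^ (-q)) := by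
  have hZ : 0 < ‖z‖ := norm_pos_iff.2 hz
  have hW := norm_nonneg w
  -- concavity
  have h1 : ‖z + w‖ ^ a + ‖z - w‖ ^ a ≤ 2 * (‖z‖ ^ 2 + ‖w‖ ^ 2) ^ (a/2) := by
    have hc := Real.concaveOn_rpow (p := a/2) (by linarith) (by linarith)
    have p1 : ‖z+w‖^2 ∈ Ici (0:ℝ) := sq_nonneg ‖z+w‖
    have p2 : ‖z-w‖^2 ∈ Ici (0:ℝ) := sq_nonneg ‖z-w‖
    have := hc.2 p1 p2 (by norm_num : (0:ℝ) ≤ 1/2) (by norm_num : (0:ℝ) ≤ 1/2) (by norm_num)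
    simp only [smul_eq_mul] at this
    rw [rpow_sq (norm_nonneg _), rpow_sq (norm_nonneg _)] at this
    have e : (1/2:ℝ) * ‖z+w‖^2 + 1/2 * ‖z-w‖^2 = ‖z‖ ^ 2 + ‖w‖ ^ 2 := by have := par_law z w; linarith
    rw [e] at this
    linarith
  have h2 : (‖z‖ ^ 2 + ‖w‖ ^ 2) ^ (a/2) ≤ ‖z‖ ^ a + ‖w‖ ^ (a + q) * ‖z‖ ^ (-q) := by
    by_cases h : ‖w‖ ≤ ‖z‖
    · have e : (‖z‖ ^ 2 + ‖w‖ ^ 2) = ‖z‖ ^ 2 * (1 + ‖w‖ ^ 2 / ‖z‖ ^ 2) := by field_simp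
      have h3 := rpow_one_add_le_one_add_mul_self (s := ‖w‖ ^ 2 / ‖z‖ ^ 2) (p := a/2)
        (by have : 0 ≤ ‖w‖ ^ 2 / ‖z‖ ^ 2 := by positivity
            linarith) (by linarith) (by linarith)
      rw [e, Real.mul_rpow (by positivity) (by positivity), rpow_sq hZ.le]
      have h4 := interp_le hZ hW h hq ha hb
      have h5 : ‖z‖ ^ (a - 2) * ‖w‖ ^ 2 = ‖z‖ ^ a * (‖w‖ ^ 2 / ‖z‖ ^ 2) := by
        rw [Real.rpow_sub hZ]
        have : ‖z‖ ^ (2:ℝ) = ‖z‖ ^ 2 := by exact_mod_cast Real.rpow_natCast ‖z‖ 2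
        rw [this]; ring
      calc _ ≤ ‖z‖ ^ a * (1 + a / 2 * (‖w‖ ^ 2 / ‖z‖ ^ 2)) := by gcongr
        _ ≤ ‖z‖ ^ a * (1 + 1 * (‖w‖ ^ 2 / ‖z‖ ^ 2)) := by gcongr; linarith
        _ = ‖z‖ ^ a + ‖z‖ ^ (a - 2) * ‖w‖ ^ 2 := by rw [h5]; ring
        _ ≤ _ := by linarith
    · push Not at h
      have hW0 : 0 < ‖w‖ := hZ.trans h
      have h3 : (‖z‖ ^ 2 + ‖w‖ ^ 2) ^ (a/2) ≤ (‖z‖ ^ 2) ^ (a/2) + (‖w‖ ^ 2) ^ (a/2) :=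
        Real.rpow_add_le_add_rpow (by positivity) (by positivity) (by linarith) (by linarith)
      rw [rpow_sq hZ.le, rpow_sq hW] at h3
      have h4 : ‖w‖ ^ a ≤ ‖w‖ ^ (a + q) * ‖z‖ ^ (-q) := by
        have : ‖w‖ ^ (-q) ≤ ‖z‖ ^ (-q) := Real.rpow_le_rpow_of_nonpos hZ h.le (by linarith)
        calc ‖w‖ ^ a = ‖w‖ ^ (a+q) * ‖w‖ ^ (-q) := by rw [← Real.rpow_add hW0]; ring_nf
          _ ≤ _ := by gcongr
      linarith
  linarith

lemma sd_lower_small {N : ℕ} {a q : ℝ} (ha : 0 < a) (ha2 : a ≤ 2) (hq : 0 ≤ q) (hb : a + q ≤ 2)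
    (z w : Euc N) (hz : z ≠ 0) :
    2 * ‖z‖ ^ a ≤ ‖z + w‖ ^ a + ‖z - w‖ ^ a + 2 * (‖w‖ ^ (a + q) * ‖z‖ ^ (-q)) := by
  have hZ : 0 < ‖z‖ := norm_pos_iff.2 hz
  have hW := norm_nonneg w
  by_cases h : ‖w‖ ≤ ‖z‖
  · have h1 : 2 * (‖z + w‖ ^ (a/2) * ‖z - w‖ ^ (a/2)) ≤ ‖z + w‖ ^ a + ‖z - w‖ ^ a := by
      have e : ∀ x : ℝ, 0 ≤ x → x ^ a = (x ^ (a/2)) ^ 2 := by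
        intro x hx; rw [← Real.rpow_natCast, ← Real.rpow_mul hx]; congr 1; push_cast; ring
      rw [e _ (norm_nonneg _), e _ (norm_nonneg _)]
      nlinarith [sq_nonneg (‖z + w‖ ^ (a/2) - ‖z - w‖ ^ (a/2))]
    have h2 : (‖z‖ ^ 2 - ‖w‖ ^ 2) ^ (a/2) ≤ ‖z + w‖ ^ (a/2) * ‖z - w‖ ^ (a/2) := by
      rw [← Real.mul_rpow (norm_nonneg _) (norm_nonneg _)]
      refine Real.rpow_le_rpow ?_ ((le_abs_self _).trans (prod_ge z w)) (by linarith)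
      nlinarith
    have h3 : ‖z‖ ^ a - ‖w‖ ^ (a + q) * ‖z‖ ^ (-q) ≤ (‖z‖ ^ 2 - ‖w‖ ^ 2) ^ (a/2) := by
      have h4 := interp_le hZ hW h hq ha hb
      have e : (‖z‖ ^ 2 - ‖w‖ ^ 2) = ‖z‖ ^ 2 * (1 - ‖w‖ ^ 2 / ‖z‖ ^ 2) := by field_simp
      have ht : 0 ≤ 1 - ‖w‖ ^ 2 / ‖z‖ ^ 2 := by
        rw [sub_nonneg, div_le_one (by positivity)]; gcongr
      have ht1 : 1 - ‖w‖ ^ 2 / ‖z‖ ^ 2 ≤ 1 := by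
        have : 0 ≤ ‖w‖ ^ 2 / ‖z‖ ^ 2 := by positivity
        linarith
      have h5 : ‖z‖ ^ (a - 2) * ‖w‖ ^ 2 = ‖z‖ ^ a * (‖w‖ ^ 2 / ‖z‖ ^ 2) := by
        rw [Real.rpow_sub hZ]
        have : ‖z‖ ^ (2:ℝ) = ‖z‖ ^ 2 := by exact_mod_cast Real.rpow_natCast ‖z‖ 2
        rw [this]; ring
      have h6 : 1 - ‖w‖ ^ 2 / ‖z‖ ^ 2 ≤ (1 - ‖w‖ ^ 2 / ‖z‖ ^ 2) ^ (a/2) := by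
        rcases ht.eq_or_lt with h0 | h0
        · rw [← h0]; exact Real.rpow_nonneg le_rfl _
        · calc 1 - ‖w‖ ^ 2 / ‖z‖ ^ 2 = (1 - ‖w‖ ^ 2 / ‖z‖ ^ 2) ^ (1:ℝ) := (Real.rpow_one _).symm
            _ ≤ _ := Real.rpow_le_rpow_of_exponent_ge h0 ht1 (by linarith)
      rw [e, Real.mul_rpow (by positivity) ht, rpow_sq hZ.le]
      calc _ ≤ ‖z‖ ^ a - ‖z‖ ^ a * (‖w‖ ^ 2 / ‖z‖ ^ 2) := by linarith
        _ = ‖z‖ ^ a * (1 - ‖w‖ ^ 2 / ‖z‖ ^ 2) := by ring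
        _ ≤ _ := by gcongr
    linarith
  · push Not at h
    have h4 : ‖z‖ ^ a ≤ ‖w‖ ^ (a + q) * ‖z‖ ^ (-q) := by
      have : ‖z‖ ^ (a+q) ≤ ‖w‖ ^ (a+q) := Real.rpow_le_rpow hZ.le h.le (by linarith)
      calc ‖z‖ ^ a = ‖z‖ ^ (a+q) * ‖z‖ ^ (-q) := by rw [← Real.rpow_add hZ]; ring_nf
        _ ≤ _ := by gcongr
    have h5 := Real.rpow_nonneg (norm_nonneg (z+w)) a
    have h6 := Real.rpow_nonneg (norm_nonneg (z-w)) a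
    linarith

lemma sd_lower_big {N : ℕ} {a : ℝ} (ha : 1 ≤ a) (z w : Euc N) :
    2 * ‖z‖ ^ a ≤ ‖z + w‖ ^ a + ‖z - w‖ ^ a := by
  have p1 : ‖z+w‖ ∈ Ici (0:ℝ) := norm_nonneg _
  have p2 : ‖z-w‖ ∈ Ici (0:ℝ) := norm_nonneg _
  have hc := (convexOn_rpow ha).2 p1 p2 (by norm_num : (0:ℝ) ≤ 1/2) (by norm_num : (0:ℝ) ≤ 1/2) (by norm_num)
  simp only [smul_eq_mul] at hc
  have h1 : ‖z‖ ≤ 1/2 * ‖z+w‖ + 1/2 * ‖z-w‖ := by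
    have := norm_add_le (z+w) (z-w)
    rw [show z + w + (z - w) = (2:ℝ) • z by rw [two_smul]; abel, norm_smul] at this
    norm_num at this; linarith
  have h2 := Real.rpow_le_rpow (norm_nonneg z) h1 (by linarith : 0 ≤ a)
  linarith

lemma grad_ineq {N : ℕ} {a : ℝ} (ha : 2 < a) (x y : Euc N) :
    ‖x‖ ^ a - ‖y‖ ^ a ≤ a * (‖x‖ ^ (a-2) * inner ℝ x (x - y)) := by
  have h1 := tangent_pow (q := a) (by linarith) (norm_nonneg x) (norm_nonneg y)
  refine h1.trans ?_
  rw [mul_assoc]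
  refine mul_le_mul_of_nonneg_left ?_ (by linarith)
  have e : ‖x‖ ^ (a - 1) = ‖x‖ ^ (a-2) * ‖x‖ := by
    rcases (norm_nonneg x).eq_or_lt with h | h
    · rw [← h, Real.zero_rpow (by linarith)]; simp
    · rw [← Real.rpow_add_one h.ne']; ring_nf
  rw [e, mul_assoc]
  refine mul_le_mul_of_nonneg_left ?_ (by positivity)
  rw [inner_sub_right, real_inner_self_eq_norm_sq]
  have := real_inner_le_norm x y
  nlinarith

lemma F_lip {N : ℕ} {a : ℝ} (ha : 2 < a) (x y : Euc N) (hxy : ‖y‖ ≤ ‖x‖) :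
    ‖‖x‖ ^ (a-2) • x - ‖y‖ ^ (a-2) • y‖ ≤ (a - 1) * ‖x‖ ^ (a-2) * ‖x - y‖ := by
  have e : ‖x‖ ^ (a-2) • x - ‖y‖ ^ (a-2) • y = ‖x‖ ^ (a-2) • (x - y) + (‖x‖ ^ (a-2) - ‖y‖ ^ (a-2)) • y := by
    rw [smul_sub, sub_smul]; abel
  have hm : ‖y‖ ^ (a-2) ≤ ‖x‖ ^ (a-2) := Real.rpow_le_rpow (norm_nonneg _) hxy (by linarith)
  have h1 : (‖x‖ ^ (a-2) - ‖y‖ ^ (a-2)) * ‖y‖ ≤ (a-2) * ‖x‖ ^ (a-2) * ‖x - y‖ := by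
    have h2 := tangent_pow (q := a - 1) (by linarith) (norm_nonneg x) (norm_nonneg y)
    have e1 : ∀ x : Euc N, ‖x‖ ^ (a - 1) = ‖x‖ ^ (a-2) * ‖x‖ := by
      intro x
      rcases (norm_nonneg x).eq_or_lt with h | h
      · rw [← h, Real.zero_rpow (by linarith)]; simp
      · rw [← Real.rpow_add_one h.ne']; ring_nf
    rw [e1, e1, show a - 1 - 1 = a - 2 by ring] at h2
    have h3 : 0 ≤ (a-2) * ‖x‖ ^ (a-2) := mul_nonneg (by linarith) (by positivity)
    calc _ ≤ (a-2) * ‖x‖ ^ (a-2) * (‖x‖ - ‖y‖) := by linarith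
      _ ≤ _ := mul_le_mul_of_nonneg_left (norm_sub_norm_le x y) h3
  rw [e]
  refine (norm_add_le _ _).trans ?_
  rw [norm_smul, norm_smul, Real.norm_of_nonneg (by positivity), Real.norm_of_nonneg (by linarith)]
  linarith

lemma sd_upper_big {N : ℕ} {a : ℝ} (ha : 2 < a) (z w : Euc N) :
    ‖z + w‖ ^ a + ‖z - w‖ ^ a ≤ 2 * ‖z‖ ^ a + 2 * a * (a-1) * (‖w‖ ^ 2 * (‖z‖ + ‖w‖) ^ (a-2)) := by
  have h1 := grad_ineq ha (z+w) z
  have h2 := grad_ineq ha (z-w) z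
  rw [show z + w - z = w by abel] at h1
  rw [show z - w - z = -w by abel, inner_neg_right] at h2
  have h3 : ‖z+w‖ ^ (a-2) * inner ℝ (z+w) w - ‖z-w‖ ^ (a-2) * inner ℝ (z-w) w
      = inner ℝ (‖z+w‖ ^ (a-2) • (z+w) - ‖z-w‖ ^ (a-2) • (z-w)) w := by
    rw [inner_sub_left (‖z+w‖ ^ (a-2) • (z+w)), real_inner_smul_left, real_inner_smul_left]
  have h4 : ‖‖z+w‖ ^ (a-2) • (z+w) - ‖z-w‖ ^ (a-2) • (z-w)‖ ≤ (a-1) * (‖z‖ + ‖w‖) ^ (a-2) * (2 * ‖w‖) := by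
    have ew : ‖(z+w) - (z-w)‖ = 2 * ‖w‖ := by
      rw [show z + w - (z - w) = (2:ℝ) • w by rw [two_smul]; abel, norm_smul]; norm_num
    have ha1 : 0 ≤ a - 1 := by linarith
    rcases le_total ‖z-w‖ ‖z+w‖ with h | h
    · refine (F_lip ha _ _ h).trans ?_
      rw [ew]; gcongr
      exact norm_add_le _ _
    · rw [norm_sub_rev]
      refine (F_lip ha _ _ h).trans ?_
      rw [norm_sub_rev (z - w) (z + w), ew]; gcongr
      exact norm_sub_le _ _
  have h5 := (real_inner_le_norm (‖z+w‖ ^ (a-2) • (z+w) - ‖z-w‖ ^ (a-2) • (z-w)) w).trans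
    (mul_le_mul_of_nonneg_right h4 (norm_nonneg w))
  have h6 : a * (‖z+w‖ ^ (a-2) * inner ℝ (z+w) w - ‖z-w‖ ^ (a-2) * inner ℝ (z-w) w) ≤
      a * ((a-1) * (‖z‖ + ‖w‖) ^ (a-2) * (2 * ‖w‖) * ‖w‖) := by
    rw [h3]; exact mul_le_mul_of_nonneg_left h5 (by linarith)
  nlinarith

/-- admissible exponents -/
def Adm (a b q : ℝ) : Prop := 0 ≤ q ∧ 0 < b ∧ b ≤ 2 ∧ (a ≤ 2 → b = a + q) ∧ (2 < a → b = 2 ∧ q = 0)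

lemma sd_upper {N : ℕ} {a b q : ℝ} (ha : 0 < a) (hA : Adm a b q) (L : ℝ) (hL : 0 ≤ L) :
    ∃ C : ℝ, 0 < C ∧ ∀ z w : Euc N, z ≠ 0 → ‖z‖ ≤ L →
    ‖z + w‖ ^ a + ‖z - w‖ ^ a ≤ 2 * ‖z‖ ^ a + C * (‖w‖ ^ b * (1 + ‖w‖ ^ a) * ‖z‖ ^ (-q)) := by
  obtain ⟨hq, hb0, hb, h1, h2⟩ := hA
  by_cases h : a ≤ 2
  · have e := h1 h
    refine ⟨2, two_pos, fun z w hz _ => (sd_upper_small ha h hq (by linarith) z w hz).trans ?_⟩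
    rw [← e]
    have : ‖w‖ ^ b * ‖z‖ ^ (-q) ≤ ‖w‖ ^ b * (1 + ‖w‖ ^ a) * ‖z‖ ^ (-q) := by
      have h3 : 1 ≤ 1 + ‖w‖ ^ a := by have := Real.rpow_nonneg (norm_nonneg w) a; linarith
      have h4 : 0 ≤ ‖w‖ ^ b * ‖z‖ ^ (-q) := by positivity
      nlinarith
    linarith
  · push Not at h
    obtain ⟨rfl, rfl⟩ := h2 h
    refine ⟨2 * a * (a-1) * (2 ^ (a-2) * (L ^ (a-2) + 1 + 1)), ?_, fun z w hz hzL => (sd_upper_big h z w).trans ?_⟩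
    · have : 0 < a - 1 := by linarith
      positivity
    have h3 := rpow_add_le' (norm_nonneg z) (norm_nonneg w) (by linarith : 0 ≤ a - 2)
    have h4 : ‖z‖ ^ (a-2) ≤ L ^ (a-2) := Real.rpow_le_rpow (norm_nonneg _) hzL (by linarith)
    have h5 : ‖w‖ ^ (a-2) ≤ 1 + ‖w‖ ^ a := by
      have h0 := Real.rpow_nonneg (norm_nonneg w) a
      rcases le_total ‖w‖ 1 with h6 | h6
      · have := Real.rpow_le_one (norm_nonneg w) h6 (by linarith : 0 ≤ a - 2); linarith
      · have := Real.rpow_le_rpow_of_exponent_le h6 (by linarith : a - 2 ≤ a); linarith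
    have h0 := Real.rpow_nonneg (norm_nonneg w) a
    have hL0 : 0 ≤ L ^ (a-2) := by positivity
    have h6 : (‖z‖ + ‖w‖) ^ (a-2) ≤ (2 ^ (a-2) * (L ^ (a-2) + 1 + 1)) * (1 + ‖w‖ ^ a) := by
      refine h3.trans ?_
      rw [mul_assoc]
      refine mul_le_mul_of_nonneg_left ?_ (by positivity)
      nlinarith
    rw [neg_zero, Real.rpow_zero, mul_one]
    have e2 : ‖w‖ ^ (2:ℝ) = ‖w‖ ^ 2 := by exact_mod_cast Real.rpow_natCast ‖w‖ 2
    rw [e2]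
    have h7 : 0 ≤ 2 * a * (a-1) := mul_nonneg (by linarith) (by linarith)
    have h8 : ‖w‖ ^ 2 * (‖z‖ + ‖w‖) ^ (a-2) ≤ ‖w‖ ^ 2 * ((2 ^ (a-2) * (L ^ (a-2) + 1 + 1)) * (1 + ‖w‖ ^ a)) := by gcongr
    have h9 := mul_le_mul_of_nonneg_left h8 h7
    linarith

lemma sd_lower {N : ℕ} {a b q : ℝ} (ha : 0 < a) (hA : Adm a b q) (z w : Euc N) (hz : z ≠ 0) :
    2 * ‖z‖ ^ a ≤ ‖z + w‖ ^ a + ‖z - w‖ ^ a + 2 * (‖w‖ ^ b * ‖z‖ ^ (-q)) := by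
  obtain ⟨hq, hb0, hb, h1, h2⟩ := hA
  by_cases h : a ≤ 2
  · have e := h1 h
    have := sd_lower_small ha h hq (by linarith) z w hz
    rwa [← e] at this
  · have := sd_lower_big (by linarith : 1 ≤ a) z w
    have : 0 ≤ ‖w‖ ^ b * ‖z‖ ^ (-q) := by positivity
    linarith

/-- Riesz type potential of order `q` -/
noncomputable def Kq (N : ℕ) (q : ℝ) (μ : Measure (Euc N)) (x : Euc N) : ℝ≥0∞ :=
  ∫⁻ y, (ENNReal.ofReal ‖x - y‖) ^ (-q) ∂μ

lemma ofReal_two_mul (x : ℝ) : ENNReal.ofReal (2 * x) = 2 * ENNReal.ofReal x := by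
  rw [ENNReal.ofReal_mul (by norm_num)]; simp

lemma ofReal_norm_rpow {N : ℕ} {z : Euc N} (hz : z ≠ 0) (q : ℝ) :
    (ENNReal.ofReal ‖z‖) ^ q = ENNReal.ofReal (‖z‖ ^ q) :=
  ENNReal.ofReal_rpow_of_pos (norm_pos_iff.2 hz)

lemma sdE_upper {N : ℕ} {a b q : ℝ} (ha : 0 < a) (hA : Adm a b q) (L : ℝ) (hL : 0 ≤ L) :
    ∃ C : ℝ, 0 < C ∧ ∀ z w : Euc N, ‖z‖ ≤ L →
    ENNReal.ofReal (‖z - w‖ ^ a / a) + ENNReal.ofReal (‖z + w‖ ^ a / a) ≤ 2 * ENNReal.ofReal (‖z‖ ^ a / a) +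
      ENNReal.ofReal (C * (‖w‖ ^ b * (1 + ‖w‖ ^ a))) * (ENNReal.ofReal ‖z‖) ^ (-q) := by
  obtain ⟨C, hC, h⟩ := sd_upper (N := N) ha hA L hL
  refine ⟨(C + 2) / a, by positivity, fun z w hz => ?_⟩
  have hnn : 0 ≤ ‖w‖ ^ b * (1 + ‖w‖ ^ a) := by positivity
  by_cases hz0 : z = 0
  · subst hz0
    by_cases hw0 : w = 0
    · subst hw0; simp [Real.zero_rpow ha.ne']
    have hwp : 0 < ‖w‖ := norm_pos_iff.2 hw0
    obtain ⟨hq, hb0, hb, h1, h2⟩ := hA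
    rcases hq.eq_or_lt with hq0 | hq0
    · subst hq0
      rw [neg_zero, ENNReal.rpow_zero, mul_one]
      have key : ‖w‖ ^ a ≤ ‖w‖ ^ b * (1 + ‖w‖ ^ a) := by
        have p1 : 0 ≤ ‖w‖ ^ a := by positivity
        have p2 : 0 ≤ ‖w‖ ^ b := by positivity
        by_cases h3 : a ≤ 2
        · have := h1 h3
          rw [add_zero] at this; subst this
          nlinarith
        · push Not at h3
          rcases le_total ‖w‖ 1 with h6 | h6
          · have := Real.rpow_le_rpow_of_exponent_ge hwp h6 (by linarith : b ≤ a)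
            nlinarith
          · have := Real.one_le_rpow h6 hb0.le
            nlinarith
      refine le_trans ?_ le_add_self
      rw [← ENNReal.ofReal_add (by positivity) (by positivity)]
      apply ENNReal.ofReal_le_ofReal
      simp only [zero_sub, norm_neg, zero_add]
      rw [← add_div, div_mul_eq_mul_div]
      gcongr
      nlinarith
    · rw [norm_zero, ENNReal.ofReal_zero, ENNReal.zero_rpow_of_neg (by linarith), ENNReal.mul_top]
      · simp
      · have : 0 < (C + 2) / a * (‖w‖ ^ b * (1 + ‖w‖ ^ a)) := by positivity
        simpa using this
  · rw [ofReal_norm_rpow hz0, ← ENNReal.ofReal_mul (by positivity), ← ofReal_two_mul,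
      ← ENNReal.ofReal_add (by positivity) (by positivity), ← ENNReal.ofReal_add (by positivity) (by positivity)]
    apply ENNReal.ofReal_le_ofReal
    have h1 := h z w hz0 hz
    have h2 : 0 ≤ ‖w‖ ^ b * (1 + ‖w‖ ^ a) * ‖z‖ ^ (-q) := by positivity
    have e : 2 * (‖z‖ ^ a / a) + (C + 2) / a * (‖w‖ ^ b * (1 + ‖w‖ ^ a)) * ‖z‖ ^ (-q)
      = (2 * ‖z‖ ^ a + (C+2) * (‖w‖ ^ b * (1 + ‖w‖ ^ a) * ‖z‖ ^ (-q))) / a := by ring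
    rw [e, ← add_div]
    refine div_le_div_of_nonneg_right ?_ ha.le
    linarith

lemma sdE_lower {N : ℕ} {a b q : ℝ} (ha : 0 < a) (hA : Adm a b q) (z w : Euc N) :
    2 * ENNReal.ofReal (‖z‖ ^ a / a) ≤ ENNReal.ofReal (‖z - w‖ ^ a / a) + ENNReal.ofReal (‖z + w‖ ^ a / a) +
      ENNReal.ofReal (2 / a * ‖w‖ ^ b) * (ENNReal.ofReal ‖z‖) ^ (-q) := by
  by_cases hz0 : z = 0
  · subst hz0; simp [Real.zero_rpow ha.ne']
  · rw [ofReal_norm_rpow hz0, ← ENNReal.ofReal_mul (by positivity), ← ofReal_two_mul,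
      ← ENNReal.ofReal_add (by positivity) (by positivity), ← ENNReal.ofReal_add (by positivity) (by positivity)]
    apply ENNReal.ofReal_le_ofReal
    have h1 := sd_lower ha hA z w hz0
    have e : ‖z - w‖ ^ a / a + ‖z + w‖ ^ a / a + 2 / a * ‖w‖ ^ b * ‖z‖ ^ (-q)
      = (‖z + w‖ ^ a + ‖z - w‖ ^ a + 2 * (‖w‖ ^ b * ‖z‖ ^ (-q))) / a := by ring
    rw [e, ← mul_div_assoc]
    gcongr

lemma heat_sym {N : ℕ} {f : Euc N → ℝ≥0∞} (hf : Measurable f) (h : ℝ) (x : Euc N) :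
    2 * heat N h f x = ∫⁻ z, (f (x - z) + f (x + z)) ∂(gam N h) := by
  have hm : Measurable fun z => f (x - z) := hf.comp (by fun_prop)
  rw [lintegral_add_left hm, two_mul]
  congr 1
  have := gam_neg (N := N) (t := h) _ hm
  unfold heat
  rw [← this]
  simp

/-- moment of Gaussians, scaled -/
lemma gam_mom_scaled {N : ℕ} {b h : ℝ} (hb : 0 ≤ b) (hh : 0 < h) :
    ∫⁻ z, ENNReal.ofReal (‖z‖ ^ b) ∂(gam N h) =
      ENNReal.ofReal (h ^ (b/2)) * ∫⁻ z, ENNReal.ofReal (‖z‖ ^ b) ∂(gam N 1) := by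
  rw [gam_scale hh _ (by fun_prop)]
  have : ∀ z : Euc N, ENNReal.ofReal (‖Real.sqrt h • z‖ ^ b)
      = ENNReal.ofReal (h ^ (b/2)) * ENNReal.ofReal (‖z‖ ^ b) := by
    intro z
    rw [norm_smul, Real.norm_of_nonneg (Real.sqrt_nonneg _),
      Real.mul_rpow (Real.sqrt_nonneg _) (norm_nonneg _), ENNReal.ofReal_mul (by positivity)]
    congr 2
    rw [Real.sqrt_eq_rpow, ← Real.rpow_mul hh.le]; congr 1; ring
  simp_rw [this]
  rw [lintegral_const_mul _ (by fun_prop)]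

lemma gam_mom_bd (N : ℕ) {b : ℝ} (hb : 0 ≤ b) : ∃ C : ℝ, 0 < C ∧ ∀ h : ℝ, 0 < h →
    ∫⁻ z, ENNReal.ofReal (‖z‖ ^ b) ∂(gam N h) ≤ ENNReal.ofReal (C * h ^ (b/2)) := by
  refine ⟨(∫⁻ z, ENNReal.ofReal (‖z‖ ^ b) ∂(gam N 1)).toReal + 1, by positivity, fun h hh => ?_⟩
  rw [gam_mom_scaled hb hh, mul_comm, ENNReal.ofReal_mul (by positivity)]
  gcongr
  rw [← ENNReal.ofReal_toReal (gam_moment N hb).ne]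
  apply ENNReal.ofReal_le_ofReal
  simp

lemma gam_mom_bd2 (N : ℕ) {a b c : ℝ} (ha : 0 ≤ a) (hb : 0 ≤ b) (hc : 0 ≤ c) : ∃ C : ℝ, 0 < C ∧
    ∀ h : ℝ, 0 < h → h ≤ 1 →
    ∫⁻ z, ENNReal.ofReal (c * (‖z‖ ^ b * (1 + ‖z‖ ^ a))) ∂(gam N h) ≤ ENNReal.ofReal (C * h ^ (b/2)) := by
  obtain ⟨C1, hC1, h1⟩ := gam_mom_bd N hb
  obtain ⟨C2, hC2, h2⟩ := gam_mom_bd N (add_nonneg hb ha)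
  refine ⟨(c + 1) * (C1 + C2), by positivity, fun h hh hh1 => ?_⟩
  have e : ∀ z : Euc N, ENNReal.ofReal (c * (‖z‖ ^ b * (1 + ‖z‖ ^ a))) =
      ENNReal.ofReal c * (ENNReal.ofReal (‖z‖ ^ b) + ENNReal.ofReal (‖z‖ ^ (b + a))) := by
    intro z
    rw [← ENNReal.ofReal_add (by positivity) (by positivity), ← ENNReal.ofReal_mul hc,
      Real.rpow_add_of_nonneg (norm_nonneg _) hb ha]
    congr 1; ring
  simp_rw [e]
  rw [lintegral_const_mul _ (by fun_prop), lintegral_add_left (by fun_prop)]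
  have h3 : h ^ ((b+a)/2) ≤ h ^ (b/2) := Real.rpow_le_rpow_of_exponent_ge hh hh1 (by linarith)
  calc _ ≤ ENNReal.ofReal c * (ENNReal.ofReal (C1 * h ^ (b/2)) + ENNReal.ofReal (C2 * h ^ ((b+a)/2))) := by
        gcongr
        · exact h1 h hh
        · exact h2 h hh
    _ ≤ _ := by
        rw [← ENNReal.ofReal_add (by positivity) (by positivity), ← ENNReal.ofReal_mul hc]
        apply ENNReal.ofReal_le_ofReal
        have : 0 < h ^ (b/2) := by positivity
        have h4 : C1 * h ^ (b/2) + C2 * h ^ ((b+a)/2) ≤ (C1 + C2) * h ^ (b/2) := by nlinarith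
        have h5 : 0 ≤ (C1 + C2) * h ^ (b/2) := by positivity
        nlinarith

lemma measurable_Kint {N : ℕ} (q : ℝ) (x : Euc N) : Measurable fun y : Euc N => (ENNReal.ofReal ‖x - y‖) ^ (-q) := by
  fun_prop

lemma two_mul_le_cancel {x y : ℝ≥0∞} (h : 2 * x ≤ 2 * y) : x ≤ y :=
  (ENNReal.mul_le_mul_iff_right (by simp) (by simp)).1 h

lemma SU.ae_mem {N : ℕ} {s a : ℝ} {μ : Measure (Euc N)} {S : Set (Euc N)} (h : SU N s a μ S) :
    ∀ᵐ y ∂μ, y ∈ S := by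
  rw [ae_iff]; exact h.null

lemma heat_U_upper {N : ℕ} {s a : ℝ} {μ : Measure (Euc N)} {S : Set (Euc N)} (hS : SU N s a μ S)
    {b q : ℝ} (hA : Adm a b q) (R : ℝ) : ∃ C : ℝ, 0 < C ∧ ∀ x : Euc N, ‖x‖ ≤ R →
    (∀ w, Ua N a μ (x - w) + Ua N a μ (x + w) ≤ 2 * Ua N a μ x +
      ENNReal.ofReal (C * (‖w‖ ^ b * (1 + ‖w‖ ^ a))) * Kq N q μ x) ∧
    ∀ h : ℝ, 0 < h → h ≤ 1 →
      heat N h (Ua N a μ) x ≤ Ua N a μ x + ENNReal.ofReal (C * h ^ (b/2)) * Kq N q μ x := by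
  have := hS.prob
  obtain ⟨R0, hR0⟩ := hS.cpt.isBounded.exists_norm_le
  obtain ⟨C, hC, h1⟩ := sdE_upper (N := N) hS.ha hA (|R| + |R0|) (by positivity)
  have hb := hA.2.1
  obtain ⟨C', hC', h2⟩ := gam_mom_bd2 N hS.ha.le hb.le hC.le
  have main : ∀ x : Euc N, ‖x‖ ≤ R → ∀ w, Ua N a μ (x - w) + Ua N a μ (x + w) ≤ 2 * Ua N a μ x +
      ENNReal.ofReal (C * (‖w‖ ^ b * (1 + ‖w‖ ^ a))) * Kq N q μ x := by
    intro x hx w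
    unfold Ua Kq
    rw [← lintegral_add_left (by fun_prop), ← lintegral_const_mul _ (by fun_prop),
      ← lintegral_const_mul _ (by fun_prop), ← lintegral_add_left (by fun_prop)]
    refine lintegral_mono_ae ?_
    filter_upwards [hS.ae_mem] with y hy
    have := h1 (x - y) w ((norm_sub_le _ _).trans (add_le_add (hx.trans (le_abs_self _)) ((hR0 y hy).trans (le_abs_self _))))
    rwa [show x - w - y = x - y - w by abel, show x + w - y = x - y + w by abel]
  refine ⟨C + C', by positivity, fun x hx => ⟨fun w => (main x hx w).trans ?_, fun h hh hh1 => ?_⟩⟩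
  · gcongr
    linarith
  · apply two_mul_le_cancel
    have := gam_prob N hh
    rw [heat_sym (measurable_Ua a μ)]
    calc _ ≤ ∫⁻ z, (2 * Ua N a μ x + ENNReal.ofReal (C * (‖z‖ ^ b * (1 + ‖z‖ ^ a))) * Kq N q μ x) ∂(gam N h) :=
          lintegral_mono fun z => main x hx z
      _ = 2 * Ua N a μ x + (∫⁻ z, ENNReal.ofReal (C * (‖z‖ ^ b * (1 + ‖z‖ ^ a))) ∂(gam N h)) * Kq N q μ x := by
          rw [lintegral_add_left measurable_const, lintegral_const, measure_univ, mul_one,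
            lintegral_mul_const _ (by fun_prop)]
      _ ≤ 2 * Ua N a μ x + ENNReal.ofReal (C' * h ^ (b/2)) * Kq N q μ x := by gcongr; exact h2 h hh hh1
      _ ≤ 2 * Ua N a μ x + 2 * (ENNReal.ofReal ((C + C') * h ^ (b/2)) * Kq N q μ x) := by
          rw [two_mul (ENNReal.ofReal ((C + C') * h ^ (b/2)) * Kq N q μ x)]
          refine add_le_add le_rfl (le_trans ?_ le_self_add)
          gcongr
          linarith
      _ = _ := by rw [mul_add]

lemma heat_U_lower {N : ℕ} {s a : ℝ} {μ : Measure (Euc N)} {S : Set (Euc N)} (hS : SU N s a μ S)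
    {b q : ℝ} (hA : Adm a b q) : ∃ C : ℝ, 0 < C ∧ ∀ x : Euc N, 
    (∀ w, 2 * Ua N a μ x ≤ Ua N a μ (x - w) + Ua N a μ (x + w) +
      ENNReal.ofReal (C * ‖w‖ ^ b) * Kq N q μ x) ∧
    ∀ h : ℝ, 0 < h →
      Ua N a μ x ≤ heat N h (Ua N a μ) x + ENNReal.ofReal (C * h ^ (b/2)) * Kq N q μ x := by
  have := hS.prob
  have ha := hS.ha
  have hb := hA.2.1
  obtain ⟨C', hC', h2⟩ := gam_mom_bd N hb.le
  have main : ∀ x : Euc N, ∀ w, 2 * Ua N a μ x ≤ Ua N a μ (x - w) + Ua N a μ (x + w) +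
      ENNReal.ofReal (2 / a * ‖w‖ ^ b) * Kq N q μ x := by
    intro x w
    unfold Ua Kq
    rw [← lintegral_add_left (by fun_prop), ← lintegral_const_mul _ (by fun_prop),
      ← lintegral_const_mul _ (by fun_prop), ← lintegral_add_left (by fun_prop)]
    refine lintegral_mono fun y => ?_
    have := sdE_lower ha hA (x - y) w
    rwa [show x - w - y = x - y - w by abel, show x + w - y = x - y + w by abel]
  refine ⟨2 / a + 2 / a * C', by positivity, fun x => ⟨fun w => (main x w).trans ?_, fun h hh => ?_⟩⟩
  · gcongr
    have : 0 ≤ 2 / a * C' := by positivity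
    linarith
  · apply two_mul_le_cancel
    have := gam_prob N hh
    rw [mul_add, heat_sym (measurable_Ua a μ)]
    have hmU := measurable_Ua a μ
    have hm1 : Measurable fun z => Ua N a μ (x - z) + Ua N a μ (x + z) :=
      (hmU.comp (by fun_prop)).add (hmU.comp (by fun_prop))
    calc 2 * Ua N a μ x = ∫⁻ z, 2 * Ua N a μ x ∂(gam N h) := by rw [lintegral_const, measure_univ, mul_one]
      _ ≤ ∫⁻ z, (Ua N a μ (x - z) + Ua N a μ (x + z) +
      ENNReal.ofReal (2 / a * ‖z‖ ^ b) * Kq N q μ x) ∂(gam N h) := lintegral_mono fun z => main x z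
      _ = (∫⁻ z, (Ua N a μ (x - z) + Ua N a μ (x + z)) ∂(gam N h)) +
        (∫⁻ z, ENNReal.ofReal (2 / a * ‖z‖ ^ b) ∂(gam N h)) * Kq N q μ x := by
          rw [lintegral_add_left hm1, lintegral_mul_const _ (by fun_prop)]
      _ ≤ _ := by
          refine add_le_add le_rfl ?_
          rw [← mul_assoc]
          gcongr
          have e : ∀ z : Euc N, ENNReal.ofReal (2 / a * ‖z‖ ^ b) = ENNReal.ofReal (2/a) * ENNReal.ofReal (‖z‖ ^ b) :=
            fun z => ENNReal.ofReal_mul (by positivity)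
          simp_rw [e]
          rw [lintegral_const_mul _ (by fun_prop), ← ofReal_two_mul]
          refine (mul_le_mul_right (h2 h hh) _).trans ?_
          rw [← ENNReal.ofReal_mul (by positivity)]
          apply ENNReal.ofReal_le_ofReal
          have : 0 < h ^ (b/2) := by positivity
          have h3 : 0 ≤ 2 / a * h ^ (b/2) := by positivity
          have h4 : 0 ≤ 2 / a * C' * h ^ (b/2) := by positivity
          linarith

lemma SU.Ua_lt_top {N : ℕ} {s a : ℝ} {μ : Measure (Euc N)} {S : Set (Euc N)} (hS : SU N s a μ S) (x : Euc N) :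
    Ua N a μ x < ⊤ := by
  have := hS.prob
  unfold Ua
  calc _ ≤ ∫⁻ y, ENNReal.ofReal (2 ^ a / a) * (ENNReal.ofReal (‖x‖ ^ a) + ENNReal.ofReal (‖y‖ ^ a)) ∂μ :=
        lintegral_mono fun y => norm_rpow_le hS.ha x y
    _ < ⊤ := by
        rw [lintegral_const_mul _ (by fun_prop), lintegral_add_left measurable_const, lintegral_const,
          measure_univ, mul_one]
        exact ENNReal.mul_lt_top ENNReal.ofReal_lt_top (ENNReal.add_lt_top.2 ⟨ENNReal.ofReal_lt_top, hS.mom⟩)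

/-- real version of `1/c0` -/
noncomputable def ci (N : ℕ) (s : ℝ) : ℝ := ((c0 N s)⁻¹).toReal

lemma SU.ci_pos {N : ℕ} {s a : ℝ} {μ : Measure (Euc N)} {S : Set (Euc N)} (hS : SU N s a μ S) : 0 < ci N s := by
  refine ENNReal.toReal_pos ?_ ?_
  · exact ENNReal.inv_ne_zero.2 (c0_ne_top hS.hN hS.hsN)
  · exact ENNReal.inv_ne_top.2 (c0_ne_zero hS.hN hS.hs hS.hsN)

lemma SU.ci_eq {N : ℕ} {s a : ℝ} {μ : Measure (Euc N)} {S : Set (Euc N)} (hS : SU N s a μ S) :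
    ENNReal.ofReal (ci N s) = (c0 N s)⁻¹ :=
  ENNReal.ofReal_toReal (ENNReal.inv_ne_top.2 (c0_ne_zero hS.hN hS.hs hS.hsN))

lemma SU.ci_mul {N : ℕ} {s a : ℝ} {μ : Measure (Euc N)} {S : Set (Euc N)} (hS : SU N s a μ S) (x : ℝ≥0∞) :
    ENNReal.ofReal (ci N s) * (c0 N s * x) = x := by
  rw [hS.ci_eq, ← mul_assoc, ENNReal.inv_mul_cancel (c0_ne_zero hS.hN hS.hs hS.hsN) (c0_ne_top hS.hN hS.hsN), one_mul]

lemma A1 {N : ℕ} {s a : ℝ} {μ : Measure (Euc N)} {S : Set (Euc N)} (hS : SU N s a μ S)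
    {b q : ℝ} (hA : Adm a b q) : ∃ C : ℝ, 0 < C ∧ ∀ x ∈ S, ∀ h : ℝ, 0 < h → h ≤ 1 →
    Tm N (pw s) μ x ≤ heat N h (Tm N (pw s) μ) x + ENNReal.ofReal (C * h ^ (b/2)) * Kq N q μ x := by
  obtain ⟨R0, hR0⟩ := hS.cpt.isBounded.exists_norm_le
  obtain ⟨C, hC, h1⟩ := heat_U_upper hS hA R0
  have hci := hS.ci_pos
  refine ⟨ci N s * C, by positivity, fun x hx h hh hh1 => ?_⟩
  have h2 := (hS.EL x hx h hh x).trans (add_le_add_left ((h1 x (hR0 x hx)).2 h hh hh1) _)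
  rw [add_assoc] at h2
  have h3 := (ENNReal.add_le_add_iff_left (hS.Ua_lt_top x).ne).1 h2
  have h4 := mul_le_mul_right h3 (ENNReal.ofReal (ci N s))
  rw [mul_add, hS.ci_mul, hS.ci_mul, ← mul_assoc, ← ENNReal.ofReal_mul hci.le, add_comm] at h4
  rwa [mul_assoc]

lemma lint_pow {p ε H : ℝ} (hp : p ≠ 0) (hε : 0 < ε) (hH : ε ≤ H) :
    ∫⁻ h in Ioo ε H, ENNReal.ofReal (h ^ (p - 1)) = ENNReal.ofReal (H ^ p / p - ε ^ p / p) := by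
  refine lint_deriv (F := fun h => h ^ p / p) hH ?_ ?_ ?_
  · apply ContinuousOn.div_const
    apply ContinuousOn.rpow_const continuousOn_id
    intro x hx; left; simp; linarith [hx.1]
  · intro x hx
    have hx0 : 0 < x := by linarith [hx.1]
    have := (Real.hasDerivAt_rpow_const (x := x) (p := p) (Or.inl hx0.ne')).div_const p
    refine this.congr_deriv ?_
    field_simp
  · intro x hx
    have hx0 : 0 < x := by linarith [hx.1]
    positivity

/-- basic integral bound, positive exponents -/
lemma wint_pos {s β C ε H : ℝ} (hs : 0 < s) (hC : 0 ≤ C) (hβ : s < β) (hε : 0 < ε) (hH : ε ≤ H) :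
    ∫⁻ h in Ioo ε H, ENNReal.ofReal (s * h ^ (-1 - s)) * ENNReal.ofReal (C * h ^ β)
      ≤ ENNReal.ofReal (s * C / (β - s) * H ^ (β - s)) := by
  have e : ∫⁻ h in Ioo ε H, ENNReal.ofReal (s * h ^ (-1 - s)) * ENNReal.ofReal (C * h ^ β)
      = ∫⁻ h in Ioo ε H, ENNReal.ofReal (s * C) * ENNReal.ofReal (h ^ (β - s - 1)) := by
    refine setLIntegral_congr_fun measurableSet_Ioo fun h hh => ?_
    have h0 : 0 < h := hε.trans hh.1
    rw [← ENNReal.ofReal_mul (by positivity), ← ENNReal.ofReal_mul (by positivity)]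
    congr 1
    rw [show β - s - 1 = (-1 - s) + β by ring, Real.rpow_add h0]; ring
  rw [e, lintegral_const_mul _ (by fun_prop), lint_pow (by linarith) hε hH, ← ENNReal.ofReal_mul (by positivity)]
  apply ENNReal.ofReal_le_ofReal
  have h1 : 0 < β - s := by linarith
  have h2 : 0 ≤ ε ^ (β - s) / (β - s) := by positivity
  have h3 : 0 ≤ s * C := by positivity
  calc _ ≤ s * C * (H ^ (β - s) / (β - s)) := by gcongr; linarith
    _ = _ := by ring

/-- basic integral bound, negative exponents -/
lemma wint_neg {s β C ε H : ℝ} (hs : 0 < s) (hC : 0 ≤ C) (hβ : β < s) (hε : 0 < ε) (hH : ε ≤ H) :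
    ∫⁻ h in Ioo ε H, ENNReal.ofReal (s * h ^ (-1 - s)) * ENNReal.ofReal (C * h ^ β)
      ≤ ENNReal.ofReal (s * C / (s - β) * ε ^ (-(s - β))) := by
  have e : ∫⁻ h in Ioo ε H, ENNReal.ofReal (s * h ^ (-1 - s)) * ENNReal.ofReal (C * h ^ β)
      = ∫⁻ h in Ioo ε H, ENNReal.ofReal (s * C) * ENNReal.ofReal (h ^ (β - s - 1)) := by
    refine setLIntegral_congr_fun measurableSet_Ioo fun h hh => ?_
    have h0 : 0 < h := hε.trans hh.1
    rw [← ENNReal.ofReal_mul (by positivity), ← ENNReal.ofReal_mul (by positivity)]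
    congr 1
    rw [show β - s - 1 = (-1 - s) + β by ring, Real.rpow_add h0]; ring
  rw [e, lintegral_const_mul _ (by fun_prop), lint_pow (by linarith) hε hH, ← ENNReal.ofReal_mul (by positivity)]
  apply ENNReal.ofReal_le_ofReal
  have h1 : 0 < s - β := by linarith
  have hH0 : 0 < H := by linarith
  have h2 : 0 ≤ H ^ (β - s) / (s - β) := by positivity
  have h3 : 0 ≤ s * C := by positivity
  have e1 : H ^ (β - s) / (β - s) = - (H ^ (β - s) / (s - β)) := by
    rw [← neg_sub s β, div_neg]
  have e2 : ε ^ (β - s) / (β - s) = - (ε ^ (β - s) / (s - β)) := by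
    rw [← neg_sub s β, div_neg]
  rw [e1, e2, neg_sub]
  calc _ ≤ s * C * (ε ^ (β - s) / (s - β)) := by gcongr; linarith
    _ = _ := by ring

lemma Tm_mw_one_le {N : ℕ} {s H : ℝ} (hH : 0 < H) (μ : Measure (Euc N)) (x : Euc N) :
    Tm N (mw s H) μ x ≤ ENNReal.ofReal (H ^ (-s)) * Tm N (pw s) μ x := by
  unfold Tm
  have hm : Measurable fun y => Tk N (pw s) (x - y) :=
    (measurable_Tk (measurable_pw s)).comp (measurable_const.sub measurable_id)
  rw [← lintegral_const_mul _ hm]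
  exact lintegral_mono fun y => Tk_mw_le hH _

lemma A2_pre {N : ℕ} {s a : ℝ} {μ : Measure (Euc N)} {S : Set (Euc N)} (hS : SU N s a μ S)
    {b q K : ℝ} (hA : Adm a b q) (hK0 : 0 < K) (hK : ∀ x ∈ S, Kq N q μ x ≤ ENNReal.ofReal K) :
    ∃ C : ℝ, 0 < C ∧ ∀ x ∈ S, ∀ ε : ℝ, 0 < ε → ε ≤ 1 → Tm N (mw s ε) μ x ≤
      ENNReal.ofReal C + ∫⁻ h in Ioo ε 1, ENNReal.ofReal (s * h ^ (-1 - s)) * ENNReal.ofReal (C * h ^ (b/2)) := by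
  have := hS.prob
  obtain ⟨C1, hC1, h1⟩ := A1 hS hA
  obtain ⟨Cu, hCu, hu⟩ := hS.ub
  refine ⟨max Cu (C1 * K), lt_max_of_lt_left hCu, fun x hx ε hε hε1 => ?_⟩
  have h2 := ID_cmp hS.hs hε hε1 μ x ((hu x hx).trans_lt ENNReal.ofReal_lt_top) (fun _ => 0)
    (fun h => ENNReal.ofReal (max Cu (C1 * K) * h ^ (b/2))) measurable_const (by fun_prop) (by
      intro h hh
      have h0 : 0 < h := hε.trans hh.1
      rw [add_zero]
      refine (h1 x hx h h0 hh.2.le).trans (add_le_add le_rfl ?_)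
      refine (mul_le_mul_right (hK x hx) _).trans ?_
      rw [← ENNReal.ofReal_mul (by positivity)]
      apply ENNReal.ofReal_le_ofReal
      calc _ = (C1 * K) * h ^ (b/2) := by ring
        _ ≤ _ := by gcongr; exact le_max_right _ _)
  simp only [mul_zero, lintegral_zero, add_zero] at h2
  refine h2.trans (add_le_add ?_ le_rfl)
  refine (Tm_mw_one_le one_pos μ x).trans ?_
  rw [Real.one_rpow, ENNReal.ofReal_one, one_mul]
  exact (hu x hx).trans (ENNReal.ofReal_le_ofReal (le_max_left _ _))

lemma A2 {N : ℕ} {s a : ℝ} {μ : Measure (Euc N)} {S : Set (Euc N)} (hS : SU N s a μ S)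
    {b q K e : ℝ} (hA : Adm a b q) (hK0 : 0 < K) (hK : ∀ x ∈ S, Kq N q μ x ≤ ENNReal.ofReal K)
    (he0 : 0 < e) (he : s - b/2 ≤ e) :
    ∃ C : ℝ, 0 < C ∧ ∀ x ∈ S, ∀ ε : ℝ, 0 < ε → ε ≤ 1 → Tm N (mw s ε) μ x ≤
      ENNReal.ofReal (C * ε ^ (-e)) := by
  obtain ⟨C, hC, h⟩ := A2_pre hS hA hK0 hK
  have hs := hS.hs
  refine ⟨C + s * C / e, by positivity, fun x hx ε hε hε1 => (h x hx ε hε hε1).trans ?_⟩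
  have h1 : ∫⁻ h in Ioo ε 1, ENNReal.ofReal (s * h ^ (-1 - s)) * ENNReal.ofReal (C * h ^ (b/2)) ≤
      ∫⁻ h in Ioo ε 1, ENNReal.ofReal (s * h ^ (-1 - s)) * ENNReal.ofReal (C * h ^ (s - e)) := by
    refine setLIntegral_mono' measurableSet_Ioo fun h hh => ?_
    have h0 : 0 < h := hε.trans hh.1
    exact mul_le_mul_right (ENNReal.ofReal_le_ofReal (mul_le_mul_of_nonneg_left
      (Real.rpow_le_rpow_of_exponent_ge h0 hh.2.le (by linarith)) hC.le)) _
  refine (add_le_add le_rfl (h1.trans (wint_neg hs hC.le (by linarith) hε hε1))).trans ?_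
  rw [show s - (s - e) = e by ring, ← ENNReal.ofReal_add (by positivity) (by positivity)]
  apply ENNReal.ofReal_le_ofReal
  have h2 : 1 ≤ ε ^ (-e) := Real.one_le_rpow_of_pos_of_le_one_of_nonpos hε hε1 (by linarith)
  nlinarith

lemma A2f {N : ℕ} {s a : ℝ} {μ : Measure (Euc N)} {S : Set (Euc N)} (hS : SU N s a μ S)
    {b q K : ℝ} (hA : Adm a b q) (hK0 : 0 < K) (hK : ∀ x ∈ S, Kq N q μ x ≤ ENNReal.ofReal K)
    (he : s < b/2) :
    ∃ C : ℝ, 0 < C ∧ ∀ x ∈ S, ∀ ε : ℝ, 0 < ε → ε ≤ 1 → Tm N (mw s ε) μ x ≤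
      ENNReal.ofReal (C * ε ^ (-(0:ℝ))) := by
  obtain ⟨C, hC, h⟩ := A2_pre hS hA hK0 hK
  have hs := hS.hs
  have h0 : 0 < b/2 - s := by linarith
  refine ⟨C + s * C / (b/2 - s), by positivity, fun x hx ε hε hε1 => (h x hx ε hε hε1).trans ?_⟩
  refine (add_le_add le_rfl (wint_pos hs hC.le he hε hε1)).trans ?_
  rw [← ENNReal.ofReal_add (by positivity) (by positivity)]
  simp

lemma A3 {N : ℕ} {s C e : ℝ} (hs : 0 < s) (hs1 : s ≤ 1) (hC : 0 < C) : ∃ C' : ℝ, 0 < C' ∧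
    ∀ (μ : Measure (Euc N)) (x : Euc N), (∀ ε : ℝ, 0 < ε → ε ≤ 1 → Tm N (mw s ε) μ x ≤
      ENNReal.ofReal (C * ε ^ (-e))) → ∀ r : ℝ, 0 < r → r ≤ 1 →
      μ (Metric.closedBall x r) ≤ ENNReal.ofReal (C' * r ^ ((N:ℝ) - 2 * e)) := by
  obtain ⟨c, hc, hlow⟩ := Tk_mw_lower (N := N) (R := 1) hs hs1 (by norm_num)
  refine ⟨C / c, by positivity, fun μ x hM r hr hr1 => ?_⟩
  have h1 := hM (r ^ 2) (by positivity) (pow_le_one₀ hr.le hr1)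
  have h2 : ENNReal.ofReal (c * (r^2) ^ (-(N:ℝ)/2)) * μ (Metric.closedBall x r) ≤ Tm N (mw s (r^2)) μ x := by
    rw [← setLIntegral_const]
    refine le_trans ?_ (setLIntegral_le_lintegral (Metric.closedBall x r) _)
    refine setLIntegral_mono' measurableSet_closedBall fun y hy => hlow _ (by positivity) _ ?_
    rw [one_mul]
    have : ‖x - y‖ ≤ r := by rw [← dist_eq_norm, dist_comm]; exact hy
    gcongr
  have h3 := h2.trans h1
  have e1 : (r^2) ^ (-(N:ℝ)/2) = r ^ (-(N:ℝ)) := rpow_sq hr.le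
  have e2 : (r^2) ^ (-e) = r ^ (-(2*e)) := by
    rw [show -e = (-(2*e))/2 by ring]; exact rpow_sq hr.le
  rw [e1, e2] at h3
  have hcp : 0 < c * r ^ (-(N:ℝ)) := by positivity
  rw [mul_comm, ← ENNReal.le_div_iff_mul_le (Or.inl (by simpa using hcp)) (Or.inl ENNReal.ofReal_ne_top),
    ← ENNReal.ofReal_div_of_pos hcp] at h3
  refine h3.trans (ENNReal.ofReal_le_ofReal (le_of_eq ?_))
  rw [show (N:ℝ) - 2 * e = -(2*e) - (-(N:ℝ)) by ring, Real.rpow_sub hr]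
  field_simp

lemma dyadic_bd {q t : ℝ} (hq : 0 ≤ q) (ht : 0 ≤ t) :
    (ENNReal.ofReal t) ^ (-q) ≤ 1 + ∑' k : ℕ, ENNReal.ofReal (2 ^ (((k:ℝ) + 1) * q)) *
      (Iic (((1/2:ℝ)) ^ k)).indicator (fun _ => 1) t := by
  by_cases h1 : 1 < t
  · refine le_trans ?_ le_self_add
    rw [ENNReal.ofReal_rpow_of_pos (by linarith), ENNReal.ofReal_le_one]
    exact Real.rpow_le_one_of_one_le_of_nonpos h1.le (by linarith)
  push Not at h1
  rcases ht.eq_or_lt with h0 | h0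
  · subst h0
    have : ∑' k : ℕ, ENNReal.ofReal (2 ^ (((k:ℝ) + 1) * q)) *
      (Iic (((1/2:ℝ)) ^ k)).indicator (fun _ => 1) (0:ℝ) = ⊤ := by
      rw [eq_top_iff, ← ENNReal.tsum_const_eq_top_of_ne_zero (α := ℕ) (c := 1) one_ne_zero]
      refine ENNReal.tsum_le_tsum fun k => ?_
      rw [indicator_of_mem (by simp), mul_one, ENNReal.one_le_ofReal]
      exact Real.one_le_rpow (by norm_num) (by positivity)
    rw [this]; simp
  · refine le_trans ?_ le_add_self
    obtain ⟨n, hn1, hn2⟩ := exists_nat_pow_near_of_lt_one (y := (1/2:ℝ)) h0 h1 (by norm_num) (by norm_num)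
    refine le_trans ?_ (ENNReal.le_tsum n)
    rw [indicator_of_mem (by exact hn2), mul_one, ENNReal.ofReal_rpow_of_pos h0]
    apply ENNReal.ofReal_le_ofReal
    calc t ^ (-q) ≤ ((1/2:ℝ) ^ (n+1)) ^ (-q) := Real.rpow_le_rpow_of_nonpos (by positivity) hn1.le (by linarith)
      _ = _ := by
        rw [one_div, inv_pow, Real.inv_rpow (by positivity), Real.rpow_neg (by positivity), inv_inv,
          ← Real.rpow_natCast, ← Real.rpow_mul (by norm_num)]
        push_cast; rfl

lemma A4 {N : ℕ} {C p q : ℝ} (hC : 0 < C) (hq : 0 ≤ q) (hpq : q < p) : ∃ K : ℝ, 0 < K ∧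
    ∀ (μ : Measure (Euc N)) [IsProbabilityMeasure μ] (x : Euc N), (∀ r : ℝ, 0 < r → r ≤ 1 →
      μ (Metric.closedBall x r) ≤ ENNReal.ofReal (C * r ^ p)) → Kq N q μ x ≤ ENNReal.ofReal K := by
  have hr : 0 < (2:ℝ) ^ (q - p) := by positivity
  have hr1 : (2:ℝ) ^ (q - p) < 1 := Real.rpow_lt_one_of_one_lt_of_neg (by norm_num) (by linarith)
  have hsum : Summable fun k : ℕ => C * 2 ^ q * ((2:ℝ) ^ (q - p)) ^ k :=
    (summable_geometric_of_lt_one hr.le hr1).mul_left _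
  refine ⟨1 + ∑' k : ℕ, C * 2 ^ q * ((2:ℝ) ^ (q - p)) ^ k, ?_, fun μ _ x hμ => ?_⟩
  · have : 0 ≤ ∑' k : ℕ, C * 2 ^ q * ((2:ℝ) ^ (q - p)) ^ k := tsum_nonneg fun k => by positivity
    linarith
  · unfold Kq
    have hmeas : ∀ k : ℕ, Measurable fun y : Euc N => ENNReal.ofReal (2 ^ (((k:ℝ) + 1) * q)) *
      (Iic (((1/2:ℝ)) ^ k)).indicator (fun _ => (1:ℝ≥0∞)) ‖x - y‖ := by
      intro k
      refine Measurable.const_mul ?_ _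
      exact (measurable_const.indicator measurableSet_Iic).comp (by fun_prop : Measurable fun y : Euc N => ‖x - y‖)
    calc _ ≤ ∫⁻ y, (1 + ∑' k : ℕ, ENNReal.ofReal (2 ^ (((k:ℝ) + 1) * q)) *
      (Iic (((1/2:ℝ)) ^ k)).indicator (fun _ => 1) ‖x - y‖) ∂μ :=
          lintegral_mono fun y => dyadic_bd hq (norm_nonneg _)
      _ = 1 + ∑' k : ℕ, ENNReal.ofReal (2 ^ (((k:ℝ) + 1) * q)) * μ (Metric.closedBall x ((1/2:ℝ)^k)) := by
          rw [lintegral_add_left measurable_const, lintegral_const, measure_univ, mul_one,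
            lintegral_tsum fun k => (hmeas k).aemeasurable]
          congr 2; funext k
          have hm2 : Measurable fun y : Euc N => (Iic ((1/2:ℝ)^k)).indicator (fun _ => (1:ℝ≥0∞)) ‖x - y‖ :=
            (measurable_const.indicator measurableSet_Iic).comp (by fun_prop : Measurable fun y : Euc N => ‖x - y‖)
          rw [lintegral_const_mul _ hm2]
          congr 1
          rw [← lintegral_indicator_one measurableSet_closedBall]
          refine lintegral_congr fun y => ?_
          simp only [indicator, mem_Iic, Metric.mem_closedBall, dist_eq_norm, norm_sub_rev x y, Pi.one_apply]
      _ ≤ 1 + ∑' k : ℕ, ENNReal.ofReal (C * 2 ^ q * ((2:ℝ) ^ (q - p)) ^ k) := by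
          gcongr with k
          refine (mul_le_mul_right (hμ _ (by positivity) (pow_le_one₀ (by norm_num) (by norm_num))) _).trans ?_
          rw [← ENNReal.ofReal_mul (by positivity)]
          refine ENNReal.ofReal_le_ofReal (le_of_eq ?_)
          rw [one_div, inv_pow, Real.inv_rpow (by positivity), ← Real.rpow_natCast, ← Real.rpow_natCast, ← Real.rpow_mul (by norm_num),
            ← Real.rpow_mul (by norm_num), ← Real.rpow_neg (by norm_num), mul_left_comm, ← Real.rpow_add (by norm_num),
            mul_assoc, ← Real.rpow_add (by norm_num)]
          congr 2; ring
      _ = _ := by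
          rw [← ENNReal.ofReal_tsum_of_nonneg (fun k => by positivity) hsum, ENNReal.ofReal_add (by norm_num)
            (tsum_nonneg fun k => by positivity)]
          simp

lemma Kq_zero {N : ℕ} (μ : Measure (Euc N)) [IsProbabilityMeasure μ] (x : Euc N) : Kq N 0 μ x = 1 := by
  simp [Kq]

def Qb (N : ℕ) (μ : Measure (Euc N)) (S : Set (Euc N)) (q : ℝ) : Prop :=
  ∃ K : ℝ, 0 < K ∧ ∀ x ∈ S, Kq N q μ x ≤ ENNReal.ofReal K

lemma Qb_zero {N : ℕ} (μ : Measure (Euc N)) [IsProbabilityMeasure μ] (S : Set (Euc N)) : Qb N μ S 0 :=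
  ⟨1, one_pos, fun x _ => by rw [Kq_zero]; simp⟩

lemma boot_step {N : ℕ} {s a : ℝ} {μ : Measure (Euc N)} {S : Set (Euc N)} (hS : SU N s a μ S)
    {b q q' e : ℝ} (hA : Adm a b q) (hQ : Qb N μ S q) (he0 : 0 < e) (he : s - b/2 ≤ e)
    (hq0 : 0 ≤ q') (hq : q' < N - 2 * e) : Qb N μ S q' := by
  have := hS.prob
  obtain ⟨K, hK0, hK⟩ := hQ
  obtain ⟨C, hC, h1⟩ := A2 hS hA hK0 hK he0 he
  obtain ⟨C', hC', h2⟩ := A3 (N := N) (e := e) hS.hs hS.hs1 hC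
  obtain ⟨K', hK', h3⟩ := A4 (N := N) hC' hq0 hq
  exact ⟨K', hK', fun x hx => h3 μ x (h2 μ x (h1 x hx))⟩

lemma boot {N : ℕ} {s a : ℝ} {μ : Measure (Euc N)} {S : Set (Euc N)} (hS : SU N s a μ S) (bt : ℝ)
    (hbt2 : bt ≤ 2) (hbtN : bt ≤ N) (hab : a ≤ bt) (k : ℕ) : ∀ q', 0 ≤ q' → q' ≤ bt - a →
    q' ≤ k * ((N:ℝ) - 2 * s) → Qb N μ S q' := by
  have := hS.prob
  have ha := hS.ha
  have hsN := hS.hsN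
  induction k with
  | zero =>
    intro q' h0 h1 h2
    have : q' = 0 := by simp at h2; linarith
    subst this; exact Qb_zero μ S
  | succ k ih =>
    intro q' h0 h1 h2
    push_cast at h2
    set q := max (q' - ((N:ℝ) - 2 * s)) 0 with hq
    have hq1 : q' - ((N:ℝ) - 2 * s) ≤ q := le_max_left _ _
    have hq2 : 0 ≤ q := le_max_right _ _
    have hq3 : q ≤ bt - a := max_le (by linarith) (by linarith)
    have hq4 : q ≤ k * ((N:ℝ) - 2 * s) := max_le (by linarith) (mul_nonneg (by positivity) (by linarith))
    have hm1 : s - (a+q)/2 ≤ max (s - (a+q)/2) 0 := le_max_left _ _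
    have hm2 : 0 ≤ max (s - (a+q)/2) 0 := le_max_right _ _
    refine boot_step hS (b := a + q) (q := q) (e := max (s - (a+q)/2) 0 + a/4)
      ⟨hq2, by linarith, by linarith, fun _ => rfl, fun h => by linarith⟩ (ih q hq2 hq3 hq4) (by linarith)
      (by linarith) h0 ?_
    rcases max_cases (s - (a+q)/2) 0 with ⟨h, _⟩ | ⟨h, _⟩ <;> rw [h] <;> linarith

lemma boot_final {N : ℕ} {s a : ℝ} {μ : Measure (Euc N)} {S : Set (Euc N)} (hS : SU N s a μ S) :
    ∃ b q : ℝ, Adm a b q ∧ Qb N μ S q ∧ s + min 2 (N:ℝ) / 2 ≤ b := by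
  have := hS.prob
  have ha := hS.ha
  have hsN := hS.hsN
  have hs1 := hS.hs1
  have hs := hS.hs
  have m1 : min 2 (N:ℝ) ≤ 2 := min_le_left _ _
  have m2 : min 2 (N:ℝ) ≤ N := min_le_right _ _
  by_cases h : a ≤ s + min 2 (N:ℝ) / 2
  · refine ⟨s + min 2 (N:ℝ) / 2, s + min 2 (N:ℝ) / 2 - a, ⟨by linarith, by linarith, by linarith, fun _ => by ring, fun h => by linarith⟩, ?_, le_rfl⟩
    obtain ⟨k, hk⟩ := exists_nat_ge ((s + min 2 (N:ℝ) / 2 - a) / ((N:ℝ) - 2 * s))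
    refine boot hS (s + min 2 (N:ℝ) / 2) (by linarith) (by linarith) h k _ (by linarith) le_rfl ?_
    rwa [div_le_iff₀ (by linarith)] at hk
  · push Not at h
    refine ⟨min a 2, 0, ⟨le_rfl, lt_min ha two_pos, min_le_right _ _, fun h => by simp [h], fun h => by simp [h.le]⟩, Qb_zero μ S, le_min h.le (by linarith)⟩

lemma growth_lt {N : ℕ} {s a : ℝ} {μ : Measure (Euc N)} {S : Set (Euc N)} (hS : SU N s a μ S) (hs1 : s < 1) :
    ∃ C : ℝ, 0 < C ∧ ∀ x ∈ S, ∀ r : ℝ, 0 < r → r ≤ 1 → μ (Metric.closedBall x r) ≤ ENNReal.ofReal (C * r ^ N) := by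
  obtain ⟨b, q, hA, ⟨K, hK0, hK⟩, hb⟩ := boot_final hS
  have hsN := hS.hsN
  have : 2 * s < min 2 (N:ℝ) := lt_min (by linarith) hsN
  obtain ⟨C, hC, h1⟩ := A2f hS hA hK0 hK (by linarith)
  obtain ⟨C', hC', h2⟩ := A3 (N := N) (e := 0) hS.hs hS.hs1 hC
  refine ⟨C', hC', fun x hx r hr hr1 => (h2 μ x (h1 x hx) r hr hr1).trans (le_of_eq ?_)⟩
  simp

lemma growth_one {N : ℕ} {a : ℝ} {μ : Measure (Euc N)} {S : Set (Euc N)} (hS : SU N 1 a μ S) :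
    ∃ C : ℝ, 0 < C ∧ ∀ x ∈ S, ∀ r : ℝ, 0 < r → r ≤ 1 → μ (Metric.closedBall x r) ≤ ENNReal.ofReal (C * r ^ N) := by
  have := hS.prob
  obtain ⟨b, q, hA, ⟨K, hK0, hK⟩, hb⟩ := boot_final hS
  have hsN := hS.hsN
  have hb2 : b = 2 := by
    have : min 2 (N:ℝ) = 2 := min_eq_left (by linarith)
    rw [this] at hb
    exact le_antisymm hA.2.2.1 (by linarith)
  subst hb2
  obtain ⟨C, hC, h1⟩ := A1 hS hA
  obtain ⟨Cu, hCu, hu⟩ := hS.ub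
  set c : ℝ := (4 * π) ^ (-(N : ℝ) / 2) * Real.exp (-2 / 4) with hc
  have hc0 : 0 < c := by positivity
  refine ⟨2 * C * K / c, by positivity, fun x hx r hr hr1 => ?_⟩
  set h : ℝ := r ^ 2 with hh
  have h0 : 0 < h := by positivity
  have hpm : Measurable fun τ => pm N μ τ x :=
    (measurable_pm μ).comp (by fun_prop : Measurable fun τ : ℝ => (τ, x))
  have e1 : Tm N (pw 1) μ x = ∫⁻ τ in Ioi (0:ℝ), pm N μ τ x := by
    rw [Tm_eq (measurable_pw 1)]
    simp [pw]
  have e2 : heat N h (Tm N (pw 1) μ) x = ∫⁻ τ in Ioi h, pm N μ τ x := by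
    rw [heat_Tm (measurable_pw 1) μ h0]
    have : ∀ τ, (Ioi h).indicator (fun τ => pw 1 (τ - h)) τ * pm N μ τ x = (Ioi h).indicator (fun τ => pm N μ τ x) τ := by
      intro τ
      by_cases ht : τ ∈ Ioi h <;> simp [ht, pw]
    simp_rw [this]
    rw [lintegral_indicator measurableSet_Ioi, Measure.restrict_restrict measurableSet_Ioi,
      inter_eq_left.2 (Ioi_subset_Ioi h0.le)]
  have e3 : ∫⁻ τ in Ioi (0:ℝ), pm N μ τ x = (∫⁻ τ in Ioc 0 h, pm N μ τ x) + ∫⁻ τ in Ioi h, pm N μ τ x := by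
    rw [← lintegral_union measurableSet_Ioi, Ioc_union_Ioi_eq_Ioi h0.le]
    exact Set.disjoint_left.2 fun y hy hy2 => absurd hy.2 (not_le.2 hy2)
  have hfin : ∫⁻ τ in Ioi h, pm N μ τ x ≠ ⊤ := by
    refine ne_top_of_le_ne_top ?_ (lintegral_mono_set (Ioi_subset_Ioi h0.le))
    rw [← e1]
    exact ((hu x hx).trans_lt ENNReal.ofReal_lt_top).ne
  have h2 := h1 x hx h h0 (pow_le_one₀ hr.le hr1)
  rw [e2, e1, e3, add_comm] at h2
  have h3 := (ENNReal.add_le_add_iff_left hfin).1 h2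
  have h4 : ENNReal.ofReal (C * h ^ ((2:ℝ)/2)) * Kq N q μ x ≤ ENNReal.ofReal (C * K * h) := by
    refine (mul_le_mul_right (hK x hx) _).trans ?_
    rw [← ENNReal.ofReal_mul (by positivity)]
    refine ENNReal.ofReal_le_ofReal (le_of_eq ?_)
    norm_num; ring
  have h5 : ENNReal.ofReal (c * h ^ (-(N:ℝ)/2)) * μ (Metric.closedBall x r) * ENNReal.ofReal (h/2) ≤ ∫⁻ τ in Ioc 0 h, pm N μ τ x := by
    calc _ = ∫⁻ τ in Ioc (h/2) h, ENNReal.ofReal (c * h ^ (-(N:ℝ)/2)) * μ (Metric.closedBall x r) := by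
          rw [setLIntegral_const, Real.volume_Ioc]; congr 2; ring
      _ ≤ ∫⁻ τ in Ioc (h/2) h, pm N μ τ x := by
          refine setLIntegral_mono' measurableSet_Ioc fun τ hτ => ?_
          have hτ0 : 0 < τ := by linarith [hτ.1]
          rw [← setLIntegral_const]
          refine le_trans ?_ (setLIntegral_le_lintegral (Metric.closedBall x r) _)
          refine setLIntegral_mono' measurableSet_closedBall fun y hy => ENNReal.ofReal_le_ofReal ?_
          have : ‖x - y‖ ≤ r := by rw [← dist_eq_norm, dist_comm]; exact hy
          refine le_trans ?_ (gk_lower (R := 2) hτ0 _ ?_)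
          · refine mul_le_mul_of_nonneg_left ?_ hc0.le
            refine Real.rpow_le_rpow_of_nonpos hτ0 hτ.2 ?_
            have : (0:ℝ) ≤ N := by positivity
            linarith
          · have : ‖x - y‖ ^ 2 ≤ r ^ 2 := by gcongr
            linarith [hτ.1]
      _ ≤ _ := lintegral_mono_set (Ioc_subset_Ioc_left (by linarith))
  have h6 := h5.trans (h3.trans h4)
  have e4 : h ^ (-(N:ℝ)/2) = r ^ (-(N:ℝ)) := rpow_sq hr.le
  rw [e4, mul_right_comm, ← ENNReal.ofReal_mul (by positivity)] at h6
  have hcp : 0 < c * r ^ (-(N:ℝ)) * (h/2) := by positivity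
  rw [mul_comm, ← ENNReal.le_div_iff_mul_le (Or.inl (by simpa using hcp)) (Or.inl ENNReal.ofReal_ne_top),
    ← ENNReal.ofReal_div_of_pos hcp] at h6
  refine h6.trans (ENNReal.ofReal_le_ofReal (le_of_eq ?_))
  rw [Real.rpow_neg hr.le, Real.rpow_natCast]
  field_simp

lemma growth {N : ℕ} {s a : ℝ} {μ : Measure (Euc N)} {S : Set (Euc N)} (hS : SU N s a μ S) :
    ∃ C : ℝ, 0 < C ∧ ∀ x ∈ S, ∀ r : ℝ, 0 < r → r ≤ 1 → μ (Metric.closedBall x r) ≤ ENNReal.ofReal (C * r ^ N) := by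
  rcases hS.hs1.lt_or_eq with h | h
  · exact growth_lt hS h
  · subst h; exact growth_one hS

lemma growth_all {N : ℕ} {s a : ℝ} {μ : Measure (Euc N)} {S : Set (Euc N)} (hS : SU N s a μ S) :
    ∃ C : ℝ, 0 < C ∧ ∀ x, ∀ r : ℝ, 0 < r → r ≤ 1/2 → μ (Metric.closedBall x r) ≤
      ENNReal.ofReal C * volume (Metric.closedBall x r) := by
  obtain ⟨C, hC, h⟩ := growth hS
  have hN := hS.hN
  have : Nonempty (Fin N) := ⟨⟨0, hN⟩⟩
  set v : ℝ := (volume (Metric.closedBall (0:Euc N) 1)).toReal with hv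
  have hvt : volume (Metric.closedBall (0:Euc N) 1) ≠ ⊤ := (isCompact_closedBall _ _).measure_lt_top.ne
  have hv0 : 0 < v := ENNReal.toReal_pos (Metric.measure_closedBall_pos _ _ one_pos).ne' hvt
  refine ⟨C * 2 ^ N / v, by positivity, fun x r hr hr1 => ?_⟩
  by_cases hne : (Metric.closedBall x r ∩ S).Nonempty
  · obtain ⟨y, hy, hyS⟩ := hne
    have hsub : Metric.closedBall x r ⊆ Metric.closedBall y (2 * r) := by
      refine Metric.closedBall_subset_closedBall' ?_
      rw [Metric.mem_closedBall, dist_comm] at hy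
      linarith
    refine (measure_mono hsub).trans ((h y hyS (2 * r) (by positivity) (by linarith)).trans (le_of_eq ?_))
    rw [Measure.addHaar_closedBall' _ _ hr.le]
    rw [← ENNReal.ofReal_toReal hvt, ← hv, ← ENNReal.ofReal_mul (by positivity), ← ENNReal.ofReal_mul (by positivity)]
    congr 1
    simp only [finrank_euclideanSpace, Fintype.card_fin]
    field_simp
    exact mul_pow _ _ _
  · have : Metric.closedBall x r ⊆ Sᶜ := fun y hy hyS => hne ⟨y, hy, hyS⟩
    rw [measure_mono_null this hS.null]; exact zero_le

lemma le_vol {N : ℕ} {s a : ℝ} {μ : Measure (Euc N)} {S : Set (Euc N)} (hS : SU N s a μ S) :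
    ∃ C : ℝ, 0 < C ∧ ∀ A, μ A ≤ ENNReal.ofReal C * volume A := by
  have := hS.prob
  obtain ⟨C, hC, h⟩ := growth_all hS
  refine ⟨C, hC, fun A => ?_⟩
  refine ENNReal.le_of_forall_pos_le_add fun ε hε _ => ?_
  obtain ⟨t, r, ht, htA, hr, hcov, hsum⟩ := Besicovitch.exists_closedBall_covering_tsum_measure_le
    (volume : Measure (Euc N)) (ε := (ε : ℝ≥0∞) / ENNReal.ofReal C) (by
      simp only [ne_eq, ENNReal.div_eq_zero_iff, not_or]
      exact ⟨by simpa using hε.ne', ENNReal.ofReal_ne_top⟩) (fun _ => Ioc 0 (1/2)) A (by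
      intro x _ δ hδ
      exact ⟨min (1/2) (δ/2), ⟨by positivity, min_le_left _ _⟩, by positivity, (min_le_right _ _).trans_lt (by linarith)⟩)
  have hcount : Countable t := ht.to_subtype
  calc μ A ≤ μ (⋃ x ∈ t, Metric.closedBall x (r x)) := measure_mono hcov
    _ ≤ ∑' x : t, μ (Metric.closedBall x (r x)) := measure_biUnion_le _ ht _
    _ ≤ ∑' x : t, ENNReal.ofReal C * volume (Metric.closedBall (x:Euc N) (r x)) := by
        refine ENNReal.tsum_le_tsum fun x => ?_
        have := hr x x.2
        exact h _ _ this.1 this.2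
    _ = ENNReal.ofReal C * ∑' x : t, volume (Metric.closedBall (x:Euc N) (r x)) := ENNReal.tsum_mul_left
    _ ≤ ENNReal.ofReal C * (volume A + ε / ENNReal.ofReal C) := by gcongr
    _ = _ := by
        rw [mul_add, ENNReal.mul_div_cancel (by simpa using hC) ENNReal.ofReal_ne_top]

/-- bounded density -/
lemma density {N : ℕ} {s a : ℝ} {μ : Measure (Euc N)} {S : Set (Euc N)} (hS : SU N s a μ S) :
    ∃ (ρ : Euc N → ℝ) (C : ℝ), 0 < C ∧ Measurable ρ ∧ (∀ x, 0 ≤ ρ x) ∧ (∀ x, ρ x ≤ C) ∧ (∀ x, x ∉ S → ρ x = 0) ∧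
      μ = volume.withDensity fun x => ENNReal.ofReal (ρ x) := by
  have := hS.prob
  obtain ⟨C, hC, h⟩ := le_vol hS
  have hac : μ ≪ volume := by
    intro A hA
    have := h A
    rw [hA, mul_zero] at this
    exact le_antisymm this zero_le
  have hr : volume.withDensity (μ.rnDeriv volume) = μ := Measure.withDensity_rnDeriv_eq _ _ hac
  have hle : μ.rnDeriv volume ≤ᵐ[volume] fun _ => ENNReal.ofReal C := by
    refine ae_le_of_forall_setLIntegral_le_of_sigmaFinite (Measure.measurable_rnDeriv _ _) fun A hA _ => ?_
    rw [← withDensity_apply _ hA, hr, setLIntegral_const]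
    exact h A
  have hz : ∀ᵐ x ∂volume, x ∉ S → μ.rnDeriv volume x = 0 := by
    have hSc := hS.cpt.isClosed.measurableSet.compl
    have h1 : ∫⁻ x in Sᶜ, μ.rnDeriv volume x = 0 := by
      rw [← withDensity_apply _ hSc, hr, hS.null]
    rw [lintegral_eq_zero_iff (Measure.measurable_rnDeriv _ _)] at h1
    exact (ae_restrict_iff' hSc).1 h1
  refine ⟨S.indicator fun x => min (μ.rnDeriv volume x).toReal C, C, hC, ?_, ?_, ?_, ?_, ?_⟩
  · exact Measurable.indicator ((Measure.measurable_rnDeriv _ _).ennreal_toReal.min measurable_const)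
      hS.cpt.isClosed.measurableSet
  · exact fun x => indicator_nonneg (fun x _ => le_min ENNReal.toReal_nonneg hC.le) x
  · exact fun x => indicator_le' (fun x _ => min_le_right _ _) (fun x _ => hC.le) x
  · exact fun x hx => indicator_of_notMem hx _
  · conv_lhs => rw [← hr]
    refine withDensity_congr_ae ?_
    filter_upwards [hle, hz] with x hx hx2
    by_cases hxS : x ∈ S
    · rw [indicator_of_mem hxS, min_eq_left (ENNReal.toReal_le_of_le_ofReal hC.le hx),
        ENNReal.ofReal_toReal (ne_top_of_le_ne_top ENNReal.ofReal_ne_top hx)]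
    · rw [indicator_of_notMem hxS, hx2 hxS]; simp

lemma mr_le2 {s H τ : ℝ} (hs : 0 < s) (hs1 : s ≤ 1) (hH : 0 < H) (hτ : 0 < τ) :
    mr s H τ ≤ H ^ (1 - s) * τ ^ (s - 2) := by
  rcases le_total τ H with h | h
  · rw [mr_eq hs hτ h, show 1 - s = -s + 1 by ring, show s - 2 = (s - 1) - 1 by ring, Real.rpow_add_one hH.ne',
      Real.rpow_sub_one hτ.ne' (s-1)]
    have : 1 ≤ H / τ := (one_le_div hτ).2 h
    calc H ^ (-s) * τ ^ (s-1) = H ^ (-s) * τ ^ (s-1) * 1 := by ring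
      _ ≤ H ^ (-s) * τ ^ (s-1) * (H/τ) := by gcongr
      _ = _ := by ring
  · unfold mr
    rw [max_eq_left (by linarith)]
    have ht0 : 0 ≤ (τ - H) / τ := div_nonneg (by linarith) hτ.le
    have ht1 : (τ - H) / τ ≤ 1 := (div_le_one hτ).2 (by linarith)
    have h1 : (τ - H) / τ ≤ ((τ - H) / τ) ^ s := by
      rcases ht0.eq_or_lt with h0 | h0
      · rw [← h0]; exact Real.rpow_nonneg le_rfl _
      · calc (τ - H) / τ = ((τ - H) / τ) ^ (1:ℝ) := (Real.rpow_one _).symm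
          _ ≤ _ := Real.rpow_le_rpow_of_exponent_ge h0 ht1 hs1
    rw [Real.div_rpow (by linarith) hτ.le] at h1
    have hts : 0 < τ ^ s := by positivity
    rw [le_div_iff₀ hts] at h1
    have h2 : τ ^ s - (τ - H) ^ s ≤ H * τ⁻¹ * τ ^ s := by
      have : (τ - H) / τ * τ ^ s = τ ^ s - H * τ⁻¹ * τ ^ s := by field_simp
      linarith
    calc _ ≤ H ^ (-s) * τ⁻¹ * (H * τ⁻¹ * τ ^ s) := by gcongr
      _ = _ := by
        rw [show 1 - s = -s + 1 by ring, show s - 2 = (s - 1) - 1 by ring, Real.rpow_add_one hH.ne',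
          Real.rpow_sub_one hτ.ne' (s-1), Real.rpow_sub_one hτ.ne' s]
        field_simp

/-- moments of the weight -/
noncomputable def Wt (s H q : ℝ) : ℝ≥0∞ := ∫⁻ τ in Ioi (0:ℝ), mw s H τ * ENNReal.ofReal (τ ^ q)

lemma Wt_scale {s H : ℝ} (hH : 0 < H) (q : ℝ) : Wt s H q = ENNReal.ofReal (H ^ q) * Wt s 1 q := by
  unfold Wt
  have hm : ∀ H, Measurable fun τ => mw s H τ * ENNReal.ofReal (τ ^ q) := fun H =>
    (measurable_mw s H).mul (by fun_prop)
  rw [lint_Ioi_scale hH _ (hm H), ← lintegral_const_mul' _ _ ENNReal.ofReal_ne_top,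
    ← lintegral_const_mul' _ _ ENNReal.ofReal_ne_top]
  refine setLIntegral_congr_fun measurableSet_Ioi fun τ (hτ : 0 < τ) => ?_
  unfold mw
  rw [mr_scale hH hτ, Real.mul_rpow hH.le hτ.le, ENNReal.ofReal_mul (by positivity), ENNReal.ofReal_mul (by positivity)]
  have : ENNReal.ofReal H * ENNReal.ofReal H⁻¹ = 1 := by
    rw [← ENNReal.ofReal_mul hH.le, mul_inv_cancel₀ hH.ne', ENNReal.ofReal_one]
  calc _ = (ENNReal.ofReal H * ENNReal.ofReal H⁻¹) * (ENNReal.ofReal (H ^ q) * (ENNReal.ofReal (mr s 1 τ) * ENNReal.ofReal (τ ^ q))) := by ring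
    _ = _ := by rw [this, one_mul]

lemma Wt_lt_top {s q : ℝ} (hs : 0 < s) (hs1 : s ≤ 1) (hq : -s < q) (hq1 : q < 1 - s) : Wt s 1 q < ⊤ := by
  unfold Wt
  have hsplit : Ioi (0:ℝ) = Ioc 0 1 ∪ Ioi 1 := (Ioc_union_Ioi_eq_Ioi zero_le_one).symm
  rw [hsplit]
  refine lt_of_le_of_lt (lintegral_union_le _ _ _) (ENNReal.add_lt_top.2 ⟨?_, ?_⟩)
  · calc _ ≤ ∫⁻ τ in Ioc (0:ℝ) 1, ENNReal.ofReal (τ ^ (s - 1 + q)) := by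
          refine setLIntegral_mono' measurableSet_Ioc fun τ hτ => ?_
          have hτ0 := hτ.1
          unfold mw
          rw [← ENNReal.ofReal_mul' (by positivity), Real.rpow_add hτ0]
          apply ENNReal.ofReal_le_ofReal
          have := mr_le (s := s) one_pos hτ0
          rw [Real.one_rpow, one_mul] at this
          gcongr
      _ < ⊤ := by
          have := (intervalIntegral.intervalIntegrable_rpow' (a := 0) (b := 1) (r := s - 1 + q) (by linarith))
          rw [intervalIntegrable_iff_integrableOn_Ioc_of_le zero_le_one] at this
          exact Integrable.lintegral_lt_top this
  · calc _ ≤ ∫⁻ τ in Ioi (1:ℝ), ENNReal.ofReal (τ ^ (s - 2 + q)) := by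
          refine setLIntegral_mono' measurableSet_Ioi fun τ (hτ : 1 < τ) => ?_
          have hτ0 : 0 < τ := by linarith
          unfold mw
          rw [← ENNReal.ofReal_mul' (by positivity), Real.rpow_add hτ0]
          apply ENNReal.ofReal_le_ofReal
          have := mr_le2 hs hs1 one_pos hτ0
          rw [Real.one_rpow, one_mul] at this
          gcongr
      _ < ⊤ := by
        have := integrableOn_Ioi_rpow_of_lt (a := s - 2 + q) (c := 1) (by linarith) one_pos
        exact Integrable.lintegral_lt_top this

/-- normalisation -/
noncomputable def Zc (s : ℝ) : ℝ := (Wt s 1 0).toReal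

lemma Wt_zero_pos {s : ℝ} (hs : 0 < s) : Wt s 1 0 ≠ 0 := by
  unfold Wt
  have hm : Measurable fun τ => mw s 1 τ * ENNReal.ofReal (τ ^ (0:ℝ)) :=
    (measurable_mw s 1).mul (by fun_prop)
  rw [← pos_iff_ne_zero, setLIntegral_pos_iff hm]
  have : Ioc (0:ℝ) 1 ⊆ (Function.support fun τ => mw s 1 τ * ENNReal.ofReal (τ ^ (0:ℝ))) ∩ Ioi 0 := by
    intro τ hτ
    refine ⟨?_, hτ.1⟩
    have h0 := hτ.1
    simp only [Function.mem_support, Real.rpow_zero, ENNReal.ofReal_one, mul_one, mw]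
    rw [mr_eq hs hτ.1 hτ.2]
    have : 0 < (1:ℝ) ^ (-s) * τ ^ (s - 1) := by positivity
    simpa using this
  refine lt_of_lt_of_le ?_ (measure_mono this)
  simp

lemma Zc_eq {s : ℝ} (hs : 0 < s) (hs1 : s < 1) : ENNReal.ofReal (Zc s) = Wt s 1 0 :=
  ENNReal.ofReal_toReal (Wt_lt_top hs hs1.le (by linarith) (by linarith)).ne

lemma Zc_pos {s : ℝ} (hs : 0 < s) (hs1 : s < 1) : 0 < Zc s :=
  ENNReal.toReal_pos (Wt_zero_pos hs) (Wt_lt_top hs hs1.le (by linarith) (by linarith)).ne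

lemma Tk_lint {N : ℕ} {w : ℝ → ℝ≥0∞} (hw : Measurable w) {f : Euc N → ℝ≥0∞} (hf : Measurable f) :
    ∫⁻ z, Tk N w z * f z = ∫⁻ τ in Ioi (0:ℝ), w τ * ∫⁻ z, f z ∂(gam N τ) := by
  have hm : Measurable fun p : Euc N × ℝ => w p.2 * gE N p.2 p.1 * f p.1 :=
    ((hw.comp measurable_snd).mul ((measurable_gE N).comp measurable_swap)).mul (hf.comp measurable_fst)
  have e1 : ∀ z, Tk N w z * f z = ∫⁻ τ in Ioi (0:ℝ), w τ * gE N τ z * f z := by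
    intro z
    have hm1 : Measurable fun τ => w τ * gE N τ z := hw.mul ((measurable_gE N).comp (by fun_prop : Measurable fun τ : ℝ => (τ, z)))
    rw [lintegral_mul_const _ hm1]; rfl
  simp_rw [e1]
  rw [lintegral_lintegral_swap hm.aemeasurable]
  refine lintegral_congr fun τ => ?_
  have hm2 : Measurable fun z => gE N τ z * f z := (measurable_gE' N τ).mul hf
  rw [lintegral_gam f hf, ← lintegral_const_mul _ hm2]
  simp_rw [mul_assoc]

lemma Tk_total {N : ℕ} {s H : ℝ} (hs : 0 < s) (hs1 : s < 1) (hH : 0 < H) :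
    ∫⁻ z, Tk N (mw s H) z = ENNReal.ofReal (Zc s) := by
  have := Tk_lint (N := N) (measurable_mw s H) (f := fun _ => 1) measurable_const
  simp only [mul_one] at this
  rw [this, Zc_eq hs hs1]
  have h2 := Wt_scale (s := s) hH 0
  rw [Real.rpow_zero, ENNReal.ofReal_one, one_mul] at h2
  rw [← h2]
  refine setLIntegral_congr_fun measurableSet_Ioi fun τ (hτ : 0 < τ) => ?_
  have := gam_prob N hτ
  simp

lemma Tk_moment (N : ℕ) {s : ℝ} (hs : 0 < s) (hs1 : s < 1) : ∃ C : ℝ, 0 < C ∧ ∀ H : ℝ, 0 < H →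
    ∫⁻ z, Tk N (mw s H) z * ENNReal.ofReal (‖z‖ ^ (1 - s)) ≤ ENNReal.ofReal (C * H ^ ((1 - s)/2)) := by
  obtain ⟨C1, hC1, h1⟩ := gam_mom_bd N (b := 1 - s) (by linarith)
  have hW := Wt_lt_top hs hs1.le (q := (1-s)/2) (by linarith) (by linarith)
  refine ⟨C1 * ((Wt s 1 ((1-s)/2)).toReal + 1), by positivity, fun H hH => ?_⟩
  rw [Tk_lint (measurable_mw s H) (by fun_prop)]
  calc _ ≤ ∫⁻ τ in Ioi (0:ℝ), ENNReal.ofReal C1 * (mw s H τ * ENNReal.ofReal (τ ^ ((1-s)/2))) := by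
        refine setLIntegral_mono' measurableSet_Ioi fun τ (hτ : 0 < τ) => ?_
        refine (mul_le_mul_right (h1 τ hτ) _).trans (le_of_eq ?_)
        rw [ENNReal.ofReal_mul hC1.le]; ring
    _ = ENNReal.ofReal C1 * (ENNReal.ofReal (H ^ ((1-s)/2)) * Wt s 1 ((1-s)/2)) := by
        rw [lintegral_const_mul' _ _ ENNReal.ofReal_ne_top, ← Wt_scale hH]; rfl
    _ ≤ _ := by
        rw [← ENNReal.ofReal_toReal hW.ne, ← ENNReal.ofReal_mul (by positivity), ← ENNReal.ofReal_mul (by positivity)]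
        apply ENNReal.ofReal_le_ofReal
        rw [ENNReal.toReal_ofReal (by positivity)]
        have : 0 < C1 * H ^ ((1-s)/2) := by positivity
        nlinarith

lemma lint_le_vol {N : ℕ} {μ : Measure (Euc N)} {C : ℝ} (hμ : ∀ A, μ A ≤ ENNReal.ofReal C * volume A) (f : Euc N → ℝ≥0∞) :
    ∫⁻ y, f y ∂μ ≤ ENNReal.ofReal C * ∫⁻ y, f y := by
  rw [← smul_eq_mul, ← lintegral_smul_measure]
  refine lintegral_mono' (Measure.le_iff'.2 fun A => ?_) le_rfl
  simpa using hμ A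

lemma pm_le_C {N : ℕ} {μ : Measure (Euc N)} {C : ℝ} (hμ : ∀ A, μ A ≤ ENNReal.ofReal C * volume A) {τ : ℝ}
    (hτ : 0 < τ) (x : Euc N) : pm N μ τ x ≤ ENNReal.ofReal C := by
  refine (lint_le_vol hμ _).trans ?_
  rw [lintegral_sub_left_eq_self (fun y => gE N τ y) x, lintegral_gE hτ, mul_one]

lemma gk_mod {N : ℕ} {τ : ℝ} (hτ : 0 < τ) (z z' : Euc N) :
    gk N τ z ≤ gk N τ z' + gk N τ z * (‖z - z'‖ * (2 * ‖z‖ + ‖z - z'‖) / (4 * τ)) := by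
  have h1 : ‖z'‖ ≤ ‖z‖ + ‖z - z'‖ := by
    have := norm_sub_le z (z - z'); simpa using this
  have h2 : ‖z'‖ ^ 2 - ‖z‖ ^ 2 ≤ ‖z - z'‖ * (2 * ‖z‖ + ‖z - z'‖) := by nlinarith [norm_nonneg z, norm_nonneg z', norm_nonneg (z-z')]
  have h3 := Real.add_one_le_exp ((-‖z'‖^2/(4*τ)) - (-‖z‖^2/(4*τ)))
  rw [Real.exp_sub] at h3
  have he := Real.exp_pos (-‖z‖^2/(4*τ))
  rw [le_div_iff₀ he] at h3
  have h4 : (-‖z'‖^2/(4*τ)) - (-‖z‖^2/(4*τ)) = - ((‖z'‖ ^ 2 - ‖z‖ ^ 2) / (4 * τ)) := by ring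
  have h5 : (‖z'‖ ^ 2 - ‖z‖ ^ 2) / (4 * τ) ≤ ‖z - z'‖ * (2 * ‖z‖ + ‖z - z'‖) / (4 * τ) := by gcongr
  have h6 : Real.exp (-‖z‖^2/(4*τ)) ≤ Real.exp (-‖z'‖^2/(4*τ)) +
      Real.exp (-‖z‖^2/(4*τ)) * (‖z - z'‖ * (2 * ‖z‖ + ‖z - z'‖) / (4 * τ)) := by
    rw [h4] at h3
    nlinarith
  unfold gk
  have hp : 0 < (4 * π * τ) ^ (-(N : ℝ) / 2) := by positivity
  nlinarith

lemma pm_mod (N : ℕ) {s C : ℝ} (hs : 0 < s) (hs1 : s ≤ 1) (hC : 0 < C) : ∃ C' : ℝ, 0 < C' ∧ ∀ (μ : Measure (Euc N)),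
    (∀ A, μ A ≤ ENNReal.ofReal C * volume A) → ∀ τ : ℝ, 0 < τ → ∀ x x' : Euc N,
    pm N μ τ x ≤ pm N μ τ x' + ENNReal.ofReal (C' * (‖x - x'‖ ^ s * τ ^ (-(s/2)))) := by
  obtain ⟨C1, hC1, h1⟩ := gam_mom_bd N (b := 1) (by linarith)
  refine ⟨C * (C1 + 1), by positivity, fun μ hμ τ hτ x x' => ?_⟩
  set d := ‖x - x'‖ with hd
  have hd0 : 0 ≤ d := norm_nonneg _
  have hsq : 0 < Real.sqrt τ := Real.sqrt_pos.2 hτ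
  set t := d / Real.sqrt τ with ht
  have ht0 : 0 ≤ t := by positivity
  have ets : d ^ s * τ ^ (-(s/2)) = t ^ s := by
    rw [ht, Real.div_rpow hd0 hsq.le, Real.sqrt_eq_rpow, ← Real.rpow_mul hτ.le, Real.rpow_neg hτ.le, div_eq_mul_inv]
    congr 3; ring
  rw [ets]
  rcases le_total 1 t with h | h
  · refine (pm_le_C hμ hτ x).trans (le_add_left (ENNReal.ofReal_le_ofReal ?_))
    have : 1 ≤ t ^ s := Real.one_le_rpow h hs.le
    have h2 : 0 < C * C1 := by positivity
    nlinarith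
  · have hts : t ≤ t ^ s := by
      rcases ht0.eq_or_lt with h0 | h0
      · rw [← h0]; exact Real.rpow_nonneg le_rfl _
      · calc t = t ^ (1:ℝ) := (Real.rpow_one _).symm
          _ ≤ _ := Real.rpow_le_rpow_of_exponent_ge h0 h hs1
    set D : Euc N → ℝ≥0∞ := fun z => gE N τ z * ENNReal.ofReal (d * (2 * ‖z‖ + d) / (4 * τ)) with hD
    have hDm : Measurable D := (measurable_gE' N τ).mul (by fun_prop)
    have h2 : ∀ y, gE N τ (x - y) ≤ gE N τ (x' - y) + D (x - y) := by
      intro y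
      have := gk_mod hτ (x - y) (x' - y)
      rw [sub_sub_sub_cancel_right, ← hd] at this
      rw [hD]; unfold gE
      have hg := gk_pos hτ (x - y)
      have hg' := gk_pos hτ (x' - y)
      beta_reduce
      rw [← ENNReal.ofReal_mul hg.le, ← ENNReal.ofReal_add hg'.le (by positivity)]
      exact ENNReal.ofReal_le_ofReal this
    have hDi : ∫⁻ z, D z ≤ ENNReal.ofReal ((C1 + 1) * t ^ s) := by
      rw [hD, ← lintegral_gam _ (by fun_prop)]
      have e : ∀ z : Euc N, ENNReal.ofReal (d * (2 * ‖z‖ + d) / (4 * τ)) =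
          ENNReal.ofReal (d / (2 * τ)) * ENNReal.ofReal (‖z‖ ^ (1:ℝ)) + ENNReal.ofReal (d ^ 2 / (4 * τ)) := by
        intro z
        rw [← ENNReal.ofReal_mul (by positivity), ← ENNReal.ofReal_add (by positivity) (by positivity), Real.rpow_one]
        congr 1; field_simp; ring
      have := gam_prob N hτ
      simp_rw [e]
      rw [lintegral_add_right _ measurable_const, lintegral_const, measure_univ, mul_one,
        lintegral_const_mul _ (by fun_prop)]
      refine (add_le_add (mul_le_mul_right (h1 τ hτ) _) le_rfl).trans ?_
      rw [← ENNReal.ofReal_mul (by positivity), ← ENNReal.ofReal_add (by positivity) (by positivity)]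
      apply ENNReal.ofReal_le_ofReal
      rw [← Real.sqrt_eq_rpow]
      have hτs : τ = Real.sqrt τ * Real.sqrt τ := (Real.mul_self_sqrt hτ.le).symm
      have e1 : d / (2 * τ) * (C1 * Real.sqrt τ) = C1 * t / 2 := by
        rw [ht]; conv_lhs => rw [hτs]
        rw [← hτs]; field_simp
        rw [Real.sq_sqrt hτ.le]
      have e2 : d ^ 2 / (4 * τ) = t ^ 2 / 4 := by
        rw [ht, div_pow, Real.sq_sqrt hτ.le]; field_simp
      rw [e1, e2]
      have : t ^ 2 ≤ t := by nlinarith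
      have : C1 * t ≤ C1 * t ^ s := by gcongr
      nlinarith
    calc pm N μ τ x ≤ ∫⁻ y, (gE N τ (x' - y) + D (x - y)) ∂μ := lintegral_mono h2
      _ = pm N μ τ x' + ∫⁻ y, D (x - y) ∂μ := by
          have hm : Measurable fun y => gE N τ (x' - y) := (measurable_gE' N τ).comp (measurable_const.sub measurable_id)
          rw [lintegral_add_left hm]; rfl
      _ ≤ _ := by
          refine add_le_add le_rfl ((lint_le_vol hμ _).trans ?_)
          rw [lintegral_sub_left_eq_self D x]
          refine (mul_le_mul_right hDi _).trans (le_of_eq ?_)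
          rw [← ENNReal.ofReal_mul hC.le]; congr 1; ring

lemma Tm_mod (N : ℕ) {s C : ℝ} (hs : 0 < s) (hs1 : s < 1) (hC : 0 < C) : ∃ C' : ℝ, 0 < C' ∧ ∀ (μ : Measure (Euc N)) [SFinite μ],
    (∀ A, μ A ≤ ENNReal.ofReal C * volume A) → ∀ H : ℝ, 0 < H → ∀ x x' : Euc N,
    Tm N (mw s H) μ x ≤ Tm N (mw s H) μ x' + ENNReal.ofReal (C' * (‖x - x'‖ ^ s * H ^ (-(s/2)))) := by
  obtain ⟨C1, hC1, h1⟩ := pm_mod N hs hs1.le hC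
  have hW := Wt_lt_top hs hs1.le (q := -(s/2)) (by linarith) (by linarith)
  refine ⟨C1 * ((Wt s 1 (-(s/2))).toReal + 1), by positivity, fun μ _ hμ H hH x x' => ?_⟩
  rw [Tm_eq (measurable_mw s H), Tm_eq (measurable_mw s H)]
  have hm : Measurable fun τ => mw s H τ * pm N μ τ x' :=
    (measurable_mw s H).mul ((measurable_pm μ).comp (by fun_prop : Measurable fun τ : ℝ => (τ, x')))
  calc _ ≤ ∫⁻ τ in Ioi (0:ℝ), (mw s H τ * pm N μ τ x' + ENNReal.ofReal (C1 * ‖x - x'‖ ^ s) * (mw s H τ * ENNReal.ofReal (τ ^ (-(s/2))))) := by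
        refine setLIntegral_mono' measurableSet_Ioi fun τ (hτ : 0 < τ) => ?_
        refine (mul_le_mul_right (h1 μ hμ τ hτ x x') _).trans (le_of_eq ?_)
        rw [mul_add, ← mul_assoc C1, ENNReal.ofReal_mul (by positivity)]; ring
    _ = (∫⁻ τ in Ioi (0:ℝ), mw s H τ * pm N μ τ x') + ENNReal.ofReal (C1 * ‖x - x'‖ ^ s) * (ENNReal.ofReal (H ^ (-(s/2))) * Wt s 1 (-(s/2))) := by
        rw [lintegral_add_left hm, lintegral_const_mul' _ _ ENNReal.ofReal_ne_top, ← Wt_scale hH]; rfl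
    _ ≤ _ := by
        refine add_le_add le_rfl ?_
        rw [← ENNReal.ofReal_toReal hW.ne, ← ENNReal.ofReal_mul (by positivity), ← ENNReal.ofReal_mul (by positivity)]
        apply ENNReal.ofReal_le_ofReal
        rw [ENNReal.toReal_ofReal (by positivity)]
        have : 0 ≤ C1 * ‖x - x'‖ ^ s * H ^ (-(s/2)) := by positivity
        nlinarith

lemma pm_le_t {N : ℕ} {μ : Measure (Euc N)} [IsProbabilityMeasure μ] {τ : ℝ} (hτ : 0 < τ) (x : Euc N) :
    pm N μ τ x ≤ ENNReal.ofReal (τ ^ (-(N:ℝ)/2)) := by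
  unfold pm
  calc _ ≤ ∫⁻ y, ENNReal.ofReal (τ ^ (-(N:ℝ)/2)) ∂μ :=
        lintegral_mono fun y => ENNReal.ofReal_le_ofReal (gk_le hτ _)
    _ = _ := by simp

/-- dominating function for the potential -/
noncomputable def Dm (N : ℕ) (s C : ℝ) (τ : ℝ) : ℝ≥0∞ :=
  pw s τ * min (ENNReal.ofReal C) (ENNReal.ofReal (τ ^ (-(N:ℝ)/2)))

lemma Dm_lt_top {N : ℕ} {s C : ℝ} (hs : 0 < s) (hsN : 2 * s < N) :
    ∫⁻ τ in Ioi (0:ℝ), Dm N s C τ < ⊤ := by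
  have e : Ioi (0:ℝ) = Ioc 0 1 ∪ Ioi 1 := (Ioc_union_Ioi_eq_Ioi zero_le_one).symm
  rw [e]
  refine (lintegral_union_le _ _ _).trans_lt (ENNReal.add_lt_top.2 ⟨?_, ?_⟩)
  · calc _ ≤ ∫⁻ τ in Ioc (0:ℝ) 1, ENNReal.ofReal C * pw s τ := by
          refine lintegral_mono fun τ => ?_
          unfold Dm; rw [mul_comm]; gcongr; exact min_le_left _ _
      _ < ⊤ := by
          rw [lintegral_const_mul' _ _ ENNReal.ofReal_ne_top]
          refine ENNReal.mul_lt_top ENNReal.ofReal_lt_top ?_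
          have : IntegrableOn (fun τ : ℝ => τ ^ (s-1)) (Ioc 0 1) := by
            rw [← intervalIntegrable_iff_integrableOn_Ioc_of_le zero_le_one]
            exact intervalIntegral.intervalIntegrable_rpow' (by linarith)
          exact this.lintegral_lt_top
  · calc _ ≤ ∫⁻ τ in Ioi (1:ℝ), ENNReal.ofReal (τ ^ (s - 1 - (N:ℝ)/2)) := by
          refine setLIntegral_mono' measurableSet_Ioi fun τ (hτ : 1 < τ) => ?_
          have h0 : (0:ℝ) < τ := by linarith
          unfold Dm pw
          refine (mul_le_mul_right (min_le_right _ _) _).trans (le_of_eq ?_)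
          rw [← ENNReal.ofReal_mul (by positivity), ← Real.rpow_add h0]
          congr 2; ring
      _ < ⊤ := (integrableOn_Ioi_rpow_of_lt (by linarith) one_pos).lintegral_lt_top

lemma measurable_pm1 {N : ℕ} (μ : Measure (Euc N)) [SFinite μ] (x : Euc N) : Measurable fun τ => pm N μ τ x :=
  (measurable_pm μ).comp (measurable_id.prodMk measurable_const)

lemma u_dom {N : ℕ} {s C : ℝ} {μ : Measure (Euc N)} [IsProbabilityMeasure μ]
    (hμ : ∀ A, μ A ≤ ENNReal.ofReal C * volume A) {τ : ℝ} (hτ : 0 < τ) (x : Euc N) :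
    pw s τ * pm N μ τ x ≤ Dm N s C τ := by
  unfold Dm; gcongr; exact le_min (pm_le_C hμ hτ x) (pm_le_t hτ x)

lemma u_bdd {N : ℕ} {s C : ℝ} (hs : 0 < s) (hsN : 2 * s < N) {μ : Measure (Euc N)} [IsProbabilityMeasure μ]
    (hμ : ∀ A, μ A ≤ ENNReal.ofReal C * volume A) : ∃ K : ℝ, 0 < K ∧ ∀ x, Tm N (pw s) μ x ≤ ENNReal.ofReal K := by
  refine ⟨(∫⁻ τ in Ioi (0:ℝ), Dm N s C τ).toReal + 1, by positivity, fun x => ?_⟩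
  rw [Tm_eq (measurable_pw s)]
  calc _ ≤ ∫⁻ τ in Ioi (0:ℝ), Dm N s C τ :=
        setLIntegral_mono' measurableSet_Ioi fun τ hτ => u_dom hμ hτ x
    _ = ENNReal.ofReal (∫⁻ τ in Ioi (0:ℝ), Dm N s C τ).toReal := (ENNReal.ofReal_toReal (Dm_lt_top hs hsN).ne).symm
    _ ≤ _ := ENNReal.ofReal_le_ofReal (by linarith)

lemma pm_cont {N : ℕ} {μ : Measure (Euc N)} [IsProbabilityMeasure μ] {τ : ℝ} (hτ : 0 < τ) :
    Continuous fun x => pm N μ τ x := by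
  rw [continuous_iff_continuousAt]
  intro x
  unfold ContinuousAt pm
  refine tendsto_lintegral_filter_of_dominated_convergence (fun _ => ENNReal.ofReal (τ ^ (-(N:ℝ)/2))) ?_ ?_ ?_ ?_
  · exact Eventually.of_forall fun y => ((measurable_gE' N τ).comp (measurable_const.sub measurable_id))
  · exact Eventually.of_forall fun y => Eventually.of_forall fun z => ENNReal.ofReal_le_ofReal (gk_le hτ _)
  · simp
  · refine Eventually.of_forall fun y => ?_
    have : Continuous fun x : Euc N => gE N τ (x - y) := by
      unfold gE gk; exact ENNReal.continuous_ofReal.comp (by fun_prop)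
    exact this.tendsto x

lemma u_cont {N : ℕ} {s C : ℝ} (hs : 0 < s) (hsN : 2 * s < N) {μ : Measure (Euc N)} [IsProbabilityMeasure μ]
    (hμ : ∀ A, μ A ≤ ENNReal.ofReal C * volume A) : Continuous (Tm N (pw s) μ) := by
  have e : Tm N (pw s) μ = fun x => ∫⁻ τ in Ioi (0:ℝ), pw s τ * pm N μ τ x := by
    ext x; exact Tm_eq (measurable_pw s) μ x
  rw [e, continuous_iff_continuousAt]
  intro x
  unfold ContinuousAt
  refine tendsto_lintegral_filter_of_dominated_convergence (Dm N s C) ?_ ?_ (Dm_lt_top hs hsN).ne ?_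
  · exact Eventually.of_forall fun y => (measurable_pw s).mul (measurable_pm1 μ y)
  · refine Eventually.of_forall fun y => ?_
    filter_upwards [ae_restrict_mem measurableSet_Ioi] with τ hτ
    exact u_dom hμ hτ y
  · filter_upwards [ae_restrict_mem measurableSet_Ioi] with τ hτ
    refine ENNReal.Tendsto.const_mul ((pm_cont hτ).tendsto x) (Or.inr ?_)
    exact ENNReal.ofReal_ne_top

lemma heat_tendsto {N : ℕ} {f : Euc N → ℝ≥0∞} (hf : Continuous f) {K : ℝ} (hK : ∀ x, f x ≤ ENNReal.ofReal K) (x : Euc N) :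
    Tendsto (fun h => heat N h f x) (𝓝[>] 0) (𝓝 (f x)) := by
  have hp := gam_prob N one_pos
  have e : (fun h => ∫⁻ z, f (x - Real.sqrt h • z) ∂(gam N 1)) =ᶠ[𝓝[>] 0] fun h => heat N h f x := by
    filter_upwards [self_mem_nhdsWithin] with h hh
    unfold heat
    rw [gam_scale hh (fun z => f (x - z)) (hf.measurable.comp (measurable_const.sub measurable_id))]
  refine Tendsto.congr' e ?_
  have e2 : f x = ∫⁻ z, f x ∂(gam N 1) := by simp
  rw [e2]
  refine tendsto_lintegral_filter_of_dominated_convergence (fun _ => ENNReal.ofReal K) ?_ ?_ ?_ ?_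
  · exact Eventually.of_forall fun h => hf.measurable.comp (by fun_prop)
  · exact Eventually.of_forall fun h => Eventually.of_forall fun z => hK _
  · simp
  · refine Eventually.of_forall fun z => ?_
    have : Continuous fun h : ℝ => f (x - Real.sqrt h • z) := hf.comp (by fun_prop)
    have := this.tendsto 0
    simp only [Real.sqrt_zero, zero_smul, sub_zero] at this
    exact this.mono_left nhdsWithin_le_nhds

/-- smallness of averages off the support -/
lemma T_off {N : ℕ} {s C : ℝ} (hs : 0 < s) (hs1 : s < 1) (hC : 0 < C) : ∃ C' : ℝ, 0 < C' ∧ ∀ (μ : Measure (Euc N)) (S : Set (Euc N)),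
    (∀ᵐ y ∂μ, y ∈ S) → (∀ A, μ A ≤ ENNReal.ofReal C * volume A) → ∀ (x : Euc N) (d : ℝ), 0 < d → (∀ y ∈ S, d ≤ ‖x - y‖) →
    ∀ ε : ℝ, 0 < ε → Tm N (mw s ε) μ x ≤ ENNReal.ofReal (C' * (ε ^ ((1-s)/2) * d ^ (-(1-s)))) := by
  obtain ⟨C1, hC1, h1⟩ := Tk_moment N hs hs1
  refine ⟨C * C1, by positivity, fun μ S hS hμ x d hd hdS ε hε => ?_⟩
  unfold Tm
  have hm : Measurable fun z : Euc N => Tk N (mw s ε) z * ENNReal.ofReal (‖z‖ ^ (1 - s)) :=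
    (measurable_Tk (measurable_mw s ε)).mul (by fun_prop)
  calc _ ≤ ∫⁻ y, ENNReal.ofReal (d ^ (-(1-s))) * (Tk N (mw s ε) (x - y) * ENNReal.ofReal (‖x - y‖ ^ (1-s))) ∂μ := by
        refine lintegral_mono_ae ?_
        filter_upwards [hS] with y hy
        rw [mul_left_comm, ← ENNReal.ofReal_mul (by positivity)]
        refine le_mul_of_one_le_right' ?_
        rw [ENNReal.one_le_ofReal, Real.rpow_neg hd.le, ← div_eq_inv_mul, one_le_div (by positivity)]
        exact Real.rpow_le_rpow hd.le (hdS y hy) (by linarith)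
    _ ≤ ENNReal.ofReal (d ^ (-(1-s))) * (ENNReal.ofReal C * ENNReal.ofReal (C1 * ε ^ ((1-s)/2))) := by
        rw [lintegral_const_mul' _ _ ENNReal.ofReal_ne_top]
        gcongr
        refine (lint_le_vol hμ _).trans ?_
        gcongr
        rw [lintegral_sub_left_eq_self (fun z => Tk N (mw s ε) z * ENNReal.ofReal (‖z‖ ^ (1 - s))) x]
        exact h1 ε hε
    _ = _ := by
        rw [← ENNReal.ofReal_mul (by positivity), ← ENNReal.ofReal_mul (by positivity)]; congr 1; ring

lemma Adm_exists {N : ℕ} {s a : ℝ} (hN : 1 ≤ N) (hs1 : s < 1) (hsN : 2 * s < N) (ha : 0 < a) :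
    ∃ β q : ℝ, Adm a β q ∧ 1 < β ∧ β ≤ 2 ∧ 2 * s < β ∧ q < N := by
  rcases lt_or_ge 2 a with h | h
  · refine ⟨2, 0, ⟨le_rfl, by norm_num, le_rfl, fun h' => absurd h (by linarith), fun _ => ⟨rfl, rfl⟩⟩, by norm_num, le_rfl, by linarith, by positivity⟩
  · rcases Nat.lt_or_ge N 2 with h2 | h2
    · have : N = 1 := by omega
      subst this
      norm_num at hsN
      exact ⟨1 + a/2, 1 - a/2, ⟨by linarith, by linarith, by linarith, fun _ => by ring, fun h' => absurd h' (by linarith)⟩, by linarith, by linarith, by linarith, by norm_num; linarith⟩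
    · have : (2:ℝ) ≤ N := by exact_mod_cast h2
      exact ⟨2, 2 - a, ⟨by linarith, by norm_num, le_rfl, fun _ => by ring, fun h' => absurd h' (by linarith)⟩, by norm_num, le_rfl, by linarith, by linarith⟩

lemma Kq_bdd {N : ℕ} {s a q : ℝ} {μ : Measure (Euc N)} {S : Set (Euc N)} (hS : SU N s a μ S) (hq : 0 ≤ q) (hqN : q < N) :
    ∃ K : ℝ, 0 < K ∧ ∀ x, Kq N q μ x ≤ ENNReal.ofReal K := by
  have := hS.prob
  have hN := hS.hN
  have : Nonempty (Fin N) := ⟨⟨0, hN⟩⟩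
  obtain ⟨C, hC, h⟩ := le_vol hS
  set v : ℝ := (volume (Metric.closedBall (0:Euc N) 1)).toReal with hv
  have hvt : volume (Metric.closedBall (0:Euc N) 1) ≠ ⊤ := (isCompact_closedBall _ _).measure_lt_top.ne
  have hv0 : 0 < v := ENNReal.toReal_pos (Metric.measure_closedBall_pos _ _ one_pos).ne' hvt
  obtain ⟨K, hK, h2⟩ := A4 (N := N) (C := C * v) (p := N) (q := q) (by positivity) hq hqN
  refine ⟨K, hK, fun x => h2 μ x fun r hr hr1 => (h _).trans (le_of_eq ?_)⟩
  rw [Measure.addHaar_closedBall' _ _ hr.le]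
  rw [← ENNReal.ofReal_toReal hvt, ← hv, ← ENNReal.ofReal_mul (by positivity), ← ENNReal.ofReal_mul (by positivity)]
  congr 1
  simp only [finrank_euclideanSpace, Fintype.card_fin]
  rw [Real.rpow_natCast]; ring

/-- normalized Euler-Lagrange potential -/
noncomputable def ps (N : ℕ) (s a : ℝ) (μ : Measure (Euc N)) (x : Euc N) : ℝ≥0∞ :=
  ENNReal.ofReal (ci N s) * Ua N a μ x + Tm N (pw s) μ x

lemma SU.ne {N : ℕ} {s a : ℝ} {μ : Measure (Euc N)} {S : Set (Euc N)} (hS : SU N s a μ S) : S.Nonempty := by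
  have := hS.prob
  by_contra h
  rw [Set.not_nonempty_iff_eq_empty] at h
  have := hS.null
  rw [h, compl_empty, measure_univ] at this
  exact one_ne_zero this

lemma ps_const {N : ℕ} {s a : ℝ} {μ : Measure (Euc N)} {S : Set (Euc N)} (hS : SU N s a μ S) :
    ∃ m : ℝ, 0 ≤ m ∧ (∀ x, ENNReal.ofReal m ≤ ps N s a μ x) ∧ ∀ x ∈ S, ps N s a μ x = ENNReal.ofReal m := by
  have hprob := hS.prob
  obtain ⟨C, hC, hμ⟩ := le_vol hS
  obtain ⟨K, hK, hu⟩ := u_bdd hS.hs hS.hsN hμ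
  have hc := u_cont hS.hs hS.hsN hμ
  obtain ⟨b, q, hA, hQ, -⟩ := boot_final hS
  -- EL in the limit
  have key : ∀ x0 ∈ S, ∀ x, ps N s a μ x0 ≤ ps N s a μ x := by
    intro x0 hx0 x
    have hA2 : ∃ b : ℝ, 0 < b ∧ ∃ C : ℝ, 0 < C ∧ ∀ h : ℝ, 0 < h → h ≤ 1 →
        heat N h (Ua N a μ) x ≤ Ua N a μ x + ENNReal.ofReal (C * h ^ b) := by
      rcases le_or_gt a 2 with h2 | h2
      · obtain ⟨C, hC, h⟩ := heat_U_upper hS (b := a) (q := 0) ⟨le_rfl, hS.ha, h2, fun _ => by ring, fun h => absurd h (by linarith)⟩ ‖x‖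
        refine ⟨a/2, by have := hS.ha; positivity, C, hC, fun t ht ht1 => ?_⟩
        simpa [Kq_zero] using (h x le_rfl).2 t ht ht1
      · obtain ⟨C, hC, h⟩ := heat_U_upper hS (b := 2) (q := 0) ⟨le_rfl, by norm_num, le_rfl, fun h => absurd h (by linarith), fun _ => ⟨rfl, rfl⟩⟩ ‖x‖
        refine ⟨2/2, by norm_num, C, hC, fun t ht ht1 => ?_⟩
        simpa only [Kq_zero, mul_one] using (h x le_rfl).2 t ht ht1
    obtain ⟨b, hb, C, hC, hup⟩ := hA2
    have h1 : ∀ᶠ h in 𝓝[>] (0:ℝ), ps N s a μ x0 ≤ ENNReal.ofReal (ci N s) * (Ua N a μ x + ENNReal.ofReal (C * h ^ b))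
        + heat N h (Tm N (pw s) μ) x := by
      have : Ioo (0:ℝ) 1 ∈ 𝓝[>] (0:ℝ) := Ioo_mem_nhdsGT one_pos
      filter_upwards [this] with h hh
      have := hS.EL x0 hx0 h hh.1 x
      have := mul_le_mul_right this (ENNReal.ofReal (ci N s))
      rw [mul_add, mul_add, hS.ci_mul, hS.ci_mul] at this
      refine this.trans ?_
      gcongr
      exact hup h hh.1 hh.2.le
    have h2 : Tendsto (fun h : ℝ => ENNReal.ofReal (ci N s) * (Ua N a μ x + ENNReal.ofReal (C * h ^ b))
        + heat N h (Tm N (pw s) μ) x) (𝓝[>] 0) (𝓝 (ENNReal.ofReal (ci N s) * (Ua N a μ x + ENNReal.ofReal (C * (0:ℝ) ^ b)) + Tm N (pw s) μ x)) := by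
      refine Tendsto.add (ENNReal.Tendsto.const_mul (Tendsto.add tendsto_const_nhds ?_) (Or.inr ENNReal.ofReal_ne_top)) (heat_tendsto hc hu x)
      refine ENNReal.tendsto_ofReal (Tendsto.const_mul _ ?_)
      exact ((Real.continuousAt_rpow_const 0 b (Or.inr hb.le)).tendsto).mono_left nhdsWithin_le_nhds
    have h3 := ge_of_tendsto h2 h1
    rw [Real.zero_rpow hb.ne', mul_zero, ENNReal.ofReal_zero, add_zero] at h3
    exact h3
  obtain ⟨x0, hx0⟩ := hS.ne
  have hfin : ps N s a μ x0 ≠ ⊤ := by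
    unfold ps
    exact ENNReal.add_ne_top.2 ⟨ENNReal.mul_ne_top ENNReal.ofReal_ne_top (hS.Ua_lt_top x0).ne, ((hu x0).trans_lt ENNReal.ofReal_lt_top).ne⟩
  refine ⟨(ps N s a μ x0).toReal, ENNReal.toReal_nonneg, fun x => ?_, fun x hx => ?_⟩
  · rw [ENNReal.ofReal_toReal hfin]; exact key x0 hx0 x
  · rw [ENNReal.ofReal_toReal hfin]; exact le_antisymm (key x hx x0) (key x0 hx0 x)

/-- monotone convergence `H^s Tm m_H → u` -/
lemma Tm_mw_sup {N : ℕ} {s : ℝ} (hs : 0 < s) {μ : Measure (Euc N)} [IsProbabilityMeasure μ] {x : Euc N} {K : ℝ≥0∞}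
    (h : ∀ H : ℝ, 0 < H → ENNReal.ofReal (H ^ s) * Tm N (mw s H) μ x ≤ K) : Tm N (pw s) μ x ≤ K := by
  rw [Tm_eq (measurable_pw s)]
  have hm : Measurable fun τ => pw s τ * pm N μ τ x := (measurable_pw s).mul (measurable_pm1 μ x)
  have h1 : ∀ n : ℕ, ∫⁻ τ in Ioc (0:ℝ) (n+1), pw s τ * pm N μ τ x ≤ K := by
    intro n
    refine le_trans ?_ (h (n+1) (by positivity))
    rw [Tm_eq (measurable_mw s _), ← lintegral_const_mul' _ _ ENNReal.ofReal_ne_top]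
    refine le_trans ?_ (lintegral_mono_set (s := Ioc (0:ℝ) (n+1)) (t := Ioi 0) (fun τ hτ => hτ.1))
    refine setLIntegral_mono' measurableSet_Ioc fun τ hτ => ?_
    rw [← mul_assoc]
    gcongr
    unfold pw mw
    rw [mr_eq hs hτ.1 hτ.2, ← ENNReal.ofReal_mul (by positivity), ← mul_assoc, ← Real.rpow_add (by positivity)]
    simp
  have e : Ioi (0:ℝ) = ⋃ n : ℕ, Ioc (0:ℝ) (n+1) := by
    ext τ
    simp only [mem_Ioi, mem_iUnion, mem_Ioc]
    constructor
    · intro h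
      obtain ⟨n, hn⟩ := exists_nat_ge τ
      exact ⟨n, h, by linarith⟩
    · rintro ⟨n, h, -⟩; exact h
  rw [e, setLIntegral_iUnion_of_directed]
  · exact iSup_le h1
  · refine Monotone.directed_le fun i j hij => Ioc_subset_Ioc_right ?_
    have : (i:ℝ) ≤ j := by exact_mod_cast hij
    linarith

lemma Tk_pw_far {N : ℕ} {s a C : ℝ} {μ : Measure (Euc N)} {S : Set (Euc N)} (hS : SU N s a μ S) (hC : 0 < C) :
    ∃ R : ℝ, ∀ x : Euc N, R < ‖x‖ → Tm N (pw s) μ x < ENNReal.ofReal C := by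
  have := hS.prob
  obtain ⟨R0, hR0⟩ := hS.cpt.isBounded.exists_norm_le
  have hcK := cK_ne_top hS.hN hS.hs hS.hsN
  have hp : 0 < (N:ℝ) - 2 * s := by linarith [hS.hsN]
  have h1 : Tendsto (fun t : ℝ => (cK N s).toReal * t ^ (-((N:ℝ) - 2 * s))) atTop (𝓝 ((cK N s).toReal * 0)) :=
    (tendsto_rpow_neg_atTop hp).const_mul _
  rw [mul_zero] at h1
  obtain ⟨T, hT⟩ := eventually_atTop.1 ((h1.eventually (gt_mem_nhds (half_pos hC))).and (eventually_gt_atTop 0))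
  refine ⟨R0 + T, fun x hx => ?_⟩
  have h2 : Tm N (pw s) μ x ≤ ENNReal.ofReal (C/2) := by
    unfold Tm
    calc _ ≤ ∫⁻ y, ENNReal.ofReal (C/2) ∂μ := by
          refine lintegral_mono_ae ?_
          filter_upwards [hS.ae_mem] with y hy
          have h3 : T ≤ ‖x - y‖ := by
            have := norm_sub_norm_le x y
            have := hR0 y hy
            linarith
          obtain ⟨h4, h5⟩ := hT _ h3
          rw [Tk_pw hS.hN hS.hs hS.hsN, ENNReal.ofReal_rpow_of_pos h5, ← ENNReal.ofReal_toReal hcK,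
            ← ENNReal.ofReal_mul ENNReal.toReal_nonneg]
          refine ENNReal.ofReal_le_ofReal ?_
          rw [neg_sub] at h4
          exact h4.le
      _ = _ := by simp
  refine h2.trans_lt ?_
  rw [ENNReal.ofReal_lt_ofReal_iff hC]; linarith

/-- maximum principle step: at a maximum of `2u - u(·+w) - u(·-w)` off the support the value is ≤ 0 -/
lemma max_off {N : ℕ} {s a : ℝ} {μ : Measure (Euc N)} {S : Set (Euc N)} (hS : SU N s a μ S) (hs1 : s < 1)
    {x w : Euc N} (hx : x ∉ S)
    (hmax : ∀ y, 2 * Tm N (pw s) μ y + (Tm N (pw s) μ (x - w) + Tm N (pw s) μ (x + w)) ≤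
      2 * Tm N (pw s) μ x + (Tm N (pw s) μ (y - w) + Tm N (pw s) μ (y + w))) :
    2 * Tm N (pw s) μ x ≤ Tm N (pw s) μ (x - w) + Tm N (pw s) μ (x + w) := by
  have hprob := hS.prob
  have hs := hS.hs
  obtain ⟨C, hC, hμ⟩ := le_vol hS
  obtain ⟨K, hK, hu⟩ := u_bdd hS.hs hS.hsN hμ
  have hfin : ∀ x, Tm N (pw s) μ x < ⊤ := fun x => (hu x).trans_lt ENNReal.ofReal_lt_top
  have hum : Measurable (Tm N (pw s) μ) := measurable_Tm (measurable_pw s) μ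
  set u := Tm N (pw s) μ with hudef
  have hheat : ∀ h : ℝ, 0 < h → 2 * heat N h u x + (u (x - w) + u (x + w)) ≤ 2 * u x + (heat N h u (x - w) + heat N h u (x + w)) := by
    intro h hh
    have := gam_prob N hh
    have e1 : 2 * heat N h u x + (u (x - w) + u (x + w)) = ∫⁻ z, (2 * u (x - z) + (u (x - w) + u (x + w))) ∂(gam N h) := by
      rw [lintegral_add_right _ measurable_const, lintegral_const_mul' _ _ (by norm_num), lintegral_const, measure_univ, mul_one]; rfl
    have e2 : 2 * u x + (heat N h u (x - w) + heat N h u (x + w)) = ∫⁻ z, (2 * u x + (u (x - z - w) + u (x - z + w))) ∂(gam N h) := by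
      have m1 : Measurable fun z => u (x - z - w) := hum.comp (by fun_prop)
      rw [lintegral_add_left measurable_const, lintegral_add_left m1, lintegral_const, measure_univ, mul_one]
      unfold heat
      congr 2
      · congr 1; ext z; congr 1; abel
      · congr 1; ext z; congr 1; abel
    rw [e1, e2]
    exact lintegral_mono fun z => hmax (x - z)
  have hmh : ∀ y : Euc N, Measurable fun h => heat N h u y := fun y => measurable_heat hum y
  -- comparison
  have cmp : ∀ ε H : ℝ, 0 < ε → ε ≤ H → 2 * Tm N (mw s H) μ x ≤ 2 * Tm N (mw s ε) μ x + (Tm N (mw s H) μ (x - w) + Tm N (mw s H) μ (x + w)) := by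
    intro ε H hε hH
    have i0 := ID hs hε hH μ x
    have i1 := ID hs hε hH μ (x - w)
    have i2 := ID hs hε hH μ (x + w)
    rw [← hudef] at i0 i1 i2
    set I : (ℝ → ℝ≥0∞) → ℝ≥0∞ := fun f => ∫⁻ h in Ioo ε H, ENNReal.ofReal (s * h ^ (-1 - s)) * f h with hI
    have Iadd : ∀ f g : ℝ → ℝ≥0∞, Measurable f → I (fun h => f h + g h) = I f + I g := by
      intro f g hf
      simp only [hI, mul_add]
      exact lintegral_add_left ((by fun_prop : Measurable fun h : ℝ => ENNReal.ofReal (s * h ^ (-1 - s))).mul hf) _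
    have Imul : ∀ f : ℝ → ℝ≥0∞, I (fun h => 2 * f h) = 2 * I f := by
      intro f
      simp only [hI]
      rw [← lintegral_const_mul' _ _ (by norm_num)]
      congr 1; ext h; ring
    have Ifin : ∀ y, I (fun _ => u y) ≠ ⊤ := by
      intro y
      simp only [hI]
      rw [lintegral_mul_const' _ _ (hfin y).ne, weight_integral0 hs hε hH]
      exact ENNReal.mul_ne_top ENNReal.ofReal_ne_top (hfin y).ne
    have Ile : I (fun h => 2 * heat N h u x + (u (x - w) + u (x + w))) ≤ I (fun h => 2 * u x + (heat N h u (x - w) + heat N h u (x + w))) :=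
      setLIntegral_mono' measurableSet_Ioo fun h hh => mul_le_mul_right (hheat h (hε.trans hh.1)) _
    rw [Iadd _ _ ((hmh x).const_mul 2), Imul, Iadd _ _ measurable_const, Iadd _ _ measurable_const, Imul, Iadd _ _ (hmh _)] at Ile
    change Tm N (mw s ε) μ x + I (fun h => heat N h u x) = Tm N (mw s H) μ x + I (fun _ => u x) at i0
    change Tm N (mw s ε) μ (x-w) + I (fun h => heat N h u (x-w)) = Tm N (mw s H) μ (x-w) + I (fun _ => u (x-w)) at i1
    change Tm N (mw s ε) μ (x+w) + I (fun h => heat N h u (x+w)) = Tm N (mw s H) μ (x+w) + I (fun _ => u (x+w)) at i2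
    have hF : 2 * I (fun _ => u x) + (I (fun _ => u (x - w)) + I (fun _ => u (x + w))) ≠ ⊤ :=
      ENNReal.add_ne_top.2 ⟨ENNReal.mul_ne_top (by norm_num) (Ifin _), ENNReal.add_ne_top.2 ⟨Ifin _, Ifin _⟩⟩
    refine (ENNReal.add_le_add_iff_right hF).1 ?_
    calc 2 * Tm N (mw s H) μ x + (2 * I (fun _ => u x) + (I (fun _ => u (x - w)) + I (fun _ => u (x + w))))
        = 2 * (Tm N (mw s H) μ x + I (fun _ => u x)) + (I (fun _ => u (x - w)) + I (fun _ => u (x + w))) := by ring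
      _ = 2 * Tm N (mw s ε) μ x + (2 * I (fun h => heat N h u x) + (I (fun _ => u (x - w)) + I (fun _ => u (x + w)))) := by
          rw [← i0]; ring
      _ ≤ 2 * Tm N (mw s ε) μ x + (2 * I (fun _ => u x) + (I (fun h => heat N h u (x-w)) + I (fun h => heat N h u (x+w)))) := by
          gcongr
      _ ≤ 2 * Tm N (mw s ε) μ x + (2 * I (fun _ => u x) + ((Tm N (mw s H) μ (x-w) + I (fun _ => u (x-w))) + (Tm N (mw s H) μ (x+w) + I (fun _ => u (x+w))))) := by
          rw [← i1, ← i2]; gcongr <;> exact le_add_self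
      _ = _ := by ring
  -- ε → 0
  obtain ⟨C', hC', hoff⟩ := T_off (N := N) hs hs1 hC
  obtain ⟨d, hd, hdS⟩ : ∃ d : ℝ, 0 < d ∧ ∀ y ∈ S, d ≤ ‖x - y‖ := by
    refine ⟨Metric.infDist x S, (hS.cpt.isClosed.notMem_iff_infDist_pos hS.ne).1 hx, fun y hy => ?_⟩
    rw [← dist_eq_norm]; exact Metric.infDist_le_dist_of_mem hy
  have h0 : Tendsto (fun ε : ℝ => Tm N (mw s ε) μ x) (𝓝[>] 0) (𝓝 0) := by
    have h1 : Tendsto (fun ε : ℝ => ENNReal.ofReal (C' * (ε ^ ((1-s)/2) * d ^ (-(1-s))))) (𝓝[>] 0) (𝓝 (ENNReal.ofReal (C' * ((0:ℝ) ^ ((1-s)/2) * d ^ (-(1-s)))))) := by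
      refine ENNReal.tendsto_ofReal (Tendsto.const_mul _ (Tendsto.mul_const _ ?_))
      exact ((Real.continuousAt_rpow_const 0 ((1-s)/2) (Or.inr (by linarith))).tendsto).mono_left nhdsWithin_le_nhds
    rw [Real.zero_rpow (by linarith), zero_mul, mul_zero, ENNReal.ofReal_zero] at h1
    refine tendsto_of_tendsto_of_tendsto_of_le_of_le' tendsto_const_nhds h1 (Eventually.of_forall fun _ => zero_le) ?_
    filter_upwards [self_mem_nhdsWithin] with ε hε
    exact hoff μ S hS.ae_mem hμ x d hd hdS ε hε
  have cmp2 : ∀ H : ℝ, 0 < H → 2 * Tm N (mw s H) μ x ≤ Tm N (mw s H) μ (x - w) + Tm N (mw s H) μ (x + w) := by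
    intro H hH
    have h1 : Tendsto (fun ε : ℝ => 2 * Tm N (mw s ε) μ x + (Tm N (mw s H) μ (x - w) + Tm N (mw s H) μ (x + w))) (𝓝[>] 0)
        (𝓝 (2 * 0 + (Tm N (mw s H) μ (x - w) + Tm N (mw s H) μ (x + w)))) :=
      Tendsto.add (ENNReal.Tendsto.const_mul h0 (Or.inr (by norm_num))) tendsto_const_nhds
    rw [mul_zero, zero_add] at h1
    refine ge_of_tendsto h1 ?_
    have : Ioo (0:ℝ) H ∈ 𝓝[>] (0:ℝ) := Ioo_mem_nhdsGT hH
    filter_upwards [this] with ε hε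
    exact cmp ε H hε.1 hε.2.le
  have h3 : u x ≤ 2⁻¹ * (u (x - w) + u (x + w)) := by
    refine Tm_mw_sup hs fun H hH => ?_
    have hb : ∀ y, ENNReal.ofReal (H ^ s) * Tm N (mw s H) μ y ≤ u y := by
      intro y
      refine (mul_le_mul_right (Tm_mw_one_le hH μ y) _).trans (le_of_eq ?_)
      rw [← mul_assoc, ← ENNReal.ofReal_mul (by positivity), ← Real.rpow_add hH]; simp; rfl
    have h4 : Tm N (mw s H) μ x ≤ 2⁻¹ * (Tm N (mw s H) μ (x - w) + Tm N (mw s H) μ (x + w)) := by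
      refine two_mul_le_cancel ((cmp2 H hH).trans (le_of_eq ?_))
      rw [← mul_assoc, ENNReal.mul_inv_cancel (by norm_num) (by norm_num), one_mul]
    calc _ ≤ ENNReal.ofReal (H ^ s) * (2⁻¹ * (Tm N (mw s H) μ (x - w) + Tm N (mw s H) μ (x + w))) := by gcongr
      _ = 2⁻¹ * (ENNReal.ofReal (H ^ s) * Tm N (mw s H) μ (x - w) + ENNReal.ofReal (H ^ s) * Tm N (mw s H) μ (x + w)) := by ring
      _ ≤ _ := by gcongr <;> exact hb _
  calc _ ≤ 2 * (2⁻¹ * (u (x - w) + u (x + w))) := by gcongr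
    _ = _ := by rw [← mul_assoc, ENNReal.mul_inv_cancel (by norm_num) (by norm_num), one_mul]

lemma B2_on {N : ℕ} {s a β q : ℝ} {μ : Measure (Euc N)} {S : Set (Euc N)} (hS : SU N s a μ S)
    (hA : Adm a β q) (hqN : q < N) : ∃ C : ℝ, 0 < C ∧ ∀ x ∈ S, ∀ w : Euc N, ‖w‖ ≤ 1 →
    2 * Tm N (pw s) μ x ≤ Tm N (pw s) μ (x - w) + Tm N (pw s) μ (x + w) + ENNReal.ofReal (C * ‖w‖ ^ β) := by
  have hprob := hS.prob
  have hci := hS.ci_pos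
  have ha := hS.ha
  obtain ⟨m, hm0, hm1, hm2⟩ := ps_const hS
  obtain ⟨R0, hR0⟩ := hS.cpt.isBounded.exists_norm_le
  obtain ⟨K, hK, hKq⟩ := Kq_bdd hS hA.1 hqN
  obtain ⟨C, hC, hU⟩ := heat_U_upper hS hA R0
  refine ⟨ci N s * (C * 2 * K), by positivity, fun x hx w hw => ?_⟩
  have h1 := (hU x (hR0 x hx)).1 w
  have h2 := hm2 x hx
  have h3 := hm1 (x - w)
  have h4 := hm1 (x + w)
  unfold ps at h2 h3 h4
  set c := ENNReal.ofReal (ci N s) with hc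
  have hfin : c * (2 * Ua N a μ x) ≠ ⊤ := ENNReal.mul_ne_top ENNReal.ofReal_ne_top (ENNReal.mul_ne_top (by norm_num) (hS.Ua_lt_top x).ne)
  have h5 : c * (ENNReal.ofReal (C * (‖w‖ ^ β * (1 + ‖w‖ ^ a))) * Kq N q μ x) ≤ ENNReal.ofReal (ci N s * (C * 2 * K) * ‖w‖ ^ β) := by
    calc _ ≤ c * (ENNReal.ofReal (C * (‖w‖ ^ β * 2)) * ENNReal.ofReal K) := by
          gcongr
          · have : ‖w‖ ^ a ≤ 1 := Real.rpow_le_one (norm_nonneg _) hw ha.le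
            linarith
          · exact hKq x
      _ = _ := by
          rw [hc, ← ENNReal.ofReal_mul (by positivity), ← ENNReal.ofReal_mul (by positivity)]; congr 1; ring
  refine (ENNReal.add_le_add_iff_right hfin).1 ?_
  calc _ = 2 * (c * Ua N a μ x + Tm N (pw s) μ x) := by ring
    _ = ENNReal.ofReal m + ENNReal.ofReal m := by rw [h2, two_mul]
    _ ≤ (c * Ua N a μ (x - w) + Tm N (pw s) μ (x - w)) + (c * Ua N a μ (x + w) + Tm N (pw s) μ (x + w)) := add_le_add h3 h4
    _ = c * (Ua N a μ (x - w) + Ua N a μ (x + w)) + (Tm N (pw s) μ (x - w) + Tm N (pw s) μ (x + w)) := by ring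
    _ ≤ c * (2 * Ua N a μ x + ENNReal.ofReal (C * (‖w‖ ^ β * (1 + ‖w‖ ^ a))) * Kq N q μ x) + (Tm N (pw s) μ (x - w) + Tm N (pw s) μ (x + w)) := by
        gcongr
    _ = c * (ENNReal.ofReal (C * (‖w‖ ^ β * (1 + ‖w‖ ^ a))) * Kq N q μ x) + (c * (2 * Ua N a μ x) + (Tm N (pw s) μ (x - w) + Tm N (pw s) μ (x + w))) := by ring
    _ ≤ ENNReal.ofReal (ci N s * (C * 2 * K) * ‖w‖ ^ β) + (c * (2 * Ua N a μ x) + (Tm N (pw s) μ (x - w) + Tm N (pw s) μ (x + w))) := by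
        gcongr
    _ = _ := by ring

lemma B2 {N : ℕ} {s a β q : ℝ} {μ : Measure (Euc N)} {S : Set (Euc N)} (hS : SU N s a μ S) (hs1 : s < 1)
    (hA : Adm a β q) (hqN : q < N) : ∃ C : ℝ, 0 < C ∧ ∀ x w : Euc N,
    2 * Tm N (pw s) μ x ≤ Tm N (pw s) μ (x - w) + Tm N (pw s) μ (x + w) + ENNReal.ofReal (C * ‖w‖ ^ β) := by
  have hprob := hS.prob
  obtain ⟨C, hC, hon⟩ := B2_on hS hA hqN
  obtain ⟨Cv, hCv, hμ⟩ := le_vol hS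
  obtain ⟨K, hK, hu⟩ := u_bdd hS.hs hS.hsN hμ
  have hcont := u_cont hS.hs hS.hsN hμ
  have hfin : ∀ x, Tm N (pw s) μ x ≠ ⊤ := fun x => ((hu x).trans_lt ENNReal.ofReal_lt_top).ne
  have hβ := hA.2.1
  refine ⟨C + 2 * K, by positivity, fun x w => ?_⟩
  rcases le_total 1 ‖w‖ with hw | hw
  · refine le_add_left ?_
    calc _ ≤ 2 * ENNReal.ofReal K := by gcongr; exact hu x
      _ = ENNReal.ofReal (2 * K) := (ofReal_two_mul K).symm
      _ ≤ _ := by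
          apply ENNReal.ofReal_le_ofReal
          have := Real.one_le_rpow hw hβ.le
          nlinarith
  · have key : ∀ x, 2 * Tm N (pw s) μ x ≤ Tm N (pw s) μ (x - w) + Tm N (pw s) μ (x + w) + ENNReal.ofReal (C * ‖w‖ ^ β) := by
      by_contra hcon
      push Not at hcon
      obtain ⟨xs, hxs⟩ := hcon
      set v : Euc N → ℝ := fun x => (Tm N (pw s) μ x).toReal with hv
      have hvc : Continuous v := by
        rw [continuous_iff_continuousAt]; intro y
        exact (ENNReal.tendsto_toReal (hfin y)).comp (hcont.tendsto y)
      have hvu : ∀ x, Tm N (pw s) μ x = ENNReal.ofReal (v x) := fun x => (ENNReal.ofReal_toReal (hfin x)).symm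
      have hv0 : ∀ x, 0 ≤ v x := fun x => ENNReal.toReal_nonneg
      set F : Euc N → ℝ := fun x => 2 * v x - (v (x - w) + v (x + w)) with hF
      have hFc : Continuous F := by rw [hF]; fun_prop
      have hL : 0 ≤ C * ‖w‖ ^ β := by positivity
      have conv : ∀ (x : Euc N) (L : ℝ), 0 ≤ L → (2 * Tm N (pw s) μ x ≤ Tm N (pw s) μ (x - w) + Tm N (pw s) μ (x + w) + ENNReal.ofReal L ↔ F x ≤ L) := by
        intro x L hL
        rw [hvu, hvu, hvu, ← ofReal_two_mul, ← ENNReal.ofReal_add (hv0 _) (hv0 _), ← ENNReal.ofReal_add (add_nonneg (hv0 _) (hv0 _)) hL,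
          ENNReal.ofReal_le_ofReal_iff (add_nonneg (add_nonneg (hv0 _) (hv0 _)) hL)]
        simp only [hF]; constructor <;> intro h <;> linarith
      have hFs : C * ‖w‖ ^ β < F xs := by
        rw [← not_le, ← conv xs _ hL, not_le]; exact hxs
      have hFpos : 0 < F xs := hL.trans_lt hFs
      obtain ⟨R, hR⟩ := Tk_pw_far hS (half_pos hFpos)
      obtain ⟨x1, hx1m, hx1⟩ := (isCompact_closedBall (0 : Euc N) (max R ‖xs‖)).exists_isMaxOn ⟨xs, by simp⟩ hFc.continuousOn
      have h1 : F xs ≤ F x1 := hx1 (by simp)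
      have hmax : ∀ y, F y ≤ F x1 := by
        intro y
        by_cases hy : y ∈ Metric.closedBall (0 : Euc N) (max R ‖xs‖)
        · exact hx1 hy
        · rw [mem_closedBall_zero_iff, not_le, max_lt_iff] at hy
          have := hR y hy.1
          rw [hvu, ENNReal.ofReal_lt_ofReal_iff (half_pos hFpos)] at this
          have h2 : F y ≤ 2 * v y := by simp only [hF]; linarith [hv0 (y - w), hv0 (y + w)]
          linarith
      have hx1S : x1 ∉ S := by
        intro h
        have := (conv x1 _ hL).1 (hon x1 h w hw)
        linarith
      have := max_off hS hs1 (x := x1) (w := w) hx1S (by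
        intro y
        have := hmax y
        rw [hvu, hvu, hvu, hvu, hvu, hvu, ← ofReal_two_mul, ← ofReal_two_mul, ← ENNReal.ofReal_add (hv0 _) (hv0 _), ← ENNReal.ofReal_add (hv0 _) (hv0 _),
          ← ENNReal.ofReal_add (mul_nonneg zero_le_two (hv0 _)) (add_nonneg (hv0 _) (hv0 _)), ← ENNReal.ofReal_add (mul_nonneg zero_le_two (hv0 _)) (add_nonneg (hv0 _) (hv0 _))]
        apply ENNReal.ofReal_le_ofReal
        simp only [hF] at this
        linarith)
      have h3 := (conv x1 0 le_rfl).1 (by simpa using this)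
      linarith
    refine (key x).trans ?_
    gcongr
    linarith

/-- semiconvexity implies heat subsolution -/
lemma sub_of_semi {N : ℕ} {f : Euc N → ℝ≥0∞} (hf : Measurable f) {β C : ℝ} (hβ : 0 < β) (hC : 0 < C)
    (h : ∀ x w : Euc N, 2 * f x ≤ f (x - w) + f (x + w) + ENNReal.ofReal (C * ‖w‖ ^ β)) :
    ∃ C' : ℝ, 0 < C' ∧ ∀ t : ℝ, 0 < t → ∀ x, f x ≤ heat N t f x + ENNReal.ofReal (C' * t ^ (β/2)) := by
  obtain ⟨C1, hC1, h1⟩ := gam_mom_bd N hβ.le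
  refine ⟨C * C1, by positivity, fun t ht x => ?_⟩
  have := gam_prob N ht
  refine two_mul_le_cancel ?_
  have m1 : Measurable fun z => f (x - z) + f (x + z) := (hf.comp (by fun_prop)).add (hf.comp (by fun_prop))
  calc 2 * f x = ∫⁻ z, 2 * f x ∂(gam N t) := by simp
    _ ≤ ∫⁻ z, (f (x - z) + f (x + z) + ENNReal.ofReal (C * ‖z‖ ^ β)) ∂(gam N t) := lintegral_mono fun z => h x z
    _ = 2 * heat N t f x + ENNReal.ofReal C * ∫⁻ z, ENNReal.ofReal (‖z‖ ^ β) ∂(gam N t) := by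
        rw [lintegral_add_left m1, heat_sym hf, ← lintegral_const_mul' _ _ ENNReal.ofReal_ne_top]
        simp_rw [ENNReal.ofReal_mul hC.le]
    _ ≤ 2 * heat N t f x + ENNReal.ofReal C * ENNReal.ofReal (C1 * t ^ (β/2)) := by gcongr; exact h1 t ht
    _ ≤ _ := by
        rw [mul_add, ← ENNReal.ofReal_mul hC.le, ← mul_assoc]
        gcongr
        exact le_mul_of_one_le_left' (by norm_num)

/-- the obstacle-type structure used in the regularity step -/
structure SB (N : ℕ) (s a β : ℝ) (μ : Measure (Euc N)) (S : Set (Euc N)) (V : Euc N → ℝ≥0∞) : Prop where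
  hN : 1 ≤ N
  hs : 0 < s
  hs1 : s < 1
  hsN : 2 * s < (N:ℝ)
  ha : 0 < a
  b1 : 1 < β
  b2 : β ≤ 2
  bs : 2 * s < β
  prob : IsProbabilityMeasure μ
  cpt : IsCompact S
  ne : S.Nonempty
  aeS : ∀ᵐ y ∂μ, y ∈ S
  vol : ∃ C : ℝ, 0 < C ∧ ∀ A, μ A ≤ ENNReal.ofReal C * volume A
  ub : ∃ C : ℝ, 0 < C ∧ ∀ x, Tm N (pw s) μ x ≤ ENNReal.ofReal C
  Vm : Measurable V
  V0 : ∀ x ∈ S, V x = 0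
  f1 : ∃ C : ℝ, 0 < C ∧ ∀ h : ℝ, 0 < h → ∀ x, Tm N (pw s) μ x ≤ heat N h (Tm N (pw s) μ) x + ENNReal.ofReal (C * h ^ (β/2))
  f2 : ∃ C : ℝ, 0 < C ∧ ∀ x w : Euc N, 2 * V x ≤ V (x - w) + V (x + w) + ENNReal.ofReal (C * ‖w‖ ^ β)
  f2' : ∃ C : ℝ, 0 < C ∧ ∀ h : ℝ, 0 < h → ∀ x, V x ≤ heat N h V x + ENNReal.ofReal (C * h ^ (β/2))
  f3 : ∃ C : ℝ, 0 < C ∧ ∀ x ∈ S, ∀ h : ℝ, 0 < h → h ≤ 1 →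
    Tm N (pw s) μ x + heat N h V x ≤ heat N h (Tm N (pw s) μ) x + ENNReal.ofReal (C * h ^ (β/2))
  f4 : ∃ C : ℝ, 0 < C ∧ ∀ h : ℝ, 0 < h → ∀ x,
    heat N h (Tm N (pw s) μ) x ≤ Tm N (pw s) μ x + heat N h V x + ENNReal.ofReal (C * h ^ (β/2))
  Vb : ∃ C : ℝ, 0 < C ∧ ∀ x, V x ≤ ENNReal.ofReal (C * (1 + ‖x‖ ^ a))

lemma SB_of_SU {N : ℕ} {s a : ℝ} {μ : Measure (Euc N)} {S : Set (Euc N)} (hS : SU N s a μ S) (hs1 : s < 1) :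
    ∃ β V, SB N s a β μ S V := by
  have hprob := hS.prob
  have hci := hS.ci_pos
  have ha := hS.ha
  obtain ⟨β, q, hA, hβ1, hβ2, hβs, hqN⟩ := Adm_exists hS.hN hs1 hS.hsN hS.ha
  have hβ0 : 0 < β := by linarith
  obtain ⟨m, hm0, hm1, hm2⟩ := ps_const hS
  obtain ⟨K, hK, hKq⟩ := Kq_bdd hS hA.1 hqN
  obtain ⟨Cv, hCv, hμ⟩ := le_vol hS
  obtain ⟨Ku, hKu, hu⟩ := u_bdd hS.hs hS.hsN hμ
  have hfin : ∀ x, Tm N (pw s) μ x ≠ ⊤ := fun x => ((hu x).trans_lt ENNReal.ofReal_lt_top).ne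
  have hum : Measurable (Tm N (pw s) μ) := measurable_Tm (measurable_pw s) μ
  have hUm : Measurable (Ua N a μ) := measurable_Ua a μ
  set c := ENNReal.ofReal (ci N s) with hc
  have hcU : ∀ x, c * Ua N a μ x ≠ ⊤ := fun x => ENNReal.mul_ne_top ENNReal.ofReal_ne_top (hS.Ua_lt_top x).ne
  have hpm : Measurable (ps N s a μ) := by unfold ps; exact (hUm.const_mul _).add hum
  set V : Euc N → ℝ≥0∞ := fun x => ps N s a μ x - ENNReal.ofReal m with hV
  have hVm : Measurable V := hpm.sub measurable_const
  have hVe : ∀ x, V x + ENNReal.ofReal m = c * Ua N a μ x + Tm N (pw s) μ x := fun x => by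
    rw [hV]; exact tsub_add_cancel_of_le (hm1 x)
  have hmt : ENNReal.ofReal m ≠ ⊤ := ENNReal.ofReal_ne_top
  obtain ⟨C2, hC2, hB2⟩ := B2 hS hs1 hA hqN
  obtain ⟨C3, hC3, hUl⟩ := heat_U_lower hS hA
  have hcK : ∀ {t : ℝ} (x : Euc N), 0 ≤ t → c * (ENNReal.ofReal t * Kq N q μ x) ≤ ENNReal.ofReal (ci N s * K * t) := by
    intro t x ht
    calc _ ≤ c * (ENNReal.ofReal t * ENNReal.ofReal K) := by gcongr; exact hKq x
      _ = _ := by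
        rw [hc, ← ENNReal.ofReal_mul ht, ← ENNReal.ofReal_mul hci.le]; congr 1; ring
  have heatV : ∀ h : ℝ, 0 < h → ∀ x, heat N h V x + ENNReal.ofReal m = c * heat N h (Ua N a μ) x + heat N h (Tm N (pw s) μ) x := by
    intro h hh x
    have := gam_prob N hh
    rw [← heat_const_mul hUm, ← heat_add (hUm.const_mul c)]
    have e : heat N h V x + ENNReal.ofReal m = heat N h (fun y => V y + ENNReal.ofReal m) x := by
      rw [heat_add hVm]; congr 1; unfold heat; simp
    rw [e]; congr 1; ext y; exact hVe y
  have hUh : ∀ h : ℝ, 0 < h → ∀ x, c * heat N h (Ua N a μ) x ≠ ⊤ := fun h hh x =>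
    ENNReal.mul_ne_top ENNReal.ofReal_ne_top (heat_U_lt_top ha hh μ hS.mom x).ne
  -- f2
  have hf2 : ∀ x w : Euc N, 2 * V x ≤ V (x - w) + V (x + w) + ENNReal.ofReal ((ci N s * K * C3 + C2) * ‖w‖ ^ β) := by
    intro x w
    have hF : 2 * ENNReal.ofReal m ≠ ⊤ := ENNReal.mul_ne_top (by norm_num) hmt
    refine (ENNReal.add_le_add_iff_right hF).1 ?_
    calc _ = 2 * (V x + ENNReal.ofReal m) := by ring
      _ = c * (2 * Ua N a μ x) + 2 * Tm N (pw s) μ x := by rw [hVe]; ring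
      _ ≤ c * (Ua N a μ (x - w) + Ua N a μ (x + w) + ENNReal.ofReal (C3 * ‖w‖ ^ β) * Kq N q μ x) +
          (Tm N (pw s) μ (x - w) + Tm N (pw s) μ (x + w) + ENNReal.ofReal (C2 * ‖w‖ ^ β)) := by
          gcongr
          · exact (hUl x).1 w
          · exact hB2 x w
      _ = (c * Ua N a μ (x - w) + Tm N (pw s) μ (x - w)) + (c * Ua N a μ (x + w) + Tm N (pw s) μ (x + w)) +
          (c * (ENNReal.ofReal (C3 * ‖w‖ ^ β) * Kq N q μ x) + ENNReal.ofReal (C2 * ‖w‖ ^ β)) := by ring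
      _ ≤ (V (x - w) + ENNReal.ofReal m) + (V (x + w) + ENNReal.ofReal m) +
          (ENNReal.ofReal (ci N s * K * (C3 * ‖w‖ ^ β)) + ENNReal.ofReal (C2 * ‖w‖ ^ β)) := by
          rw [hVe, hVe]; gcongr; exact hcK x (by positivity)
      _ = _ := by
          rw [← ENNReal.ofReal_add (by positivity) (by positivity)]
          rw [show ci N s * K * (C3 * ‖w‖ ^ β) + C2 * ‖w‖ ^ β = (ci N s * K * C3 + C2) * ‖w‖ ^ β by ring]
          ring
  obtain ⟨Cf1, hCf1, hf1⟩ := sub_of_semi hum hβ0 hC2 hB2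
  obtain ⟨Cf2, hCf2, hf2'⟩ := sub_of_semi hVm hβ0 (by positivity) hf2
  obtain ⟨R0, hR0⟩ := hS.cpt.isBounded.exists_norm_le
  obtain ⟨C4, hC4, hUu⟩ := heat_U_upper hS hA R0
  refine ⟨β, V, ⟨hS.hN, hS.hs, hs1, hS.hsN, hS.ha, hβ1, hβ2, hβs, hprob, hS.cpt, hS.ne, hS.ae_mem, ⟨Cv, hCv, hμ⟩, ⟨Ku, hKu, hu⟩,
    hVm, ?_, ⟨Cf1, hCf1, hf1⟩, ⟨_, by positivity, hf2⟩, ⟨Cf2, hCf2, hf2'⟩, ?_, ?_, ?_⟩⟩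
  · intro x hx; simp only [hV]; rw [hm2 x hx, tsub_self]
  · refine ⟨ci N s * K * C4, by positivity, fun x hx h hh hh1 => ?_⟩
    refine (ENNReal.add_le_add_iff_right (hcU x)).1 ?_
    have h2 := hm2 x hx
    unfold ps at h2
    calc _ = heat N h V x + (c * Ua N a μ x + Tm N (pw s) μ x) := by ring
      _ = c * heat N h (Ua N a μ) x + heat N h (Tm N (pw s) μ) x := by rw [h2, heatV h hh]
      _ ≤ c * (Ua N a μ x + ENNReal.ofReal (C4 * h ^ (β/2)) * Kq N q μ x) + heat N h (Tm N (pw s) μ) x := by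
          gcongr; exact (hUu x (hR0 x hx)).2 h hh hh1
      _ = heat N h (Tm N (pw s) μ) x + c * (ENNReal.ofReal (C4 * h ^ (β/2)) * Kq N q μ x) + c * Ua N a μ x := by ring
      _ ≤ _ := by
          gcongr
          refine (hcK x (by positivity)).trans (le_of_eq ?_)
          congr 1; ring
  · refine ⟨ci N s * K * C3, by positivity, fun h hh x => ?_⟩
    refine (ENNReal.add_le_add_iff_right (ENNReal.add_ne_top.2 ⟨hcU x, hUh h hh x⟩)).1 ?_
    calc _ = (c * heat N h (Ua N a μ) x + heat N h (Tm N (pw s) μ) x) + c * Ua N a μ x := by ring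
      _ = (heat N h V x + ENNReal.ofReal m) + c * Ua N a μ x := by rw [heatV h hh]
      _ ≤ (heat N h V x + (c * Ua N a μ x + Tm N (pw s) μ x)) + c * (heat N h (Ua N a μ) x + ENNReal.ofReal (C3 * h ^ (β/2)) * Kq N q μ x) := by
          gcongr
          · exact hm1 x
          · exact (hUl x).2 h hh
      _ = Tm N (pw s) μ x + heat N h V x + c * (ENNReal.ofReal (C3 * h ^ (β/2)) * Kq N q μ x) + (c * Ua N a μ x + c * heat N h (Ua N a μ) x) := by ring
      _ ≤ _ := by
          gcongr
          refine (hcK x (by positivity)).trans (le_of_eq ?_)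
          congr 1; ring
  · set M := (∫⁻ y, ENNReal.ofReal (‖y‖ ^ a) ∂μ).toReal with hM
    have hM0 : 0 ≤ M := ENNReal.toReal_nonneg
    refine ⟨ci N s * (2 ^ a / a) * (1 + M) + Ku, by positivity, fun x => ?_⟩
    have h1 : Ua N a μ x ≤ ENNReal.ofReal (2 ^ a / a * (‖x‖ ^ a + M)) := by
      unfold Ua
      calc _ ≤ ∫⁻ y, ENNReal.ofReal (2 ^ a / a) * (ENNReal.ofReal (‖x‖ ^ a) + ENNReal.ofReal (‖y‖ ^ a)) ∂μ :=
            lintegral_mono fun y => norm_rpow_le ha x y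
        _ = _ := by
            rw [lintegral_const_mul' _ _ ENNReal.ofReal_ne_top, lintegral_add_left measurable_const, lintegral_const, measure_univ, mul_one,
              ← ENNReal.ofReal_toReal hS.mom.ne, ← hM, ← ENNReal.ofReal_add (by positivity) hM0, ← ENNReal.ofReal_mul (by positivity)]
    calc V x ≤ c * Ua N a μ x + Tm N (pw s) μ x := tsub_le_self
      _ ≤ c * ENNReal.ofReal (2 ^ a / a * (‖x‖ ^ a + M)) + ENNReal.ofReal Ku := by gcongr; exact hu x
      _ = ENNReal.ofReal (ci N s * (2 ^ a / a * (‖x‖ ^ a + M)) + Ku) := by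
          rw [hc, ← ENNReal.ofReal_mul hci.le, ← ENNReal.ofReal_add (by positivity) hKu.le]
      _ ≤ _ := by
          apply ENNReal.ofReal_le_ofReal
          have hx : 0 ≤ ‖x‖ ^ a := by positivity
          have hp : 0 < ci N s * (2 ^ a / a) := by positivity
          have : 0 ≤ ci N s * (2 ^ a / a) * (1 + M * ‖x‖ ^ a) + Ku * ‖x‖ ^ a := by positivity
          nlinarith

/-- pointwise density up to a constant -/
noncomputable def Rf (N : ℕ) (s : ℝ) (μ : Measure (Euc N)) (x : Euc N) : ℝ≥0∞ :=
  liminf (fun n : ℕ => Tm N (mw s ((1/2:ℝ)^n)) μ x) atTop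

lemma measurable_Rf {N : ℕ} (s : ℝ) (μ : Measure (Euc N)) [SFinite μ] : Measurable (Rf N s μ) :=
  Measurable.liminf fun _ => measurable_Tm (measurable_mw s _) μ

lemma SB.M1 {N : ℕ} {s a β : ℝ} {μ : Measure (Euc N)} {S : Set (Euc N)} {V : Euc N → ℝ≥0∞}
    (h : SB N s a β μ S V) : ∃ C : ℝ, 0 < C ∧ ∀ ε H : ℝ, 0 < ε → ε ≤ H → ∀ x,
      Tm N (mw s ε) μ x ≤ Tm N (mw s H) μ x + ENNReal.ofReal (C * H ^ (β/2 - s)) := by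
  have := h.prob
  have hs := h.hs
  have hbs := h.bs
  obtain ⟨C, hC, hf⟩ := h.f1
  obtain ⟨K, hK, hu⟩ := h.ub
  have hκ : 0 < β/2 - s := by linarith
  refine ⟨s * C / (β/2 - s), by positivity, fun ε H hε hH x => ?_⟩
  have key := ID_cmp h.hs hε hH μ x ((hu x).trans_lt ENNReal.ofReal_lt_top) (fun _ => 0)
    (fun h => ENNReal.ofReal (C * h ^ (β/2))) measurable_const (by fun_prop)
    (fun t ht => by simpa using hf t (hε.trans ht.1) x)
  have k2 := wint_pos (β := β/2) h.hs hC.le (by linarith) hε hH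
  calc Tm N (mw s ε) μ x ≤ _ := le_self_add
    _ ≤ _ := key
    _ ≤ _ := by gcongr

lemma SB.Mb {N : ℕ} {s a β : ℝ} {μ : Measure (Euc N)} {S : Set (Euc N)} {V : Euc N → ℝ≥0∞}
    (h : SB N s a β μ S V) : ∃ C : ℝ, 0 < C ∧ ∀ H : ℝ, 0 < H → ∀ x,
      Tm N (mw s H) μ x ≤ ENNReal.ofReal C := by
  obtain ⟨C, hC, hv⟩ := h.vol
  have hZ := Zc_pos h.hs h.hs1
  refine ⟨C * Zc s, by positivity, fun H hH x => ?_⟩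
  unfold Tm
  refine (lint_le_vol hv _).trans ?_
  rw [lintegral_sub_left_eq_self (fun z => Tk N (mw s H) z) x, Tk_total h.hs h.hs1 hH,
    ENNReal.ofReal_mul hC.le]

lemma SB.Rf_le {N : ℕ} {s a β : ℝ} {μ : Measure (Euc N)} {S : Set (Euc N)} {V : Euc N → ℝ≥0∞}
    (h : SB N s a β μ S V) : ∃ C : ℝ, 0 < C ∧ ∀ H : ℝ, 0 < H → ∀ x,
      Rf N s μ x ≤ Tm N (mw s H) μ x + ENNReal.ofReal (C * H ^ (β/2 - s)) := by
  obtain ⟨C, hC, h1⟩ := h.M1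
  refine ⟨C, hC, fun H hH x => ?_⟩
  have ht : Tendsto (fun n : ℕ => (1/2:ℝ)^n) atTop (𝓝 0) :=
    tendsto_pow_atTop_nhds_zero_of_lt_one (by norm_num) (by norm_num)
  have hev : ∀ᶠ n : ℕ in atTop, (1/2:ℝ)^n < H := ht.eventually (gt_mem_nhds hH)
  unfold Rf
  refine liminf_le_of_frequently_le' (Eventually.frequently ?_)
  filter_upwards [hev] with n hn
  exact h1 _ _ (by positivity) hn.le x

lemma SB.Rf_tendsto {N : ℕ} {s a β : ℝ} {μ : Measure (Euc N)} {S : Set (Euc N)} {V : Euc N → ℝ≥0∞}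
    (h : SB N s a β μ S V) (x : Euc N) :
    Tendsto (fun n : ℕ => Tm N (mw s ((1/2:ℝ)^n)) μ x) atTop (𝓝 (Rf N s μ x)) := by
  obtain ⟨C, hC, h1⟩ := h.M1
  have hbs := h.bs
  have ht : Tendsto (fun n : ℕ => (1/2:ℝ)^n) atTop (𝓝 0) :=
    tendsto_pow_atTop_nhds_zero_of_lt_one (by norm_num) (by norm_num)
  set f : ℕ → ℝ≥0∞ := fun n => Tm N (mw s ((1/2:ℝ)^n)) μ x with hf
  set c : ℕ → ℝ≥0∞ := fun n => ENNReal.ofReal (C * ((1/2:ℝ)^n) ^ (β/2 - s)) with hc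
  have hct : Tendsto c atTop (𝓝 0) := by
    have : Tendsto (fun n : ℕ => C * ((1/2:ℝ)^n) ^ (β/2 - s)) atTop (𝓝 0) := by
      have := (ht.rpow_const (p := β/2 - s) (Or.inr (by linarith))).const_mul C
      rwa [Real.zero_rpow (by linarith), mul_zero] at this
    simpa [hc] using ENNReal.tendsto_ofReal this
  refine tendsto_of_le_liminf_of_limsup_le le_rfl ?_
  have hL : ∀ n, limsup f atTop ≤ f n + c n := fun n => by
    refine limsup_le_of_le (by isBoundedDefault) ?_
    filter_upwards [eventually_ge_atTop n] with m hm
    exact h1 _ _ (by positivity) (pow_le_pow_of_le_one (by norm_num) (by norm_num) hm) x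
  have h2 : ∀ n, limsup f atTop - c n ≤ f n := fun n => tsub_le_iff_right.2 (hL n)
  have h3 : Tendsto (fun n => limsup f atTop - c n) atTop (𝓝 (limsup f atTop - 0)) :=
    ENNReal.Tendsto.sub tendsto_const_nhds hct (Or.inr (by simp))
  rw [tsub_zero] at h3
  calc limsup f atTop = liminf (fun n => limsup f atTop - c n) atTop := h3.liminf_eq.symm
    _ ≤ liminf f atTop := liminf_le_liminf (Eventually.of_forall h2)

lemma SB.Rf_off {N : ℕ} {s a β : ℝ} {μ : Measure (Euc N)} {S : Set (Euc N)} {V : Euc N → ℝ≥0∞}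
    (h : SB N s a β μ S V) {x : Euc N} (hx : x ∉ S) : Rf N s μ x = 0 := by
  obtain ⟨C, hC, hv⟩ := h.vol
  have hs1 := h.hs1
  obtain ⟨C', hC', hT⟩ := T_off (N := N) h.hs h.hs1 hC
  have hd : 0 < Metric.infDist x S := (h.cpt.isClosed.notMem_iff_infDist_pos h.ne).1 hx
  have hb := fun ε hε => hT μ S h.aeS hv x _ hd (fun y hy => by
    rw [← dist_eq_norm]; exact Metric.infDist_le_dist_of_mem hy) ε hε
  have ht : Tendsto (fun n : ℕ => (1/2:ℝ)^n) atTop (𝓝 0) :=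
    tendsto_pow_atTop_nhds_zero_of_lt_one (by norm_num) (by norm_num)
  have h0 : Tendsto (fun n : ℕ => ENNReal.ofReal (C' * (((1/2:ℝ)^n) ^ ((1-s)/2) * Metric.infDist x S ^ (-(1-s))))) atTop (𝓝 0) := by
    have := ((ht.rpow_const (p := (1-s)/2) (Or.inr (by linarith))).mul_const (Metric.infDist x S ^ (-(1-s)))).const_mul C'
    rw [Real.zero_rpow (by linarith), zero_mul, mul_zero] at this
    simpa using ENNReal.tendsto_ofReal this
  exact tendsto_nhds_unique (h.Rf_tendsto x) (tendsto_of_tendsto_of_tendsto_of_le_of_le tendsto_const_nhds h0 (fun _ => zero_le) (fun n => hb _ (by positivity)))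

lemma Tm_test {N : ℕ} {w : ℝ → ℝ≥0∞} (hw : Measurable w) (μ : Measure (Euc N)) [SFinite μ]
    {φ : Euc N → ℝ≥0∞} (hφ : Measurable φ) :
    ∫⁻ x, φ x * Tm N w μ x = ∫⁻ y, (∫⁻ τ in Ioi (0:ℝ), w τ * heat N τ φ y) ∂μ := by
  have hT := measurable_Tk (N := N) hw
  have e1 : ∀ x, φ x * Tm N w μ x = ∫⁻ y, φ x * Tk N w (x - y) ∂μ := fun x => by
    have hm : Measurable fun y => Tk N w (x - y) := hT.comp (by fun_prop)
    unfold Tm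
    rw [lintegral_const_mul _ hm]
  simp_rw [e1]
  rw [lintegral_lintegral_swap]
  · refine lintegral_congr fun y => ?_
    rw [← lintegral_sub_left_eq_self (fun x => φ x * Tk N w (x - y)) y]
    have hm : Measurable fun z => φ (y - z) := hφ.comp (by fun_prop)
    rw [show (∫⁻ τ in Ioi (0:ℝ), w τ * heat N τ φ y) = ∫⁻ z, Tk N w z * φ (y - z) from (Tk_lint hw hm).symm]
    refine lintegral_congr fun z => ?_
    rw [mul_comm, Tk_norm w (x := y - z - y) (y := z) (by simp)]
  · apply Measurable.aemeasurable
    exact (hφ.comp measurable_fst).mul (hT.comp (measurable_fst.sub measurable_snd))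

lemma mw_scale {s H τ : ℝ} (hH : 0 < H) (hτ : 0 < τ) : ENNReal.ofReal H * mw s H (H * τ) = mw s 1 τ := by
  unfold mw
  rw [← ENNReal.ofReal_mul hH.le, mr_scale hH hτ, ← mul_assoc, mul_inv_cancel₀ hH.ne', one_mul]

lemma measurable_heat2 {N : ℕ} {φ : Euc N → ℝ≥0∞} (hφm : Measurable φ) :
    Measurable fun p : Euc N × ℝ => heat N p.2 φ p.1 := by
  have : (fun p : Euc N × ℝ => heat N p.2 φ p.1) = fun p : Euc N × ℝ => ∫⁻ z, gE N p.2 z * φ (p.1 - z) := by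
    funext p
    unfold heat
    have hm : Measurable fun z => φ (p.1 - z) := hφm.comp (measurable_const.sub measurable_id)
    exact lintegral_gam _ hm
  rw [this]
  have h1 : Measurable fun q : (Euc N × ℝ) × Euc N => gE N q.1.2 q.2 :=
    (measurable_gE N).comp ((measurable_snd.comp measurable_fst).prodMk measurable_snd)
  have h2 : Measurable fun q : (Euc N × ℝ) × Euc N => φ (q.1.1 - q.2) :=
    hφm.comp ((measurable_fst.comp measurable_fst).sub measurable_snd)
  exact Measurable.lintegral_prod_right' (h1.mul h2)

lemma measurable_heat3 {N : ℕ} {φ : Euc N → ℝ≥0∞} (hφm : Measurable φ) (r : ℝ) {w : ℝ → ℝ≥0∞} (hw : Measurable w) :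
    Measurable fun y : Euc N => ∫⁻ τ in Ioi (0:ℝ), w τ * heat N (r * τ) φ y := by
  have hp : Measurable fun q : Euc N × ℝ => (q.1, r * q.2) := measurable_fst.prodMk (measurable_snd.const_mul r)
  have h1 : Measurable fun q : Euc N × ℝ => w q.2 := hw.comp measurable_snd
  have h2 : Measurable fun q : Euc N × ℝ => heat N (r * q.2) φ q.1 := Measurable.comp (g := fun p : Euc N × ℝ => heat N p.2 φ p.1) (f := fun q : Euc N × ℝ => (q.1, r * q.2)) (measurable_heat2 hφm) hp
  have h3 : Measurable fun q : Euc N × ℝ => w q.2 * heat N (r * q.2) φ q.1 := h1.mul h2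
  exact Measurable.lintegral_prod_right' (ν := volume.restrict (Ioi (0:ℝ))) h3

set_option maxHeartbeats 800000 in
lemma Tm_test_lim {N : ℕ} {s : ℝ} (hs : 0 < s) (hs1 : s < 1) (μ : Measure (Euc N)) [IsProbabilityMeasure μ]
    {φ : Euc N → ℝ≥0∞} (hφ : Continuous φ) {K : ℝ} (hK : ∀ x, φ x ≤ ENNReal.ofReal K) :
    Tendsto (fun n : ℕ => ∫⁻ x, φ x * Tm N (mw s ((1/2:ℝ)^n)) μ x) atTop
      (𝓝 (ENNReal.ofReal (Zc s) * ∫⁻ y, φ y ∂μ)) := by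
  have hφm := hφ.measurable
  have hZ : ∫⁻ τ in Ioi (0:ℝ), mw s 1 τ = ENNReal.ofReal (Zc s) := by
    rw [Zc_eq hs hs1]; simp [Wt]
  have ht : Tendsto (fun n : ℕ => (1/2:ℝ)^n) atTop (𝓝 0) :=
    tendsto_pow_atTop_nhds_zero_of_lt_one (by norm_num) (by norm_num)
  have hhm : ∀ y, Measurable fun τ => heat N τ φ y := fun y => measurable_heat hφm y
  have e : ∀ n : ℕ, ∫⁻ x, φ x * Tm N (mw s ((1/2:ℝ)^n)) μ x
      = ∫⁻ y, (∫⁻ τ in Ioi (0:ℝ), mw s 1 τ * heat N ((1/2:ℝ)^n * τ) φ y) ∂μ := fun n => by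
    rw [Tm_test (measurable_mw s _) μ hφm]
    refine lintegral_congr fun y => ?_
    have hp : (0:ℝ) < (1/2:ℝ)^n := by positivity
    rw [lint_Ioi_scale hp (fun τ => mw s ((1/2:ℝ)^n) τ * heat N τ φ y) ((measurable_mw s _).mul (hhm y)), ← lintegral_const_mul' _ _ ENNReal.ofReal_ne_top]
    refine setLIntegral_congr_fun measurableSet_Ioi fun τ hτ => ?_
    rw [← mul_assoc, mw_scale hp hτ]
  have hb : ∀ h y, 0 < h → heat N h φ y ≤ ENNReal.ofReal K := fun h y hh => by
    have := gam_prob N hh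
    calc heat N h φ y ≤ ∫⁻ _, ENNReal.ofReal K ∂(gam N h) := lintegral_mono fun z => hK _
      _ = _ := by simp
  simp_rw [e]
  have lim1 : ∀ y, Tendsto (fun n : ℕ => ∫⁻ τ in Ioi (0:ℝ), mw s 1 τ * heat N ((1/2:ℝ)^n * τ) φ y) atTop
      (𝓝 (∫⁻ τ in Ioi (0:ℝ), mw s 1 τ * φ y)) := fun y => by
    refine tendsto_lintegral_filter_of_dominated_convergence (fun τ => mw s 1 τ * ENNReal.ofReal K) ?_ ?_ ?_ ?_
    · exact Eventually.of_forall fun n => (measurable_mw s 1).mul ((hhm y).comp (by fun_prop))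
    · refine Eventually.of_forall fun n => (ae_restrict_iff' measurableSet_Ioi).2 (Eventually.of_forall fun τ hτ => ?_)
      have : (0:ℝ) < (1/2:ℝ)^n * τ := mul_pos (by positivity) hτ
      exact mul_le_mul_right (hb _ _ this) _
    · rw [lintegral_mul_const _ (measurable_mw s 1), hZ]
      exact ENNReal.mul_ne_top ENNReal.ofReal_ne_top ENNReal.ofReal_ne_top
    · refine (ae_restrict_iff' measurableSet_Ioi).2 (Eventually.of_forall fun τ hτ => ?_)
      refine ENNReal.Tendsto.const_mul ?_ (Or.inr (by simp [mw]))
      refine Tendsto.comp (g := fun h => heat N h φ y) (f := fun n : ℕ => (1/2:ℝ)^n * τ) (heat_tendsto hφ hK y) ?_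
      refine tendsto_nhdsWithin_iff.2 ⟨by have := ht.mul_const τ; rwa [zero_mul] at this, Eventually.of_forall fun n => ?_⟩
      have hp : (0:ℝ) < (1/2:ℝ)^n := by positivity
      exact mul_pos hp hτ
  have e2 : ∫⁻ y, (∫⁻ τ in Ioi (0:ℝ), mw s 1 τ * φ y) ∂μ = ENNReal.ofReal (Zc s) * ∫⁻ y, φ y ∂μ := by
    rw [← lintegral_const_mul _ hφm]
    refine lintegral_congr fun y => ?_
    rw [lintegral_mul_const _ (measurable_mw s 1), hZ]
  rw [← e2]
  refine tendsto_lintegral_filter_of_dominated_convergence (fun _ => ENNReal.ofReal (Zc s) * ENNReal.ofReal K) ?_ ?_ ?_ ?_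
  · refine Eventually.of_forall fun n => ?_
    exact (measurable_heat3 hφm ((1/2:ℝ)^n) (measurable_mw s 1))
  · refine Eventually.of_forall fun n => Eventually.of_forall fun y => ?_
    rw [← hZ, ← lintegral_mul_const _ (measurable_mw s 1)]
    refine setLIntegral_mono' measurableSet_Ioi fun τ hτ => ?_
    have : (0:ℝ) < (1/2:ℝ)^n * τ := mul_pos (by positivity) hτ
    exact mul_le_mul_right (hb _ _ this) _
  · rw [lintegral_const]
    simp [ENNReal.mul_eq_top]
  · exact Eventually.of_forall lim1

lemma SB.tail {N : ℕ} {s a β : ℝ} {μ : Measure (Euc N)} {S : Set (Euc N)} {V : Euc N → ℝ≥0∞}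
    (h : SB N s a β μ S V) : ∃ C : ℝ, 0 < C ∧ ∀ B : Set (Euc N), MeasurableSet B → (∀ y ∈ S, ∀ x ∉ B, 1 ≤ ‖x - y‖) →
      ∀ ε : ℝ, 0 < ε → ∫⁻ x in Bᶜ, Tm N (mw s ε) μ x ≤ ENNReal.ofReal (C * ε ^ ((1-s)/2)) := by
  have := h.prob
  have hs1 := h.hs1
  obtain ⟨C, hC, hT⟩ := Tk_moment N h.hs h.hs1
  refine ⟨C, hC, fun B hB hBS ε hε => ?_⟩
  have hTm := measurable_Tk (N := N) (measurable_mw s ε)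
  unfold Tm
  rw [lintegral_lintegral_swap]
  · calc ∫⁻ y, (∫⁻ x in Bᶜ, Tk N (mw s ε) (x - y)) ∂μ
        ≤ ∫⁻ _, ENNReal.ofReal (C * ε ^ ((1-s)/2)) ∂μ := by
          refine lintegral_mono_ae ?_
          filter_upwards [h.aeS] with y hy
          calc ∫⁻ x in Bᶜ, Tk N (mw s ε) (x - y)
              ≤ ∫⁻ x in Bᶜ, Tk N (mw s ε) (x - y) * ENNReal.ofReal (‖x - y‖ ^ (1 - s)) := by
                refine setLIntegral_mono' hB.compl fun x hx => ?_
                have := hBS y hy x hx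
                have h1 : 1 ≤ ENNReal.ofReal (‖x - y‖ ^ (1 - s)) := by
                  rw [ENNReal.one_le_ofReal]
                  exact Real.one_le_rpow this (by linarith)
                calc Tk N (mw s ε) (x - y) = Tk N (mw s ε) (x - y) * 1 := (mul_one _).symm
                  _ ≤ _ := by gcongr
            _ ≤ ∫⁻ x, Tk N (mw s ε) (x - y) * ENNReal.ofReal (‖x - y‖ ^ (1 - s)) := setLIntegral_le_lintegral _ _
            _ = ∫⁻ z, Tk N (mw s ε) z * ENNReal.ofReal (‖z‖ ^ (1 - s)) :=
                lintegral_sub_right_eq_self (fun z => Tk N (mw s ε) z * ENNReal.ofReal (‖z‖ ^ (1 - s))) y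
            _ ≤ _ := hT ε hε
      _ = _ := by simp
  · exact (hTm.comp (measurable_fst.sub measurable_snd)).aemeasurable

lemma SB.Rf_density {N : ℕ} {s a β : ℝ} {μ : Measure (Euc N)} {S : Set (Euc N)} {V : Euc N → ℝ≥0∞}
    (h : SB N s a β μ S V) : ENNReal.ofReal (Zc s) • μ = volume.withDensity (Rf N s μ) := by
  have := h.prob
  have hs1 := h.hs1
  have hZ := Zc_pos h.hs h.hs1
  have hRm := measurable_Rf s μ
  obtain ⟨R, hR⟩ := h.cpt.isBounded.subset_closedBall (0 : Euc N)
  set B : Set (Euc N) := Metric.closedBall 0 (R + 1) with hB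
  have hBm : MeasurableSet B := Metric.isClosed_closedBall.measurableSet
  have hBS : ∀ y ∈ S, ∀ x ∉ B, 1 ≤ ‖x - y‖ := fun y hy x hx => by
    have h1 : ‖y‖ ≤ R := by simpa using hR hy
    have h2 : R + 1 < ‖x‖ := by simpa [hB] using hx
    have := norm_sub_norm_le x y
    linarith
  obtain ⟨C, hC, htail⟩ := h.tail
  obtain ⟨K, hK, hMb⟩ := h.Mb
  have ht : Tendsto (fun n : ℕ => (1/2:ℝ)^n) atTop (𝓝 0) :=
    tendsto_pow_atTop_nhds_zero_of_lt_one (by norm_num) (by norm_num)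
  have hoff : ∀ x ∉ B, Rf N s μ x = 0 := fun x hx => h.Rf_off fun hxS => by
    have := hBS x hxS x hx
    simp at this
    linarith
  have key : ∀ φ : Euc N → ℝ≥0∞, Continuous φ → ∀ L : ℝ, (∀ x, φ x ≤ ENNReal.ofReal L) →
      ENNReal.ofReal (Zc s) * ∫⁻ y, φ y ∂μ = ∫⁻ x, φ x * Rf N s μ x := by
    intro φ hφ L hL
    have hφm := hφ.measurable
    have l1 := Tm_test_lim h.hs h.hs1 μ hφ hL
    refine tendsto_nhds_unique l1 ?_
    have hin : Tendsto (fun n : ℕ => ∫⁻ x in B, φ x * Tm N (mw s ((1/2:ℝ)^n)) μ x) atTop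
        (𝓝 (∫⁻ x in B, φ x * Rf N s μ x)) := by
      refine tendsto_lintegral_filter_of_dominated_convergence (fun _ => ENNReal.ofReal L * ENNReal.ofReal K) ?_ ?_ ?_ ?_
      · exact Eventually.of_forall fun n => hφm.mul (measurable_Tm (measurable_mw s _) μ)
      · exact Eventually.of_forall fun n => Eventually.of_forall fun x =>
          mul_le_mul' (hL x) (hMb _ (by positivity) x)
      · rw [lintegral_const]
        refine ENNReal.mul_ne_top (ENNReal.mul_ne_top ENNReal.ofReal_ne_top ENNReal.ofReal_ne_top) ?_
        rw [Measure.restrict_apply_univ]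
        exact measure_closedBall_lt_top.ne
      · refine Eventually.of_forall fun x => ENNReal.Tendsto.const_mul (h.Rf_tendsto x) (Or.inr ?_)
        exact ((hL x).trans_lt ENNReal.ofReal_lt_top).ne
    have hout : Tendsto (fun n : ℕ => ∫⁻ x in Bᶜ, φ x * Tm N (mw s ((1/2:ℝ)^n)) μ x) atTop (𝓝 0) := by
      have h0 : Tendsto (fun n : ℕ => ENNReal.ofReal L * ENNReal.ofReal (C * ((1/2:ℝ)^n) ^ ((1-s)/2))) atTop (𝓝 0) := by
        have := (ht.rpow_const (p := (1-s)/2) (Or.inr (by linarith))).const_mul C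
        rw [Real.zero_rpow (by linarith), mul_zero] at this
        have := ENNReal.Tendsto.const_mul (a := ENNReal.ofReal L) (ENNReal.tendsto_ofReal this) (Or.inr ENNReal.ofReal_ne_top)
        simpa using this
      refine tendsto_of_tendsto_of_tendsto_of_le_of_le tendsto_const_nhds h0 (fun _ => zero_le) (fun n => ?_)
      calc ∫⁻ x in Bᶜ, φ x * Tm N (mw s ((1/2:ℝ)^n)) μ x
          ≤ ∫⁻ x in Bᶜ, ENNReal.ofReal L * Tm N (mw s ((1/2:ℝ)^n)) μ x := lintegral_mono fun x => mul_le_mul_left (hL x) _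
        _ = ENNReal.ofReal L * ∫⁻ x in Bᶜ, Tm N (mw s ((1/2:ℝ)^n)) μ x := lintegral_const_mul' _ _ ENNReal.ofReal_ne_top
        _ ≤ _ := by gcongr; exact htail B hBm hBS _ (by positivity)
    have hsum := hin.add hout
    simp_rw [lintegral_add_compl _ hBm] at hsum
    have e0 : ∫⁻ x in Bᶜ, φ x * Rf N s μ x = 0 := by
      rw [setLIntegral_congr_fun (g := fun _ => 0) hBm.compl fun x hx => by simp [hoff x hx]]
      simp
    rwa [← e0, lintegral_add_compl _ hBm] at hsum
  have hfin : IsFiniteMeasure (volume.withDensity (Rf N s μ)) := by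
    refine isFiniteMeasure_withDensity ?_
    have := key (fun _ => 1) continuous_const 1 (by simp)
    simp only [one_mul] at this
    rw [← this]
    simp
  have hfin2 : IsFiniteMeasure (ENNReal.ofReal (Zc s) • μ) := by
    constructor
    simp
  refine ext_of_forall_lintegral_eq_of_IsFiniteMeasure fun f => ?_
  have hfc : Continuous fun x => (f x : ℝ≥0∞) := ENNReal.continuous_coe.comp f.continuous
  rw [lintegral_smul_measure, smul_eq_mul, lintegral_withDensity_eq_lintegral_mul _ hRm hfc.measurable]
  obtain ⟨L, hL⟩ : ∃ L : ℝ, ∀ x, (f x : ℝ≥0∞) ≤ ENNReal.ofReal L := by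
    refine ⟨nndist f 0, fun x => ?_⟩
    rw [ENNReal.ofReal_coe_nnreal, ENNReal.coe_le_coe]
    exact BoundedContinuousFunction.NNReal.upper_bound f x
  rw [key _ hfc L hL]
  exact lintegral_congr fun x => mul_comm _ _

lemma SB.Tm_Rf {N : ℕ} {s a β : ℝ} {μ : Measure (Euc N)} {S : Set (Euc N)} {V : Euc N → ℝ≥0∞}
    (h : SB N s a β μ S V) {w : ℝ → ℝ≥0∞} (hw : Measurable w) (x : Euc N) :
    ENNReal.ofReal (Zc s) * Tm N w μ x = ∫⁻ y, Tk N w (x - y) * Rf N s μ y := by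
  have := h.prob
  have hm : Measurable fun y => Tk N w (x - y) := (measurable_Tk hw).comp (by fun_prop)
  unfold Tm
  rw [← smul_eq_mul, ← lintegral_smul_measure, h.Rf_density,
    lintegral_withDensity_eq_lintegral_mul _ (measurable_Rf s μ) hm]
  exact lintegral_congr fun y => mul_comm _ _

lemma gk_shift {N : ℕ} {h : ℝ} (hh : 0 < h) (z w : Euc N) (hw : ‖w‖ ^ 2 ≤ h) :
    gk N (h/2) (z + w) ≤ (2 ^ ((N:ℝ)/2) * Real.exp (1/2)) * gk N h z := by
  unfold gk
  have h1 : (4 * π * (h/2)) ^ (-(N:ℝ)/2) = 2 ^ ((N:ℝ)/2) * (4 * π * h) ^ (-(N:ℝ)/2) := by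
    rw [show 4 * π * (h/2) = (2:ℝ)⁻¹ * (4 * π * h) by ring, Real.mul_rpow (by norm_num) (by positivity),
      Real.inv_rpow (by norm_num), ← Real.rpow_neg (by norm_num)]
    congr 2; ring
  have h2 : ‖z‖ ^ 2 ≤ 2 * ‖z + w‖ ^ 2 + 2 * ‖w‖ ^ 2 := by
    have : ‖z‖ ≤ ‖z + w‖ + ‖w‖ := by
      calc ‖z‖ = ‖(z + w) - w‖ := by simp
        _ ≤ _ := norm_sub_le _ _
    nlinarith [norm_nonneg z, norm_nonneg (z+w), norm_nonneg w, sq_nonneg (‖z+w‖ - ‖w‖)]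
  have h3 : Real.exp (-‖z + w‖ ^ 2 / (4 * (h/2))) ≤ Real.exp (1/2) * Real.exp (-‖z‖ ^ 2 / (4 * h)) := by
    rw [← Real.exp_add]
    apply Real.exp_le_exp.2
    rw [div_add_div _ _ (by norm_num) (by positivity), div_le_div_iff₀ (by positivity) (by positivity)]
    nlinarith
  rw [h1]
  calc _ ≤ 2 ^ ((N:ℝ)/2) * (4 * π * h) ^ (-(N:ℝ)/2) * (Real.exp (1/2) * Real.exp (-‖z‖ ^ 2 / (4 * h))) := by gcongr
    _ = _ := by ring

lemma heat_vol {N : ℕ} {f : Euc N → ℝ≥0∞} (hf : Measurable f) (h : ℝ) (x : Euc N) :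
    heat N h f x = ∫⁻ y, gE N h (x - y) * f y := by
  unfold heat
  have hm : Measurable fun z => f (x - z) := hf.comp (measurable_const.sub measurable_id)
  rw [lintegral_gam _ hm, ← lintegral_sub_left_eq_self (fun y => gE N h (x - y) * f y) x]
  refine lintegral_congr fun z => by simp

lemma heat_shift {N : ℕ} {f : Euc N → ℝ≥0∞} (hf : Measurable f) {h : ℝ} (hh : 0 < h) (x w : Euc N) (hw : ‖w‖ ^ 2 ≤ h) :
    heat N (h/2) f (x + w) ≤ ENNReal.ofReal (2 ^ ((N:ℝ)/2) * Real.exp (1/2)) * heat N h f x := by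
  rw [heat_vol hf, heat_vol hf, ← lintegral_const_mul' _ _ ENNReal.ofReal_ne_top]
  refine lintegral_mono fun y => ?_
  rw [← mul_assoc]
  refine mul_le_mul_left ?_ _
  unfold gE
  rw [← ENNReal.ofReal_mul (by positivity)]
  apply ENNReal.ofReal_le_ofReal
  have := gk_shift hh (x - y) w hw
  rwa [show x - y + w = x + w - y by abel] at this

lemma SB.B4 {N : ℕ} {s a β : ℝ} {μ : Measure (Euc N)} {S : Set (Euc N)} {V : Euc N → ℝ≥0∞}
    (h : SB N s a β μ S V) : ∃ C : ℝ, 0 < C ∧ ∀ x₀ ∈ S, ∀ w : Euc N, 0 < ‖w‖ → ‖w‖ ≤ 1/2 →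
      V (x₀ + w) ≤ ENNReal.ofReal (C * ‖w‖ ^ (2 * s)) *
        (Tm N (mw s (4 * ‖w‖ ^ 2)) μ x₀ + ENNReal.ofReal (‖w‖ ^ (β - 2 * s))) := by
  have := h.prob
  have hs := h.hs
  have hbs := h.bs
  have hVm := h.Vm
  obtain ⟨C₃, hC₃, f3⟩ := h.f3
  obtain ⟨C₂, hC₂, f2⟩ := h.f2'
  obtain ⟨Ku, hKu, hu⟩ := h.ub
  set K := (2:ℝ) ^ ((N:ℝ)/2) * Real.exp (1/2) with hK
  have hK0 : 0 < K := by positivity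
  have h4 : (4:ℝ) ^ (-s) < 1 := Real.rpow_lt_one_of_one_lt_of_neg (by norm_num) (by linarith)
  set b := 1 - (4:ℝ) ^ (-s) with hb
  have hb0 : 0 < b := by linarith
  have hκ : 0 < β/2 - s := by linarith
  set D := s * C₃ / (β/2 - s) * 4 ^ (β/2 - s) with hD
  set D₂ := s * C₂ / (β/2 - s) * 4 ^ (β/2 - s) with hD2
  have hD0 : 0 < D := by positivity
  have hD20 : 0 < D₂ := by positivity
  refine ⟨(K + K * D + D₂) / b, by positivity, fun x₀ hx₀ w hw0 hw1 => ?_⟩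
  set r := ‖w‖ with hr
  have hr2 : 0 < r ^ 2 := by positivity
  have hH1 : 4 * r ^ 2 ≤ 1 := by nlinarith
  have hεH : r ^ 2 ≤ 4 * r ^ 2 := by linarith
  have hhm : Measurable fun t => heat N t V x₀ := measurable_heat hVm x₀
  have e4 : ∀ c : ℝ, c * (4 * r ^ 2) ^ (β/2 - s) = c * 4 ^ (β/2 - s) * r ^ (β - 2 * s) := fun c => by
    rw [Real.mul_rpow (by norm_num) hr2.le, ← Real.rpow_natCast, ← Real.rpow_mul hw0.le]
    push_cast
    rw [show 2 * (β/2 - s) = β - 2 * s by ring]; ring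
  have k1 := ID_cmp h.hs hr2 hεH μ x₀ ((hu x₀).trans_lt ENNReal.ofReal_lt_top) (fun t => heat N t V x₀)
    (fun t => ENNReal.ofReal (C₃ * t ^ (β/2))) hhm (by fun_prop)
    (fun t ht => f3 x₀ hx₀ t (hr2.trans ht.1) (ht.2.le.trans hH1))
  have k2 := wint_pos (β := β/2) h.hs hC₃.le (by linarith) hr2 hεH
  have k3 := wint_pos (β := β/2) h.hs hC₂.le (by linarith) hr2 hεH
  rw [e4, ← hD] at k2
  rw [e4, ← hD2] at k3
  have k4 := weight_integral0 h.hs hr2 hεH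
  have e5 : (r ^ 2) ^ (-s) - (4 * r ^ 2) ^ (-s) = b * r ^ (-(2 * s)) := by
    rw [Real.mul_rpow (by norm_num) hr2.le, ← Real.rpow_natCast, ← Real.rpow_mul hw0.le]
    push_cast
    rw [show 2 * -s = -(2 * s) by ring]; ring
  rw [e5] at k4
  have hle : (∫⁻ t in Ioo (r^2) (4 * r^2), ENNReal.ofReal (s * t ^ (-1 - s)) * heat N t V x₀)
      ≤ Tm N (mw s (4 * r ^ 2)) μ x₀ + ENNReal.ofReal (D * r ^ (β - 2 * s)) :=
    le_add_self.trans (k1.trans (by gcongr))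
  have k5 : ENNReal.ofReal (b * r ^ (-(2 * s))) * V (x₀ + w) ≤
      ENNReal.ofReal K * (Tm N (mw s (4 * r ^ 2)) μ x₀ + ENNReal.ofReal (D * r ^ (β - 2 * s)))
        + ENNReal.ofReal (D₂ * r ^ (β - 2 * s)) := by
    have hwm : Measurable fun t : ℝ => ENNReal.ofReal (s * t ^ (-1 - s)) := by fun_prop
    rw [← k4, ← lintegral_mul_const _ hwm]
    calc ∫⁻ t in Ioo (r^2) (4 * r^2), ENNReal.ofReal (s * t ^ (-1 - s)) * V (x₀ + w)
        ≤ ∫⁻ t in Ioo (r^2) (4 * r^2), (ENNReal.ofReal K * (ENNReal.ofReal (s * t ^ (-1 - s)) * heat N t V x₀)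
            + ENNReal.ofReal (s * t ^ (-1 - s)) * ENNReal.ofReal (C₂ * t ^ (β/2))) := by
          refine setLIntegral_mono' measurableSet_Ioo fun t ht => ?_
          have ht0 : 0 < t := hr2.trans ht.1
          have := f2 (t/2) (by positivity) (x₀ + w)
          have h6 := heat_shift hVm ht0 x₀ w ht.1.le
          have h7 : ENNReal.ofReal (C₂ * (t/2) ^ (β/2)) ≤ ENNReal.ofReal (C₂ * t ^ (β/2)) := by
            apply ENNReal.ofReal_le_ofReal
            have : t/2 ≤ t := by linarith
            have hb2 : 0 ≤ β/2 := by linarith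
            gcongr
          calc _ ≤ ENNReal.ofReal (s * t ^ (-1 - s)) * (ENNReal.ofReal K * heat N t V x₀ + ENNReal.ofReal (C₂ * t ^ (β/2))) := by
                gcongr
                exact this.trans (add_le_add h6 h7)
            _ = _ := by ring
      _ = ENNReal.ofReal K * (∫⁻ t in Ioo (r^2) (4 * r^2), ENNReal.ofReal (s * t ^ (-1 - s)) * heat N t V x₀)
            + ∫⁻ t in Ioo (r^2) (4 * r^2), ENNReal.ofReal (s * t ^ (-1 - s)) * ENNReal.ofReal (C₂ * t ^ (β/2)) := by
          rw [lintegral_add_right _ (by fun_prop), lintegral_const_mul' _ _ ENNReal.ofReal_ne_top]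
      _ ≤ _ := by gcongr
  have e6 : ENNReal.ofReal (r ^ (2 * s) / b) * (ENNReal.ofReal (b * r ^ (-(2 * s))) * V (x₀ + w)) = V (x₀ + w) := by
    rw [← mul_assoc, ← ENNReal.ofReal_mul (by positivity)]
    rw [show r ^ (2 * s) / b * (b * r ^ (-(2 * s))) = r ^ (2 * s) * r ^ (-(2 * s)) by field_simp,
      ← Real.rpow_add hw0]
    simp
  rw [← e6]
  calc _ ≤ ENNReal.ofReal (r ^ (2 * s) / b) * (ENNReal.ofReal K * (Tm N (mw s (4 * r ^ 2)) μ x₀ + ENNReal.ofReal (D * r ^ (β - 2 * s)))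
        + ENNReal.ofReal (D₂ * r ^ (β - 2 * s))) := by gcongr
    _ = ENNReal.ofReal (r ^ (2 * s) / b) * (ENNReal.ofReal K * Tm N (mw s (4 * r ^ 2)) μ x₀
        + ENNReal.ofReal (K * D + D₂) * ENNReal.ofReal (r ^ (β - 2 * s))) := by
        rw [ENNReal.ofReal_add (by positivity) (by positivity), ENNReal.ofReal_mul hK0.le, ENNReal.ofReal_mul hD0.le,
          ENNReal.ofReal_mul hD20.le]
        ring
    _ ≤ ENNReal.ofReal (r ^ (2 * s) / b) * (ENNReal.ofReal (K + K * D + D₂) * Tm N (mw s (4 * r ^ 2)) μ x₀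
        + ENNReal.ofReal (K + K * D + D₂) * ENNReal.ofReal (r ^ (β - 2 * s))) := by
        have : 0 < K * D := by positivity
        have i1 : ENNReal.ofReal K ≤ ENNReal.ofReal (K + K * D + D₂) := ENNReal.ofReal_le_ofReal (by linarith)
        have i2 : ENNReal.ofReal (K * D + D₂) ≤ ENNReal.ofReal (K + K * D + D₂) := ENNReal.ofReal_le_ofReal (by linarith)
        gcongr
    _ = _ := by
        rw [← mul_add, ← mul_assoc, ← ENNReal.ofReal_mul (by positivity)]
        congr 2
        ring

lemma max_pow_le {t α p : ℝ} (ht : 0 ≤ t) (hα : 0 < α) (hαp : α ≤ p) (hp : p ≤ 1) :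
    max 1 (1 + t) ^ α ≤ 1 + α / p * (1 + t ^ p) := by
  have hp0 : 0 < p := hα.trans_le hαp
  rw [max_eq_right (by linarith)]
  have h1 : (1 + t) ^ α = ((1 + t) ^ p) ^ (α / p) := by
    rw [← Real.rpow_mul (by linarith)]; congr 1; field_simp
  have h2 : (1 + t) ^ p ≤ 1 + t ^ p := by
    have := Real.rpow_add_le_add_rpow (p := p) zero_le_one ht hp0.le hp
    simpa using this
  have h0 : 0 ≤ t ^ p := by positivity
  have h3 := rpow_one_add_le_one_add_mul_self (s := t ^ p) (p := α / p) (by linarith) (by positivity) ((div_le_one hp0).2 hαp)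
  rw [h1]
  calc ((1 + t) ^ p) ^ (α / p) ≤ (1 + t ^ p) ^ (α / p) := by gcongr
    _ ≤ 1 + α / p * t ^ p := h3
    _ ≤ _ := by
      have : 0 < α / p := by positivity
      nlinarith

/-- kernel average against a growing weight -/
lemma Tk_growth (N : ℕ) {s : ℝ} (hs : 0 < s) (hs1 : s < 1) : ∃ K : ℝ, 0 < K ∧ ∀ α : ℝ, 0 < α → α ≤ 1 - s →
    ∀ r c : ℝ, 0 < r → 0 < c → c ≤ 2 → ∀ x : Euc N,
    ∫⁻ y, Tk N (mw s ((c * r) ^ 2)) (x - y) * ENNReal.ofReal ((1 + ‖x - y‖ / r + 1) ^ α)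
      ≤ ENNReal.ofReal (Zc s + α * K) := by
  obtain ⟨C, hC, hT⟩ := Tk_moment N hs hs1
  have hZ := Zc_pos hs hs1
  have hp : 0 < 1 - s := by linarith
  refine ⟨2 / (1 - s) * (Zc s + C), by positivity, fun α hα hα1 r c hr hc hc2 x => ?_⟩
  have hcr : 0 < (c * r) ^ 2 := by positivity
  rw [lintegral_sub_left_eq_self (fun z => Tk N (mw s ((c * r) ^ 2)) z * ENNReal.ofReal ((1 + ‖z‖ / r + 1) ^ α)) x]
  have hpt : ∀ z : Euc N, (1 + ‖z‖ / r + 1) ^ α ≤ (1 + 2 * α / (1 - s)) + (α / (1 - s) * r ^ (-(1 - s))) * ‖z‖ ^ (1 - s) := fun z => by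
    have h1 := max_pow_le (t := 1 + ‖z‖ / r) (by positivity) hα hα1 (by linarith)
    rw [max_eq_right (by have : 0 ≤ ‖z‖ / r := by positivity
                         linarith)] at h1
    have h2 := Real.rpow_add_le_add_rpow (p := 1 - s) zero_le_one (show 0 ≤ ‖z‖ / r by positivity) hp.le (by linarith)
    rw [Real.one_rpow, Real.div_rpow (by positivity) hr.le] at h2
    have h3 : r ^ (-(1 - s)) * ‖z‖ ^ (1 - s) = ‖z‖ ^ (1 - s) / r ^ (1 - s) := by
      rw [Real.rpow_neg hr.le]; field_simp
    rw [mul_assoc, h3]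
    have hd : 0 < α / (1 - s) := by positivity
    have : 2 * α / (1 - s) = α / (1 - s) * 2 := by ring
    rw [this]
    calc _ = (1 + (1 + ‖z‖ / r)) ^ α := by ring_nf
      _ ≤ _ := h1
      _ ≤ _ := by nlinarith
  calc _ ≤ ∫⁻ z, (ENNReal.ofReal (1 + 2 * α / (1 - s)) * Tk N (mw s ((c * r) ^ 2)) z
        + ENNReal.ofReal (α / (1 - s) * r ^ (-(1 - s))) * (Tk N (mw s ((c * r) ^ 2)) z * ENNReal.ofReal (‖z‖ ^ (1 - s)))) := by
        refine lintegral_mono fun z => ?_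
        calc _ ≤ Tk N (mw s ((c * r) ^ 2)) z * ENNReal.ofReal ((1 + 2 * α / (1 - s)) + (α / (1 - s) * r ^ (-(1 - s))) * ‖z‖ ^ (1 - s)) :=
              mul_le_mul_right (ENNReal.ofReal_le_ofReal (hpt z)) _
          _ = _ := by
              rw [ENNReal.ofReal_add (by positivity) (by positivity), ENNReal.ofReal_mul (p := α / (1 - s) * r ^ (-(1 - s))) (by positivity)]
              ring
    _ = ENNReal.ofReal (1 + 2 * α / (1 - s)) * ENNReal.ofReal (Zc s) + ENNReal.ofReal (α / (1 - s) * r ^ (-(1 - s))) *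
        ∫⁻ z, (Tk N (mw s ((c * r) ^ 2)) z * ENNReal.ofReal (‖z‖ ^ (1 - s))) := by
        rw [lintegral_add_left ((measurable_Tk (measurable_mw s _)).const_mul _), lintegral_const_mul' _ _ ENNReal.ofReal_ne_top,
          lintegral_const_mul' _ _ ENNReal.ofReal_ne_top, Tk_total hs hs1 hcr]
    _ ≤ ENNReal.ofReal (1 + 2 * α / (1 - s)) * ENNReal.ofReal (Zc s) + ENNReal.ofReal (α / (1 - s) * r ^ (-(1 - s))) *
        ENNReal.ofReal (C * ((c * r) ^ 2) ^ ((1 - s)/2)) := by gcongr; exact hT _ hcr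
    _ ≤ _ := by
        rw [← ENNReal.ofReal_mul (by positivity), ← ENNReal.ofReal_mul (by positivity), ← ENNReal.ofReal_add (by positivity) (by positivity)]
        apply ENNReal.ofReal_le_ofReal
        have e : ((c * r) ^ 2) ^ ((1 - s)/2) = c ^ (1 - s) * r ^ (1 - s) := by
          rw [← Real.rpow_natCast, ← Real.rpow_mul (by positivity), ← Real.mul_rpow hc.le hr.le]
          congr 1; push_cast; ring
        have e2 : r ^ (-(1 - s)) * r ^ (1 - s) = 1 := by rw [← Real.rpow_add hr]; simp
        have e3 : c ^ (1 - s) ≤ 2 := by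
          calc c ^ (1 - s) ≤ 2 ^ (1 - s) := by gcongr
            _ ≤ 2 ^ (1:ℝ) := Real.rpow_le_rpow_of_exponent_le (by norm_num) (by linarith)
            _ = 2 := by norm_num
        rw [e]
        calc _ = (1 + 2 * α / (1 - s)) * Zc s + α / (1 - s) * C * c ^ (1 - s) * (r ^ (-(1 - s)) * r ^ (1 - s)) := by ring
          _ = (1 + 2 * α / (1 - s)) * Zc s + α / (1 - s) * C * c ^ (1 - s) := by rw [e2, mul_one]
          _ ≤ (1 + 2 * α / (1 - s)) * Zc s + α / (1 - s) * C * 2 := by gcongr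
          _ = _ := by ring

lemma half_ball {N : ℕ} {ρ : Euc N → ℝ≥0∞} (hρ : Measurable ρ) (y₁ : Euc N) {R : ℝ} (a : ℝ≥0∞)
    (h : ∀ w : Euc N, ‖w‖ < R → ρ (y₁ - w) = 0 ∨ ρ (y₁ + w) = 0) :
    a * volume (Metric.ball (0 : Euc N) R) ≤ 2 * ∫⁻ y in Metric.ball y₁ R, (a - ρ y) := by
  have hB : MeasurableSet (Metric.ball y₁ R) := Metric.isOpen_ball.measurableSet
  have hB0 : MeasurableSet (Metric.ball (0 : Euc N) R) := Metric.isOpen_ball.measurableSet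
  have hm : Measurable fun y => a - ρ y := measurable_const.sub hρ
  have e1 : ∫⁻ y in Metric.ball y₁ R, (a - ρ y) = ∫⁻ w in Metric.ball (0 : Euc N) R, (a - ρ (y₁ + w)) := by
    rw [← lintegral_indicator hB, ← lintegral_indicator hB0,
      ← lintegral_add_left_eq_self ((Metric.ball y₁ R).indicator fun y => a - ρ y) y₁]
    refine lintegral_congr fun w => ?_
    by_cases hw : ‖w‖ < R <;> simp [indicator, hw]
  have e2 : ∫⁻ y in Metric.ball y₁ R, (a - ρ y) = ∫⁻ w in Metric.ball (0 : Euc N) R, (a - ρ (y₁ - w)) := by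
    rw [← lintegral_indicator hB, ← lintegral_indicator hB0,
      ← lintegral_sub_left_eq_self ((Metric.ball y₁ R).indicator fun y => a - ρ y) y₁]
    refine lintegral_congr fun w => ?_
    by_cases hw : ‖w‖ < R <;> simp [indicator, hw, dist_eq_norm]
  rw [two_mul]
  nth_rw 1 [e1]
  rw [e2, ← lintegral_add_left (by exact hm.comp (measurable_const.add measurable_id)), ← setLIntegral_const]
  refine setLIntegral_mono' hB0 fun w hw => ?_
  rcases h w (by simpa using hw) with h1 | h1
  · rw [h1, tsub_zero]; exact le_add_self
  · rw [h1, tsub_zero]; exact le_self_add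

lemma SB.osc {N : ℕ} {s a β : ℝ} {μ : Measure (Euc N)} {S : Set (Euc N)} {V : Euc N → ℝ≥0∞}
    (h : SB N s a β μ S V) {C₂ : ℝ} (hC₂ : 0 < C₂)
    (f2 : ∀ x w : Euc N, 2 * V x ≤ V (x - w) + V (x + w) + ENNReal.ofReal (C₂ * ‖w‖ ^ β)) :
    ∃ α C' : ℝ, 0 < α ∧ α ≤ 1 - s ∧ α ≤ β - 2 * s ∧ 0 < C' ∧ ∀ (x₀ : Euc N) (r A : ℝ), 0 < r → 0 < A →
      C' * r ^ (β - 2 * s) ≤ A →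
      (∀ y, Rf N s μ y ≤ ENNReal.ofReal (A * max 1 (‖y - x₀‖ / r) ^ α)) →
      (∃ y₁, ‖y₁ - x₀‖ = r / 2 ∧ ENNReal.ofReal (C₂ * (r / 2) ^ β) < 2 * V y₁) →
      ∀ y, Rf N s μ y ≤ ENNReal.ofReal ((A * 2 ^ (-α)) * max 1 (‖y - x₀‖ / (r / 2)) ^ α) := by
  have := h.prob
  have hs := h.hs
  have hs1 := h.hs1
  have hbs := h.bs
  have hb1 := h.b1
  have hRm := measurable_Rf s μ
  have hZ := Zc_pos h.hs h.hs1
  obtain ⟨K, hK, hgrow⟩ := Tk_growth N h.hs h.hs1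
  obtain ⟨c, hc, hlow⟩ := Tk_mw_lower (N := N) h.hs h.hs1.le (R := 4) (by norm_num)
  obtain ⟨C, hC, hRle⟩ := h.Rf_le
  set vB := (volume (Metric.ball (0 : Euc N) 1)).toReal with hvB
  have hvt : volume (Metric.ball (0 : Euc N) 1) ≠ ⊤ := measure_ball_lt_top.ne
  have hv0 : 0 < vB := ENNReal.toReal_pos (Metric.measure_ball_pos volume _ one_pos).ne' hvt
  set c1 := c * (1/2) ^ N * vB / 2 with hc1
  have hc10 : 0 < c1 := by positivity
  set α := min (min (1 - s) (β - 2 * s)) (min (c1 / (4 * K)) (c1 / (2 * Zc s))) with hα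
  have hα0 : 0 < α := by
    refine lt_min (lt_min (by linarith) (by linarith)) (lt_min (by positivity) (by positivity))
  have hα1 : α ≤ 1 - s := (min_le_left _ _).trans (min_le_left _ _)
  have hα2 : α ≤ β - 2 * s := (min_le_left _ _).trans (min_le_right _ _)
  have hα3 : α * K ≤ c1 / 4 := by
    have : α ≤ c1 / (4 * K) := (min_le_right _ _).trans (min_le_left _ _)
    rw [le_div_iff₀ (by positivity)] at this
    linarith
  have hα4 : α * Zc s ≤ c1 / 2 := by
    have : α ≤ c1 / (2 * Zc s) := (min_le_right _ _).trans (min_le_right _ _)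
    rw [le_div_iff₀ (by positivity)] at this
    linarith
  refine ⟨α, 4 * Zc s * C / c1, hα0, hα1, hα2, by positivity, fun x₀ r A hr hA hCA hgr hbad y => ?_⟩
  have h2α : 1 - α ≤ (2:ℝ) ^ (-α) := by
    rw [Real.rpow_def_of_pos (by norm_num)]
    have h1 := Real.add_one_le_exp (Real.log 2 * -α)
    have h2 : Real.log 2 ≤ 1 := by
      have := Real.log_le_sub_one_of_pos (show (0:ℝ) < 2 by norm_num)
      linarith
    nlinarith
  -- far points
  rcases le_or_gt (‖y - x₀‖) r with hy | hy
  swap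
  · refine (hgr y).trans (ENNReal.ofReal_le_ofReal ?_)
    have h1 : 1 ≤ ‖y - x₀‖ / r := by rw [le_div_iff₀ hr]; linarith
    have h2 : ‖y - x₀‖ / (r/2) = 2 * (‖y - x₀‖ / r) := by field_simp
    rw [max_eq_right h1, h2, max_eq_right (by linarith), Real.mul_rpow (by norm_num) (by positivity),
      show A * 2 ^ (-α) * (2 ^ α * (‖y - x₀‖ / r) ^ α) = A * (2 ^ (-α) * 2 ^ α) * (‖y - x₀‖ / r) ^ α by ring,
      ← Real.rpow_add (by norm_num)]
    simp
  -- near points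
  have hr2 : 0 < r ^ 2 := by positivity
  obtain ⟨y₁, hy₁, hV⟩ := hbad
  have hz : ∀ w : Euc N, ‖w‖ < r / 2 → Rf N s μ (y₁ - w) = 0 ∨ Rf N s μ (y₁ + w) = 0 := by
    intro w hw
    by_contra hcon
    push Not at hcon
    have m1 : y₁ - w ∈ S := by by_contra hS; exact hcon.1 (h.Rf_off hS)
    have m2 : y₁ + w ∈ S := by by_contra hS; exact hcon.2 (h.Rf_off hS)
    have := f2 y₁ w
    rw [h.V0 _ m1, h.V0 _ m2, zero_add, zero_add] at this
    have h3 := hV.trans_le this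
    have h4 : ENNReal.ofReal (C₂ * ‖w‖ ^ β) ≤ ENNReal.ofReal (C₂ * (r / 2) ^ β) := by
      apply ENNReal.ofReal_le_ofReal
      gcongr
    exact absurd h3 (not_lt.2 h4)
  have hhb := half_ball hRm y₁ (R := r / 2) (ENNReal.ofReal A) hz
  set B := Metric.ball y₁ (r / 2) with hB
  have hBm : MeasurableSet B := Metric.isOpen_ball.measurableSet
  have hBin : ∀ z ∈ B, ‖z - x₀‖ ≤ r := fun z hz => by
    have h1 : ‖z - y₁‖ < r / 2 := by rw [← dist_eq_norm]; exact hz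
    calc ‖z - x₀‖ = ‖(z - y₁) + (y₁ - x₀)‖ := by congr 1; abel
      _ ≤ ‖z - y₁‖ + ‖y₁ - x₀‖ := norm_add_le _ _
      _ ≤ r := by linarith
  have gain : ENNReal.ofReal (c1 * A) ≤ ∫⁻ z in B, Tk N (mw s (r ^ 2)) (y - z) * (ENNReal.ofReal A - Rf N s μ z) := by
    have g1 : ENNReal.ofReal (c * (r ^ 2) ^ (-(N:ℝ)/2)) * ∫⁻ z in B, (ENNReal.ofReal A - Rf N s μ z)
        ≤ ∫⁻ z in B, Tk N (mw s (r ^ 2)) (y - z) * (ENNReal.ofReal A - Rf N s μ z) := by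
      rw [← lintegral_const_mul' _ _ ENNReal.ofReal_ne_top]
      refine setLIntegral_mono' hBm fun z hz => ?_
      refine mul_le_mul_left (hlow (r ^ 2) hr2 _ ?_) _
      have : ‖y - z‖ ≤ 2 * r := by
        calc ‖y - z‖ = ‖(y - x₀) - (z - x₀)‖ := by congr 1; abel
          _ ≤ ‖y - x₀‖ + ‖z - x₀‖ := norm_sub_le _ _
          _ ≤ 2 * r := by linarith [hBin z hz]
      nlinarith [norm_nonneg (y - z)]
    refine le_trans ?_ g1
    have hvol : volume (Metric.ball (0 : Euc N) (r/2)) = ENNReal.ofReal ((r/2) ^ N * vB) := by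
      rw [Measure.addHaar_ball_of_pos _ _ (by positivity), ENNReal.ofReal_mul (by positivity), hvB, ENNReal.ofReal_toReal hvt]
      simp
    rw [hvol, ← ENNReal.ofReal_mul hA.le] at hhb
    have e : (r ^ 2) ^ (-(N:ℝ)/2) * r ^ N = 1 := by
      rw [← Real.rpow_natCast r 2, ← Real.rpow_mul hr.le, ← Real.rpow_natCast r N, ← Real.rpow_add hr]
      push_cast
      rw [show 2 * (-(N:ℝ)/2) + N = 0 by ring, Real.rpow_zero]
    have h2 : ENNReal.ofReal (A * ((r/2) ^ N * vB) / 2) ≤ ∫⁻ z in B, (ENNReal.ofReal A - Rf N s μ z) := by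
      rw [ENNReal.ofReal_div_of_pos (by norm_num)]
      refine ENNReal.div_le_of_le_mul' ?_
      simpa using hhb
    calc ENNReal.ofReal (c1 * A) = ENNReal.ofReal (c * (r ^ 2) ^ (-(N:ℝ)/2)) * ENNReal.ofReal (A * ((r/2) ^ N * vB) / 2) := by
          rw [← ENNReal.ofReal_mul (by positivity)]
          congr 1
          rw [show c * (r ^ 2) ^ (-(N:ℝ)/2) * (A * ((r/2) ^ N * vB) / 2)
            = c * (1/2) ^ N * vB / 2 * A * ((r ^ 2) ^ (-(N:ℝ)/2) * r ^ N) by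
              rw [div_eq_mul_one_div r 2, mul_pow]; ring, e, mul_one]
      _ ≤ _ := by gcongr
  have tot : ENNReal.ofReal (Zc s) * Tm N (mw s (r ^ 2)) μ y + ENNReal.ofReal (c1 * A) ≤ ENNReal.ofReal (A * (Zc s + α * K)) := by
    rw [h.Tm_Rf (measurable_mw s _)]
    have hTm : Measurable fun z => Tk N (mw s (r ^ 2)) (y - z) * Rf N s μ z :=
      ((measurable_Tk (measurable_mw s _)).comp (measurable_const.sub measurable_id)).mul hRm
    calc _ ≤ (∫⁻ z, Tk N (mw s (r ^ 2)) (y - z) * Rf N s μ z) + ∫⁻ z in B, Tk N (mw s (r ^ 2)) (y - z) * (ENNReal.ofReal A - Rf N s μ z) := by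
          gcongr
      _ = ∫⁻ z, (Tk N (mw s (r ^ 2)) (y - z) * Rf N s μ z + B.indicator (fun z => Tk N (mw s (r ^ 2)) (y - z) * (ENNReal.ofReal A - Rf N s μ z)) z) := by
          rw [lintegral_add_left hTm, lintegral_indicator hBm]
      _ ≤ ∫⁻ z, ENNReal.ofReal A * (Tk N (mw s ((1 * r) ^ 2)) (y - z) * ENNReal.ofReal ((1 + ‖y - z‖ / r + 1) ^ α)) := by
          refine lintegral_mono fun z => ?_
          rw [one_mul, mul_left_comm, ← ENNReal.ofReal_mul hA.le]
          have hbase : 1 ≤ 1 + ‖y - z‖ / r + 1 := by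
            have : 0 ≤ ‖y - z‖ / r := by positivity
            linarith
          by_cases hzB : z ∈ B
          · rw [indicator_of_mem hzB, ← mul_add]
            refine mul_le_mul_right ?_ _
            have h1 : Rf N s μ z ≤ ENNReal.ofReal A := by
              have := hgr z
              rwa [max_eq_left ((div_le_one hr).2 (hBin z hzB)), Real.one_rpow, mul_one] at this
            rw [add_tsub_cancel_of_le h1]
            apply ENNReal.ofReal_le_ofReal
            exact le_mul_of_one_le_right hA.le (Real.one_le_rpow hbase hα0.le)
          · rw [indicator_of_notMem hzB, add_zero]
            refine mul_le_mul_right ((hgr z).trans (ENNReal.ofReal_le_ofReal ?_)) _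
            have : max 1 (‖z - x₀‖ / r) ≤ 1 + ‖y - z‖ / r + 1 := by
              refine max_le hbase ?_
              have : ‖z - x₀‖ ≤ ‖y - z‖ + r := by
                calc ‖z - x₀‖ = ‖(y - x₀) - (y - z)‖ := by congr 1; abel
                  _ ≤ ‖y - x₀‖ + ‖y - z‖ := norm_sub_le _ _
                  _ ≤ _ := by linarith
              calc ‖z - x₀‖ / r ≤ (‖y - z‖ + r) / r := by gcongr
                _ = ‖y - z‖ / r + 1 := by field_simp
                _ ≤ _ := by linarith
            gcongr
      _ ≤ _ := by
          rw [lintegral_const_mul' _ _ ENNReal.ofReal_ne_top, ENNReal.ofReal_mul hA.le]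
          gcongr
          exact hgrow α hα0 hα1 r 1 hr one_pos (by norm_num) y
  have hRy := hRle (r ^ 2) hr2 y
  have e5 : (r ^ 2) ^ (β/2 - s) = r ^ (β - 2 * s) := by
    rw [← Real.rpow_natCast, ← Real.rpow_mul hr.le]; congr 1; push_cast; ring
  rw [e5] at hRy
  have fin : ENNReal.ofReal (Zc s) * Rf N s μ y + ENNReal.ofReal (c1 * A) ≤ ENNReal.ofReal (A * (Zc s + α * K) + Zc s * (C * r ^ (β - 2 * s))) := by
    rw [ENNReal.ofReal_add (by positivity) (by positivity)]
    calc _ ≤ ENNReal.ofReal (Zc s) * (Tm N (mw s (r ^ 2)) μ y + ENNReal.ofReal (C * r ^ (β - 2 * s))) + ENNReal.ofReal (c1 * A) := by gcongr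
      _ = (ENNReal.ofReal (Zc s) * Tm N (mw s (r ^ 2)) μ y + ENNReal.ofReal (c1 * A)) + ENNReal.ofReal (Zc s) * ENNReal.ofReal (C * r ^ (β - 2 * s)) := by ring
      _ ≤ _ := by rw [← ENNReal.ofReal_mul hZ.le]; gcongr
  have hRt : Rf N s μ y ≠ ⊤ := ((hgr y).trans_lt ENNReal.ofReal_lt_top).ne
  rw [← ENNReal.ofReal_toReal hRt] at fin ⊢
  set t := (Rf N s μ y).toReal with ht
  have ht0 : 0 ≤ t := ENNReal.toReal_nonneg
  rw [← ENNReal.ofReal_mul hZ.le, ← ENNReal.ofReal_add (by positivity) (by positivity), ENNReal.ofReal_le_ofReal_iff (by positivity)] at fin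
  apply ENNReal.ofReal_le_ofReal
  have hq : Zc s * (C * r ^ (β - 2 * s)) ≤ c1 / 4 * A := by
    rw [div_mul_eq_mul_div, div_le_iff₀ hc10] at hCA
    linarith
  have h6 : Zc s * t ≤ Zc s * (A * (1 - α)) := by nlinarith
  have h7 : t ≤ A * (1 - α) := le_of_mul_le_mul_left h6 hZ
  have h8 : 1 ≤ max 1 (‖y - x₀‖ / (r/2)) ^ α := Real.one_le_rpow (le_max_left _ _) hα0.le
  have h9 : 0 < A * 2 ^ (-α) := by positivity
  calc t ≤ A * (1 - α) := h7
    _ ≤ A * 2 ^ (-α) := by gcongr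
    _ ≤ _ := le_mul_of_one_le_right h9.le h8

lemma SB.Rf_b {N : ℕ} {s a β : ℝ} {μ : Measure (Euc N)} {S : Set (Euc N)} {V : Euc N → ℝ≥0∞}
    (h : SB N s a β μ S V) : ∃ K : ℝ, 0 < K ∧ ∀ x, Rf N s μ x ≤ ENNReal.ofReal K := by
  obtain ⟨C, hC, h1⟩ := h.Rf_le
  obtain ⟨K, hK, h2⟩ := h.Mb
  refine ⟨K + C, by positivity, fun x => (h1 1 one_pos x).trans ?_⟩
  rw [ENNReal.ofReal_add hK.le hC.le]
  simpa using add_le_add_left (h2 1 one_pos x) (ENNReal.ofReal C)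

lemma SB.Vfin {N : ℕ} {s a β : ℝ} {μ : Measure (Euc N)} {S : Set (Euc N)} {V : Euc N → ℝ≥0∞}
    (h : SB N s a β μ S V) (x : Euc N) : V x ≠ ⊤ := by
  obtain ⟨C, hC, h1⟩ := h.Vb
  exact ((h1 x).trans_lt ENNReal.ofReal_lt_top).ne

/-- doubling along a ray -/
lemma SB.dbl {N : ℕ} {s a β : ℝ} {μ : Measure (Euc N)} {S : Set (Euc N)} {V : Euc N → ℝ≥0∞}
    (h : SB N s a β μ S V) {C₂ : ℝ} (hC₂ : 0 < C₂)
    (f2 : ∀ x w : Euc N, 2 * V x ≤ V (x - w) + V (x + w) + ENNReal.ofReal (C₂ * ‖w‖ ^ β)) :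
    ∃ K : ℝ, 0 < K ∧ ∀ x₀ ∈ S, ∀ w : Euc N, ∀ j : ℕ,
      2 ^ j * (V (x₀ + w)).toReal ≤ (V (x₀ + (2:ℝ) ^ j • w)).toReal + K * ((2:ℝ) ^ j * ‖w‖) ^ β := by
  have hb1 := h.b1
  have h2b : (2:ℝ) < 2 ^ β := by
    calc (2:ℝ) = 2 ^ (1:ℝ) := by simp
      _ < 2 ^ β := Real.rpow_lt_rpow_of_exponent_lt (by norm_num) hb1
  set K := C₂ / (2 ^ β - 2) with hK
  have hKe : C₂ + 2 * K = 2 ^ β * K := by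
    have : (2:ℝ) ^ β - 2 ≠ 0 := by linarith
    rw [hK]; field_simp; ring
  have hK0 : 0 < K := div_pos hC₂ (by linarith)
  refine ⟨K, hK0, fun x₀ hx₀ w j => ?_⟩
  have step : ∀ j : ℕ, 2 * (V (x₀ + (2:ℝ) ^ j • w)).toReal ≤ (V (x₀ + (2:ℝ) ^ (j+1) • w)).toReal + C₂ * ((2:ℝ) ^ j * ‖w‖) ^ β := by
    intro j
    have := f2 (x₀ + (2:ℝ) ^ j • w) ((2:ℝ) ^ j • w)
    rw [add_sub_cancel_right, h.V0 _ hx₀, zero_add, add_assoc, ← add_smul, ← two_mul, ← pow_succ', norm_smul, norm_pow, Real.norm_ofNat] at this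
    rw [← ENNReal.ofReal_toReal (h.Vfin (x₀ + (2:ℝ) ^ j • w)), ← ENNReal.ofReal_toReal (h.Vfin (x₀ + (2:ℝ) ^ (j+1) • w)),
      ← ENNReal.ofReal_add ENNReal.toReal_nonneg (by positivity)] at this
    rw [← ofReal_two_mul, ENNReal.ofReal_le_ofReal_iff (by positivity)] at this
    exact this
  have main : 2 ^ j * ((V (x₀ + w)).toReal + K * ‖w‖ ^ β) ≤ (V (x₀ + (2:ℝ) ^ j • w)).toReal + K * ((2:ℝ) ^ j * ‖w‖) ^ β := by
    induction j with
    | zero => simp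
    | succ j ih =>
      have e : ((2:ℝ) ^ (j+1) * ‖w‖) ^ β = 2 ^ β * ((2:ℝ) ^ j * ‖w‖) ^ β := by
        rw [pow_succ', mul_assoc, Real.mul_rpow (by norm_num) (by positivity)]
      have hst := step j
      calc 2 ^ (j+1) * ((V (x₀ + w)).toReal + K * ‖w‖ ^ β) = 2 * (2 ^ j * ((V (x₀ + w)).toReal + K * ‖w‖ ^ β)) := by ring
        _ ≤ 2 * ((V (x₀ + (2:ℝ) ^ j • w)).toReal + K * ((2:ℝ) ^ j * ‖w‖) ^ β) := by gcongr
        _ ≤ (V (x₀ + (2:ℝ) ^ (j+1) • w)).toReal + (C₂ + 2 * K) * ((2:ℝ) ^ j * ‖w‖) ^ β := by linarith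
        _ = _ := by rw [hKe, e]; ring
  refine le_trans ?_ main
  gcongr
  have : 0 ≤ K * ‖w‖ ^ β := by positivity
  linarith

lemma SB.osc_iter {N : ℕ} {s a β : ℝ} {μ : Measure (Euc N)} {S : Set (Euc N)} {V : Euc N → ℝ≥0∞}
    (h : SB N s a β μ S V) {C₂ : ℝ} (hC₂ : 0 < C₂)
    (f2 : ∀ x w : Euc N, 2 * V x ≤ V (x - w) + V (x + w) + ENNReal.ofReal (C₂ * ‖w‖ ^ β)) :
    ∃ α A : ℝ, 0 < α ∧ α ≤ 1 - s ∧ 0 < A ∧ ∀ (x₀ : Euc N) (T : ℝ), 0 < T → T ≤ 1 → ∀ n : ℕ,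
      (∀ i < n, ∃ y₁, ‖y₁ - x₀‖ = T * (1/2) ^ i / 2 ∧ ENNReal.ofReal (C₂ * (T * (1/2) ^ i / 2) ^ β) < 2 * V y₁) →
      ∀ y, Rf N s μ y ≤ ENNReal.ofReal (A * ((2:ℝ) ^ (-α)) ^ n * max 1 (‖y - x₀‖ / (T * (1/2) ^ n)) ^ α) := by
  have hbs := h.bs
  obtain ⟨α, C', hα, hα1, hα2, hC', hosc⟩ := h.osc hC₂ f2
  obtain ⟨K, hK, hRb⟩ := h.Rf_b
  refine ⟨α, K + C', hα, hα1, by positivity, fun x₀ T hT hT1 n => ?_⟩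
  induction n with
  | zero =>
    intro _ y
    refine (hRb y).trans (ENNReal.ofReal_le_ofReal ?_)
    have h8 : 1 ≤ max 1 (‖y - x₀‖ / (T * (1/2) ^ 0)) ^ α := Real.one_le_rpow (le_max_left _ _) hα.le
    rw [pow_zero, mul_one]
    calc K ≤ K + C' := by linarith
      _ ≤ _ := le_mul_of_one_le_right (by positivity) h8
  | succ n ih =>
    intro hbad y
    have h1 := ih fun i hi => hbad i (by omega)
    have h2 := hosc x₀ (T * (1/2) ^ n) ((K + C') * ((2:ℝ) ^ (-α)) ^ n) (by positivity) (by positivity) ?_ h1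
      (hbad n (by omega)) y
    · refine h2.trans (le_of_eq ?_)
      have q1 : T * (1/2:ℝ) ^ n / 2 = T * (1/2) ^ (n+1) := by ring
      have q2 : (K + C') * ((2:ℝ) ^ (-α)) ^ n * 2 ^ (-α) = (K + C') * ((2:ℝ) ^ (-α)) ^ (n+1) := by ring
      rw [← q1, ← q2]
      try ring_nf
    · have e1 : (T * (1/2) ^ n) ^ (β - 2 * s) ≤ ((2:ℝ) ^ (-α)) ^ n := by
        calc (T * (1/2) ^ n) ^ (β - 2 * s) ≤ ((1/2:ℝ) ^ n) ^ (β - 2 * s) := by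
              have : T * (1/2) ^ n ≤ (1/2) ^ n := mul_le_of_le_one_left (by positivity) hT1
              have : 0 ≤ β - 2 * s := by linarith
              gcongr
          _ ≤ ((1/2:ℝ) ^ n) ^ α := Real.rpow_le_rpow_of_exponent_ge (by positivity) (pow_le_one₀ (by norm_num) (by norm_num)) hα2
          _ = _ := by
              rw [← Real.rpow_natCast, ← Real.rpow_mul (by norm_num), mul_comm, Real.rpow_mul (by norm_num), Real.rpow_natCast]
              congr 1
              rw [one_div, Real.inv_rpow (by norm_num), Real.rpow_neg (by norm_num)]
      have : 0 ≤ ((2:ℝ) ^ (-α)) ^ n := by positivity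
      calc C' * (T * (1/2) ^ n) ^ (β - 2 * s) ≤ C' * ((2:ℝ) ^ (-α)) ^ n := by gcongr
        _ ≤ _ := by nlinarith

lemma SB.growth {N : ℕ} {s a β : ℝ} {μ : Measure (Euc N)} {S : Set (Euc N)} {V : Euc N → ℝ≥0∞}
    (h : SB N s a β μ S V) : ∃ e C : ℝ, 2 * s < e ∧ e ≤ 2 * s + 1 ∧ e ≤ β ∧ 0 < C ∧ ∀ x₀ ∈ S, ∀ w : Euc N, ‖w‖ ≤ 1/2 →
      V (x₀ + w) ≤ ENNReal.ofReal (C * ‖w‖ ^ e) := by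
  have hs := h.hs
  have hs1 := h.hs1
  have hbs := h.bs
  have hb1 := h.b1
  have hb2 := h.b2
  have hZ := Zc_pos h.hs h.hs1
  obtain ⟨C₂, hC₂, f2⟩ := h.f2
  obtain ⟨K, hK, hdbl⟩ := h.dbl hC₂ f2
  obtain ⟨α, A, hα, hα1, hA, hit⟩ := h.osc_iter hC₂ f2
  obtain ⟨CB, hCB, hB4⟩ := h.B4
  obtain ⟨K₁, hK₁, hgrow⟩ := Tk_growth N h.hs h.hs1
  set κ := β/2 - s with hκ
  have hκ0 : 0 < κ := by linarith
  have hκ1 : κ ≤ 1 := by linarith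
  have hακ : κ * α ≤ κ := mul_le_of_le_one_right hκ0.le (by linarith)
  have hακ0 : 0 < κ * α := by positivity
  set K₃ := (Zc s + α * K₁) / Zc s with hK₃
  have hK₃0 : 0 < K₃ := by positivity
  refine ⟨2 * s + κ * α, CB * (2 * A * K₃ + 1) + (C₂ + K), by linarith, by linarith, by linarith, by positivity, fun x₀ hx₀ w hw => ?_⟩
  rcases eq_or_lt_of_le (norm_nonneg w) with hw0 | hw0
  · have : w = 0 := norm_eq_zero.1 hw0.symm
    rw [this, add_zero, h.V0 _ hx₀]; exact zero_le
  set r := ‖w‖ with hr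
  have hr1 : r ≤ 1 := by linarith
  obtain ⟨n, hn1, hn2⟩ := exists_nat_pow_near (x := r ^ (-κ)) (y := (2:ℝ))
    (Real.one_le_rpow_of_pos_of_le_one_of_nonpos hw0 hr1 (by linarith)) (by norm_num)
  have hrk : r ^ (-κ) * r ^ κ = 1 := by rw [← Real.rpow_add hw0]; simp
  have hrk0 : 0 < r ^ κ := by positivity
  by_cases hgood : ∃ j < n, 2 * V (x₀ + (2:ℝ) ^ j • w) ≤ ENNReal.ofReal (C₂ * ((2:ℝ) ^ j * r) ^ β)
  · obtain ⟨j, hj, hg⟩ := hgood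
    rw [← ENNReal.ofReal_toReal (h.Vfin (x₀ + w))]
    apply ENNReal.ofReal_le_ofReal
    have hd := hdbl x₀ hx₀ w j
    rw [← hr] at hd
    set v := (V (x₀ + w)).toReal with hv
    have hg' : (V (x₀ + (2:ℝ) ^ j • w)).toReal ≤ C₂ * ((2:ℝ) ^ j * r) ^ β := by
      apply ENNReal.toReal_le_of_le_ofReal (by positivity)
      refine le_trans ?_ hg
      rw [two_mul]; exact le_self_add
    have h2j : (0:ℝ) < 2 ^ j := by positivity
    have h2jn : (2:ℝ) ^ j ≤ r ^ (-κ) := (pow_le_pow_right₀ (by norm_num) hj.le).trans hn1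
    have e1 : ((2:ℝ) ^ j * r) ^ β = 2 ^ j * (((2:ℝ) ^ j) ^ (β - 1) * r ^ β) := by
      rw [Real.mul_rpow h2j.le hw0.le]
      nth_rw 1 [show β = 1 + (β - 1) by ring]
      rw [Real.rpow_add h2j, Real.rpow_one]; ring
    have e2 : ((2:ℝ) ^ j) ^ (β - 1) ≤ r ^ (-κ) := by
      calc ((2:ℝ) ^ j) ^ (β - 1) ≤ ((2:ℝ) ^ j) ^ (1:ℝ) :=
            Real.rpow_le_rpow_of_exponent_le (one_le_pow₀ (by norm_num)) (by linarith)
        _ ≤ _ := by rw [Real.rpow_one]; exact h2jn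
    have e3 : v ≤ (C₂ + K) * (((2:ℝ) ^ j) ^ (β - 1) * r ^ β) := by
      refine le_of_mul_le_mul_left ?_ h2j
      calc 2 ^ j * v ≤ (C₂ + K) * ((2:ℝ) ^ j * r) ^ β := by linarith
        _ = _ := by rw [e1]; ring
    calc v ≤ (C₂ + K) * (((2:ℝ) ^ j) ^ (β - 1) * r ^ β) := e3
      _ ≤ (C₂ + K) * (r ^ (-κ) * r ^ β) := by gcongr
      _ = (C₂ + K) * r ^ (2 * s + κ) := by rw [← Real.rpow_add hw0]; congr 2; rw [hκ]; ring
      _ ≤ (C₂ + K) * r ^ (2 * s + κ * α) := by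
          gcongr ?_ * ?_
          exact Real.rpow_le_rpow_of_exponent_ge hw0 hr1 (by linarith)
      _ ≤ _ := by
          refine mul_le_mul_of_nonneg_right ?_ (by positivity)
          have : 0 < CB * (2 * A * K₃ + 1) := by positivity
          linarith
  · push Not at hgood
    have hT1 : (2:ℝ) ^ n * r ≤ 1 := by
      calc (2:ℝ) ^ n * r ≤ r ^ (-κ) * r ^ κ := by
            gcongr
            calc r = r ^ (1:ℝ) := by simp
              _ ≤ r ^ κ := Real.rpow_le_rpow_of_exponent_ge hw0 hr1 hκ1
        _ = 1 := hrk
    have h12 : ∀ m : ℕ, (2:ℝ) ^ m * (1/2) ^ m = 1 := fun m => by rw [← mul_pow]; norm_num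
    have hI := hit x₀ ((2:ℝ) ^ n * r) (by positivity) hT1 n fun i hi => by
      refine ⟨x₀ + (2:ℝ) ^ (n - 1 - i) • w, ?_, ?_⟩
      · rw [add_sub_cancel_left, norm_smul, norm_pow, Real.norm_ofNat, ← hr]
        have : n = (n - 1 - i) + i + 1 := by omega
        rw [show (2:ℝ) ^ n = 2 ^ (n - 1 - i) * 2 ^ i * 2 by rw [← pow_add, ← pow_succ]; congr 1]
        linear_combination (-(2:ℝ) ^ (n - 1 - i) * r) * h12 i
      · have hb := hgood (n - 1 - i) (by omega)
        convert hb using 4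
        rw [show (2:ℝ) ^ n = 2 ^ (n - 1 - i) * 2 ^ i * 2 by rw [← pow_add, ← pow_succ]; congr 1; omega]
        linear_combination ((2:ℝ) ^ (n - 1 - i) * r) * h12 i
    have eT : (2:ℝ) ^ n * r * (1/2) ^ n = r := by linear_combination r * h12 n
    rw [eT] at hI
    set An := A * ((2:ℝ) ^ (-α)) ^ n with hAn
    have hAn0 : 0 < An := by positivity
    have hM : Tm N (mw s (4 * r ^ 2)) μ x₀ ≤ ENNReal.ofReal (An * K₃) := by
      have h1 : ENNReal.ofReal (Zc s) * Tm N (mw s (4 * r ^ 2)) μ x₀ ≤ ENNReal.ofReal (Zc s) * ENNReal.ofReal (An * K₃) := by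
        rw [h.Tm_Rf (measurable_mw s _), show 4 * r ^ 2 = (2 * r) ^ 2 by ring]
        calc ∫⁻ y, Tk N (mw s ((2 * r) ^ 2)) (x₀ - y) * Rf N s μ y
            ≤ ∫⁻ y, ENNReal.ofReal An * (Tk N (mw s ((2 * r) ^ 2)) (x₀ - y) * ENNReal.ofReal ((1 + ‖x₀ - y‖ / r + 1) ^ α)) := by
              refine lintegral_mono fun y => ?_
              rw [mul_left_comm, ← ENNReal.ofReal_mul hAn0.le]
              refine mul_le_mul_right ((hI y).trans (ENNReal.ofReal_le_ofReal ?_)) _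
              have : 0 ≤ ‖x₀ - y‖ / r := by positivity
              have h3 : max 1 (‖y - x₀‖ / r) ≤ 1 + ‖x₀ - y‖ / r + 1 := by
                rw [norm_sub_rev]
                exact max_le (by linarith) (by linarith)
              gcongr
          _ ≤ ENNReal.ofReal An * ENNReal.ofReal (Zc s + α * K₁) := by
              rw [lintegral_const_mul' _ _ ENNReal.ofReal_ne_top]
              gcongr
              exact hgrow α hα hα1 r 2 hw0 (by norm_num) le_rfl x₀
          _ = _ := by
              rw [← ENNReal.ofReal_mul hAn0.le, ← ENNReal.ofReal_mul hZ.le]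
              congr 1
              rw [hK₃]; field_simp
      rwa [ENNReal.mul_le_mul_iff_right (by simpa using hZ) ENNReal.ofReal_ne_top] at h1
    have hAn2 : An ≤ 2 * A * r ^ (κ * α) := by
      have h1 : ((1/2:ℝ) ^ n) ≤ 2 * r ^ κ := by
        have h3 : 1 ≤ (2:ℝ) ^ (n+1) * r ^ κ := by
          rw [← hrk]; gcongr
        calc (1/2:ℝ) ^ n ≤ (1/2) ^ n * ((2:ℝ) ^ (n+1) * r ^ κ) := le_mul_of_one_le_right (by positivity) h3
          _ = _ := by rw [pow_succ]; linear_combination (2 * r ^ κ) * h12 n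
      have h2 : ((2:ℝ) ^ (-α)) ^ n = ((1/2:ℝ) ^ n) ^ α := by
        rw [← Real.rpow_natCast (1/2:ℝ), ← Real.rpow_mul (by norm_num), mul_comm (n:ℝ), Real.rpow_mul (by norm_num), Real.rpow_natCast]
        congr 1
        rw [one_div, Real.inv_rpow (by norm_num), Real.rpow_neg (by norm_num)]
      have h4 : (2:ℝ) ^ α ≤ 2 := by
        calc (2:ℝ) ^ α ≤ 2 ^ (1:ℝ) := Real.rpow_le_rpow_of_exponent_le (by norm_num) (by linarith)
          _ = 2 := by norm_num
      calc An = A * ((1/2:ℝ) ^ n) ^ α := by rw [hAn, h2]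
        _ ≤ A * (2 * r ^ κ) ^ α := by gcongr
        _ = A * 2 ^ α * r ^ (κ * α) := by
            rw [Real.mul_rpow (by norm_num) hrk0.le, ← Real.rpow_mul hw0.le]; ring
        _ ≤ A * 2 * r ^ (κ * α) := by gcongr
        _ = _ := by ring
    refine (hB4 x₀ hx₀ w hw0 hw).trans ?_
    rw [← hr]
    calc _ ≤ ENNReal.ofReal (CB * r ^ (2 * s)) * (ENNReal.ofReal (An * K₃) + ENNReal.ofReal (r ^ (β - 2 * s))) := by gcongr
      _ = ENNReal.ofReal (CB * r ^ (2 * s) * (An * K₃ + r ^ (β - 2 * s))) := by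
          rw [← ENNReal.ofReal_add (by positivity) (by positivity), ← ENNReal.ofReal_mul (by positivity)]
      _ ≤ _ := by
          apply ENNReal.ofReal_le_ofReal
          have h5 : r ^ (β - 2 * s) ≤ r ^ (κ * α) := Real.rpow_le_rpow_of_exponent_ge hw0 hr1 (by linarith)
          calc CB * r ^ (2 * s) * (An * K₃ + r ^ (β - 2 * s))
              ≤ CB * r ^ (2 * s) * ((2 * A * r ^ (κ * α)) * K₃ + r ^ (κ * α)) := by gcongr
            _ = (CB * (2 * A * K₃ + 1)) * r ^ (2 * s + κ * α) := by rw [Real.rpow_add hw0]; ring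
            _ ≤ _ := by
              refine mul_le_mul_of_nonneg_right ?_ (by positivity)
              linarith

lemma SB.gg {N : ℕ} {s a β : ℝ} {μ : Measure (Euc N)} {S : Set (Euc N)} {V : Euc N → ℝ≥0∞}
    (h : SB N s a β μ S V) : ∃ e C : ℝ, 2 * s < e ∧ e ≤ 2 * s + 1 ∧ e ≤ β ∧ 0 < C ∧ ∀ x₀ ∈ S, ∀ w : Euc N,
      V (x₀ + w) ≤ ENNReal.ofReal (C * (‖w‖ ^ e + ‖w‖ ^ (e + a))) := by
  have hs := h.hs
  have ha := h.ha
  obtain ⟨e, C, he1, he2, he3, hC, hg⟩ := h.growth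
  obtain ⟨B, hB, hVb⟩ := h.Vb
  obtain ⟨R, hR⟩ := h.cpt.isBounded.exists_norm_le
  have he0 : 0 < e := by linarith
  set R' := max R 0 with hR'
  have hR0 : 0 ≤ R' := le_max_right _ _
  set D := B * (1 + 2 ^ a * R' ^ a + 2 ^ a) * 2 ^ e with hD
  refine ⟨e, C + D, he1, he2, he3, by positivity, fun x₀ hx₀ w => ?_⟩
  have hD0 : 0 ≤ D := by positivity
  rcases le_total ‖w‖ (1/2) with hw | hw
  · refine (hg x₀ hx₀ w hw).trans (ENNReal.ofReal_le_ofReal ?_)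
    have h1 : 0 ≤ ‖w‖ ^ e := by positivity
    have h2 : 0 ≤ ‖w‖ ^ (e + a) := by positivity
    calc C * ‖w‖ ^ e ≤ (C + D) * ‖w‖ ^ e := by gcongr; linarith
      _ ≤ _ := by gcongr; linarith
  · refine (hVb (x₀ + w)).trans (ENNReal.ofReal_le_ofReal ?_)
    have hw0 : 0 < ‖w‖ := by linarith
    have h1 : ‖x₀ + w‖ ^ a ≤ 2 ^ a * (R' ^ a + ‖w‖ ^ a) := by
      calc ‖x₀ + w‖ ^ a ≤ (R' + ‖w‖) ^ a := by
            have : ‖x₀ + w‖ ≤ R' + ‖w‖ := (norm_add_le _ _).trans (by gcongr; exact (hR x₀ hx₀).trans (le_max_left _ _))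
            gcongr
        _ ≤ _ := rpow_add_le' hR0 (norm_nonneg _) ha.le
    have h2 : 1 ≤ 2 ^ e * ‖w‖ ^ e := by
      rw [← Real.mul_rpow (by norm_num) hw0.le]
      exact Real.one_le_rpow (by linarith) he0.le
    have h3 : ‖w‖ ^ a ≤ 2 ^ e * ‖w‖ ^ (e + a) := by
      rw [Real.rpow_add hw0, ← mul_assoc]
      exact le_mul_of_one_le_left (by positivity) h2
    have h4 : 0 ≤ ‖w‖ ^ e := by positivity
    have h5 : 0 ≤ ‖w‖ ^ (e + a) := by positivity
    have h6 : (0:ℝ) ≤ 2 ^ a * R' ^ a := by positivity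
    have h7 : (0:ℝ) < 2 ^ a := by positivity
    have h8 : (0:ℝ) < 2 ^ e := by positivity
    calc B * (1 + ‖x₀ + w‖ ^ a) ≤ B * ((1 + 2 ^ a * R' ^ a) * 1 + 2 ^ a * ‖w‖ ^ a) := by
          refine mul_le_mul_of_nonneg_left ?_ hB.le
          linarith
      _ ≤ B * ((1 + 2 ^ a * R' ^ a) * (2 ^ e * ‖w‖ ^ e) + 2 ^ a * (2 ^ e * ‖w‖ ^ (e + a))) := by gcongr
      _ ≤ B * ((1 + 2 ^ a * R' ^ a + 2 ^ a) * (2 ^ e * ‖w‖ ^ e) + (1 + 2 ^ a * R' ^ a + 2 ^ a) * (2 ^ e * ‖w‖ ^ (e + a))) := by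
          refine mul_le_mul_of_nonneg_left (add_le_add (mul_le_mul_of_nonneg_right ?_ (by positivity))
            (mul_le_mul_of_nonneg_right ?_ (by positivity))) hB.le
          · linarith
          · linarith
      _ = D * (‖w‖ ^ e + ‖w‖ ^ (e + a)) := by rw [hD]; ring
      _ ≤ _ := by gcongr; linarith

lemma SB.heatV {N : ℕ} {s a β : ℝ} {μ : Measure (Euc N)} {S : Set (Euc N)} {V : Euc N → ℝ≥0∞}
    (h : SB N s a β μ S V) : ∃ e C : ℝ, 2 * s < e ∧ e ≤ 2 * s + 1 ∧ e ≤ β ∧ 0 < C ∧ ∀ x₀ ∈ S, ∀ x : Euc N, ‖x - x₀‖ ≤ 1 →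
      ∀ t : ℝ, 0 < t → t ≤ 1 → heat N t V x ≤ ENNReal.ofReal (C * (t ^ (e/2) + ‖x - x₀‖ ^ e)) := by
  have hs := h.hs
  have ha := h.ha
  obtain ⟨e, C, he1, he2, he3, hC, hg⟩ := h.gg
  have he0 : 0 < e := by linarith
  have hea : 0 < e + a := by linarith
  obtain ⟨C1, hC1, hm1⟩ := gam_mom_bd N he0.le
  obtain ⟨C2, hC2, hm2⟩ := gam_mom_bd N hea.le
  refine ⟨e, C * 2 ^ (e + a) * (2 + C1 + C2), he1, he2, he3, by positivity, fun x₀ hx₀ x hx t ht ht1 => ?_⟩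
  have := gam_prob N ht
  set d := ‖x - x₀‖ with hd
  have hd0 : 0 ≤ d := norm_nonneg _
  have hpt : ∀ z : Euc N, V (x - z) ≤ ENNReal.ofReal (C * 2 ^ (e + a)) *
      (ENNReal.ofReal (2 * d ^ e) + (ENNReal.ofReal (‖z‖ ^ e) + ENNReal.ofReal (‖z‖ ^ (e + a)))) := by
    intro z
    have := hg x₀ hx₀ (x - x₀ - z)
    rw [show x₀ + (x - x₀ - z) = x - z by abel] at this
    refine this.trans ?_
    rw [← ENNReal.ofReal_add (by positivity) (by positivity), ← ENNReal.ofReal_add (by positivity) (by positivity),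
      ← ENNReal.ofReal_mul (by positivity)]
    apply ENNReal.ofReal_le_ofReal
    have hn : ‖x - x₀ - z‖ ≤ d + ‖z‖ := norm_sub_le _ _
    have h1 : ‖x - x₀ - z‖ ^ e ≤ 2 ^ (e + a) * (d ^ e + ‖z‖ ^ e) := by
      calc ‖x - x₀ - z‖ ^ e ≤ (d + ‖z‖) ^ e := by gcongr
        _ ≤ 2 ^ e * (d ^ e + ‖z‖ ^ e) := rpow_add_le' hd0 (norm_nonneg _) he0.le
        _ ≤ _ := by gcongr; norm_num; linarith
    have h2 : ‖x - x₀ - z‖ ^ (e + a) ≤ 2 ^ (e + a) * (d ^ e + ‖z‖ ^ (e + a)) := by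
      calc ‖x - x₀ - z‖ ^ (e + a) ≤ (d + ‖z‖) ^ (e + a) := by gcongr
        _ ≤ 2 ^ (e + a) * (d ^ (e + a) + ‖z‖ ^ (e + a)) := rpow_add_le' hd0 (norm_nonneg _) hea.le
        _ ≤ _ := by
          refine mul_le_mul_of_nonneg_left (add_le_add ?_ le_rfl) (by positivity)
          exact Real.rpow_le_rpow_of_exponent_ge' hd0 hx he0.le (by linarith)
    calc _ ≤ C * (2 ^ (e + a) * (d ^ e + ‖z‖ ^ e) + 2 ^ (e + a) * (d ^ e + ‖z‖ ^ (e + a))) := by gcongr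
      _ = _ := by ring
  have ma : Measurable fun z : Euc N => ENNReal.ofReal (‖z‖ ^ e) := by fun_prop
  have hte : t ^ ((e + a)/2) ≤ t ^ (e/2) := Real.rpow_le_rpow_of_exponent_ge ht ht1 (by linarith)
  calc heat N t V x ≤ ∫⁻ z, ENNReal.ofReal (C * 2 ^ (e + a)) *
      (ENNReal.ofReal (2 * d ^ e) + (ENNReal.ofReal (‖z‖ ^ e) + ENNReal.ofReal (‖z‖ ^ (e + a)))) ∂(gam N t) :=
        lintegral_mono hpt
    _ = ENNReal.ofReal (C * 2 ^ (e + a)) * (ENNReal.ofReal (2 * d ^ e) + ((∫⁻ z, ENNReal.ofReal (‖z‖ ^ e) ∂(gam N t)) +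
          ∫⁻ z, ENNReal.ofReal (‖z‖ ^ (e + a)) ∂(gam N t))) := by
        rw [lintegral_const_mul' _ _ ENNReal.ofReal_ne_top, lintegral_add_left measurable_const, lintegral_add_left ma]
        simp
    _ ≤ ENNReal.ofReal (C * 2 ^ (e + a)) * (ENNReal.ofReal (2 * d ^ e) + (ENNReal.ofReal (C1 * t ^ (e/2)) +
          ENNReal.ofReal (C2 * t ^ ((e + a)/2)))) := by
        gcongr
        · exact hm1 t ht
        · exact hm2 t ht
    _ = ENNReal.ofReal (C * 2 ^ (e + a) * (2 * d ^ e + (C1 * t ^ (e/2) + C2 * t ^ ((e + a)/2)))) := by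
        rw [← ENNReal.ofReal_add (by positivity) (by positivity), ← ENNReal.ofReal_add (by positivity) (by positivity),
          ← ENNReal.ofReal_mul (by positivity)]
    _ ≤ _ := by
        apply ENNReal.ofReal_le_ofReal
        rw [mul_assoc (C * 2 ^ (e + a))]
        refine mul_le_mul_of_nonneg_left ?_ (by positivity)
        have h1 : 0 ≤ t ^ (e/2) := by positivity
        have h2 : 0 ≤ d ^ e := by positivity
        have h3 : C2 * t ^ ((e + a)/2) ≤ C2 * t ^ (e/2) := by gcongr
        nlinarith [mul_nonneg hC1.le h2, mul_nonneg hC2.le h2]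

lemma SB.lower {N : ℕ} {s a β : ℝ} {μ : Measure (Euc N)} {S : Set (Euc N)} {V : Euc N → ℝ≥0∞}
    (h : SB N s a β μ S V) : ∃ e C : ℝ, 2 * s < e ∧ e ≤ 2 * s + 1 ∧ e ≤ β ∧ 0 < C ∧ ∀ x₀ ∈ S, ∀ x : Euc N, ‖x - x₀‖ ≤ 1 →
      ∀ ε H : ℝ, 0 < ε → ε ≤ H → H ≤ 1 →
      Tm N (mw s H) μ x ≤ Tm N (mw s ε) μ x + ENNReal.ofReal (C * (H ^ (e/2 - s) + ‖x - x₀‖ ^ e * ε ^ (-s))) := by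
  have hs := h.hs
  have := h.prob
  obtain ⟨e, C, he1, he2, he3, hC, hg⟩ := h.heatV
  obtain ⟨C4, hC4, hf4⟩ := h.f4
  obtain ⟨Cu, hCu, hub⟩ := h.ub
  set K := C + C4 with hK
  have hK0 : 0 < K := by positivity
  have hes : 0 < e/2 - s := by linarith
  refine ⟨e, K * (s / (e/2 - s) + 1), he1, he2, he3, by positivity, fun x₀ hx₀ x hx ε H hε hεH hH => ?_⟩
  set d := ‖x - x₀‖ with hd
  have hd0 : 0 ≤ d := norm_nonneg _
  have hH0 : 0 < H := hε.trans_le hεH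
  have m1 : Measurable fun t : ℝ => ENNReal.ofReal (K * t ^ (e/2)) + ENNReal.ofReal (K * d ^ e) := by fun_prop
  have hid := ID_ge hs hε hεH μ x ((hub x).trans_lt ENNReal.ofReal_lt_top) (fun _ => 0)
    (fun t => ENNReal.ofReal (K * t ^ (e/2)) + ENNReal.ofReal (K * d ^ e)) measurable_const m1 (by
      intro t ht
      have ht0 : 0 < t := hε.trans ht.1
      have ht1 : t ≤ 1 := ht.2.le.trans hH
      have hd1 : 0 ≤ d ^ e := by positivity
      rw [add_zero]
      refine (hf4 t ht0 x).trans ?_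
      rw [add_assoc]
      refine add_le_add le_rfl ?_
      calc _ ≤ ENNReal.ofReal (C * (t ^ (e/2) + d ^ e)) + ENNReal.ofReal (C4 * t ^ (e/2)) := by
            have h1 : t ^ (β/2) ≤ t ^ (e/2) := Real.rpow_le_rpow_of_exponent_ge ht0 ht1 (by linarith)
            exact add_le_add (hg x₀ hx₀ x hx t ht0 ht1) (ENNReal.ofReal_le_ofReal (by gcongr))
        _ = ENNReal.ofReal (C * (t ^ (e/2) + d ^ e) + C4 * t ^ (e/2)) := (ENNReal.ofReal_add (by positivity) (by positivity)).symm
        _ ≤ ENNReal.ofReal (K * t ^ (e/2) + K * d ^ e) := by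
            apply ENNReal.ofReal_le_ofReal
            rw [hK]; nlinarith [mul_nonneg hC4.le hd1]
        _ = _ := ENNReal.ofReal_add (by positivity) (by positivity))
  simp only [mul_zero, lintegral_zero, add_zero, mul_add] at hid
  have m2 : Measurable fun t : ℝ => ENNReal.ofReal (s * t ^ (-1 - s)) * ENNReal.ofReal (K * t ^ (e/2)) := by fun_prop
  have m3 : Measurable fun t : ℝ => ENNReal.ofReal (s * t ^ (-1 - s)) := by fun_prop
  rw [lintegral_add_left m2, lintegral_mul_const _ m3, weight_integral0 hs hε hεH] at hid
  refine hid.trans ?_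
  gcongr
  calc _ ≤ ENNReal.ofReal (s * K / (e/2 - s) * H ^ (e/2 - s)) + ENNReal.ofReal (ε ^ (-s)) * ENNReal.ofReal (K * d ^ e) := by
        gcongr
        · exact wint_pos hs hK0.le (by linarith) hε hεH
        · have : 0 ≤ H ^ (-s) := by positivity
          linarith
    _ = ENNReal.ofReal (s * K / (e/2 - s) * H ^ (e/2 - s) + ε ^ (-s) * (K * d ^ e)) := by
        rw [← ENNReal.ofReal_mul (by positivity), ← ENNReal.ofReal_add (by positivity) (by positivity)]
    _ ≤ _ := by
        apply ENNReal.ofReal_le_ofReal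
        have h1 : 0 ≤ K * H ^ (e/2 - s) := by positivity
        have h2 : 0 ≤ K * (s / (e/2 - s)) * (d ^ e * ε ^ (-s)) := by positivity
        have : s * K / (e/2 - s) = K * (s / (e/2 - s)) := by ring
        rw [this]
        nlinarith

lemma SB.holder {N : ℕ} {s a β : ℝ} {μ : Measure (Euc N)} {S : Set (Euc N)} {V : Euc N → ℝ≥0∞}
    (h : SB N s a β μ S V) : ∃ α C : ℝ, 0 < α ∧ α < 1 ∧ 0 < C ∧ ∀ x y : Euc N, ‖x - y‖ ≤ 1 →
      Rf N s μ x ≤ Rf N s μ y + ENNReal.ofReal (C * ‖x - y‖ ^ α) := by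
  have hs := h.hs
  have hs1 := h.hs1
  have := h.prob
  obtain ⟨Cv, hCv, hvol⟩ := h.vol
  obtain ⟨C1, hC1, hR⟩ := h.Rf_le
  obtain ⟨C2, hC2, hmod⟩ := Tm_mod N hs hs1 hCv
  obtain ⟨e, C3, he1, he2, he3, hC3, hlow⟩ := h.lower
  obtain ⟨C4, hC4, hoff⟩ := T_off (N := N) hs hs1 hCv
  set γ := e/2 - s with hγ
  have hγ0 : 0 < γ := by linarith
  set α := min (s/2) (γ/2 * (1 - s)) with hα
  have hs1' : 0 < 1 - s := by linarith
  have hα0 : 0 < α := lt_min (by linarith) (by positivity)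
  have hα1 : α ≤ s/2 := min_le_left _ _
  have hα2 : α ≤ γ/2 * (1 - s) := min_le_right _ _
  have hα3 : α ≤ γ := hα2.trans (by nlinarith)
  refine ⟨α, C1 + C2 + C4 + 2 * C3, hα0, by linarith, by positivity, fun x y hxy => ?_⟩
  rcases eq_or_lt_of_le (norm_nonneg (x - y)) with h0 | h0
  · have : x = y := by rw [← sub_eq_zero, ← norm_eq_zero, h0]
    rw [this]; exact le_self_add
  set t := ‖x - y‖ with ht
  have hpow : ∀ q : ℝ, α ≤ q → t ^ q ≤ t ^ α := fun q hq => Real.rpow_le_rpow_of_exponent_ge h0 hxy hq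
  have ht0 : 0 ≤ t ^ α := by positivity
  have hA : Rf N s μ x ≤ Tm N (mw s t) μ y + ENNReal.ofReal ((C1 + C2) * t ^ α) := by
    calc Rf N s μ x ≤ Tm N (mw s t) μ x + ENNReal.ofReal (C1 * t ^ (β/2 - s)) := hR t h0 x
      _ ≤ (Tm N (mw s t) μ y + ENNReal.ofReal (C2 * (t ^ s * t ^ (-(s/2))))) + ENNReal.ofReal (C1 * t ^ (β/2 - s)) :=
          add_le_add (hmod μ hvol t h0 x y) le_rfl
      _ = Tm N (mw s t) μ y + ENNReal.ofReal (C2 * t ^ (s/2) + C1 * t ^ (β/2 - s)) := by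
          rw [add_assoc, ← ENNReal.ofReal_add (by positivity) (by positivity), ← Real.rpow_add h0]
          ring_nf
      _ ≤ _ := by
          refine add_le_add le_rfl (ENNReal.ofReal_le_ofReal ?_)
          have h1 : C2 * t ^ (s/2) ≤ C2 * t ^ α := mul_le_mul_of_nonneg_left (hpow _ hα1) (by positivity)
          have h2 : C1 * t ^ (β/2 - s) ≤ C1 * t ^ α := mul_le_mul_of_nonneg_left (hpow _ (by linarith)) (by positivity)
          linarith
  by_cases hy : y ∈ S
  · have hB : Tm N (mw s t) μ y ≤ Rf N s μ y + ENNReal.ofReal (C3 * t ^ γ) := by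
      have hl := (h.Rf_tendsto y).add_const (ENNReal.ofReal (C3 * t ^ γ))
      refine ge_of_tendsto hl ?_
      have h2 : ∀ᶠ n : ℕ in atTop, (1/2:ℝ) ^ n < t :=
        (tendsto_pow_atTop_nhds_zero_of_lt_one (r := (1/2:ℝ)) (by norm_num) (by norm_num)).eventually (gt_mem_nhds h0)
      filter_upwards [h2] with n hn
      have h3 := hlow y hy y (by simp) ((1/2:ℝ) ^ n) t (by positivity) hn.le hxy
      rw [sub_self, norm_zero, Real.zero_rpow (by linarith), zero_mul, add_zero] at h3
      exact h3
    calc Rf N s μ x ≤ _ := hA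
      _ ≤ (Rf N s μ y + ENNReal.ofReal (C3 * t ^ γ)) + ENNReal.ofReal ((C1 + C2) * t ^ α) := add_le_add hB le_rfl
      _ = Rf N s μ y + ENNReal.ofReal (C3 * t ^ γ + (C1 + C2) * t ^ α) := by
          rw [add_assoc, ← ENNReal.ofReal_add (by positivity) (by positivity)]
      _ ≤ _ := by
          refine add_le_add le_rfl (ENNReal.ofReal_le_ofReal ?_)
          have h1 : C3 * t ^ γ ≤ C3 * t ^ α := mul_le_mul_of_nonneg_left (hpow _ hα3) (by positivity)
          nlinarith [mul_nonneg hC4.le ht0, mul_nonneg hC3.le ht0]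
  by_cases hx : x ∈ S
  swap
  · rw [h.Rf_off hx]; exact zero_le
  obtain ⟨x₀, hx₀, hdx⟩ := h.cpt.exists_infDist_eq_dist h.ne y
  set d := Metric.infDist y S with hd
  have hd0 : 0 < d := (h.cpt.isClosed.notMem_iff_infDist_pos h.ne).1 hy
  have hdt : d ≤ t := by
    have := Metric.infDist_le_dist_of_mem (x := y) hx
    rwa [dist_eq_norm, norm_sub_rev] at this
  have hd1 : d ≤ 1 := hdt.trans hxy
  have hdx' : ‖y - x₀‖ = d := by rw [← dist_eq_norm, ← hdx]
  have hpowd : ∀ q : ℝ, α ≤ q → d ^ q ≤ t ^ α := fun q hq =>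
    (Real.rpow_le_rpow_of_exponent_ge hd0 hd1 hq).trans (Real.rpow_le_rpow hd0.le hdt hα0.le)
  set ε := d ^ (2 + γ) with hε
  have hε0 : 0 < ε := by positivity
  have hεt : ε ≤ t := by
    refine le_trans ?_ hdt
    calc ε ≤ d ^ (1:ℝ) := Real.rpow_le_rpow_of_exponent_ge hd0 hd1 (by linarith)
      _ = d := Real.rpow_one d
  have hB := hlow x₀ hx₀ y (by rw [hdx']; exact hd1) ε t hε0 hεt hxy
  have hC := hoff μ S h.aeS hvol y d hd0 (fun z hz => by
    have := Metric.infDist_le_dist_of_mem (x := y) hz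
    rwa [dist_eq_norm] at this) ε hε0
  rw [hdx'] at hB
  have e1 : ε ^ ((1-s)/2) * d ^ (-(1-s)) ≤ t ^ α := by
    rw [hε, ← Real.rpow_mul hd0.le, ← Real.rpow_add hd0]
    apply hpowd
    refine hα2.trans (le_of_eq (by ring))
  have e2 : d ^ e * ε ^ (-s) ≤ t ^ α := by
    rw [hε, ← Real.rpow_mul hd0.le, ← Real.rpow_add hd0]
    apply hpowd
    have : e = 2 * γ + 2 * s := by rw [hγ]; ring
    rw [this]
    nlinarith
  have e3 : t ^ γ ≤ t ^ α := hpow _ hα3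
  calc Rf N s μ x ≤ _ := hA
    _ ≤ ((ENNReal.ofReal (C4 * t ^ α)) + ENNReal.ofReal (C3 * (t ^ α + t ^ α))) + ENNReal.ofReal ((C1 + C2) * t ^ α) := by
        refine add_le_add (hB.trans (add_le_add (hC.trans ?_) ?_)) le_rfl
        · exact ENNReal.ofReal_le_ofReal (by gcongr)
        · exact ENNReal.ofReal_le_ofReal (by gcongr)
    _ = ENNReal.ofReal ((C1 + C2 + C4 + 2 * C3) * t ^ α) := by
        rw [← ENNReal.ofReal_add (by positivity) (by positivity), ← ENNReal.ofReal_add (by positivity) (by positivity)]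
        congr 1; ring
    _ ≤ _ := le_add_self

lemma SB.dens {N : ℕ} {s a β : ℝ} {μ : Measure (Euc N)} {S : Set (Euc N)} {V : Euc N → ℝ≥0∞}
    (h : SB N s a β μ S V) : ∃ ρ : Euc N → ℝ, (∀ x, 0 ≤ ρ x) ∧
      μ = (volume : Measure (Euc N)).withDensity (fun x => ENNReal.ofReal (ρ x)) ∧
      ∃ α C : ℝ, α ∈ Ioo (0:ℝ) 1 ∧ ∀ x y, |ρ x - ρ y| ≤ C * ‖x - y‖ ^ α := by
  have := h.prob
  have hZ := Zc_pos h.hs h.hs1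
  obtain ⟨K, hK, hRb⟩ := h.Rf_b
  obtain ⟨α, C, hα0, hα1, hC, hH⟩ := h.holder
  have hfin : ∀ x, Rf N s μ x ≠ ⊤ := fun x => ((hRb x).trans_lt ENNReal.ofReal_lt_top).ne
  refine ⟨fun x => (Rf N s μ x).toReal / Zc s, fun x => by positivity, ?_, α, (C + K) / Zc s, ⟨hα0, hα1⟩, ?_⟩
  · have e : (fun x => ENNReal.ofReal ((Rf N s μ x).toReal / Zc s)) = (ENNReal.ofReal (Zc s))⁻¹ • Rf N s μ := by
      funext x
      rw [ENNReal.ofReal_div_of_pos hZ, ENNReal.ofReal_toReal (hfin x), Pi.smul_apply, smul_eq_mul, div_eq_mul_inv, mul_comm]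
    rw [e, withDensity_smul _ (measurable_Rf s μ), ← h.Rf_density, smul_smul,
      ENNReal.inv_mul_cancel (by simpa using hZ) ENNReal.ofReal_ne_top, one_smul]
  · have hone : ∀ x y, (Rf N s μ x).toReal ≤ (Rf N s μ y).toReal + (C + K) * ‖x - y‖ ^ α := by
      intro x y
      rcases le_total ‖x - y‖ 1 with hxy | hxy
      · have h1 := hH x y hxy
        rw [← ENNReal.ofReal_toReal (hfin x), ← ENNReal.ofReal_toReal (hfin y),
          ← ENNReal.ofReal_add ENNReal.toReal_nonneg (by positivity), ENNReal.ofReal_le_ofReal_iff (by positivity)] at h1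
        have : 0 ≤ K * ‖x - y‖ ^ α := by positivity
        linarith
      · have h1 : (Rf N s μ x).toReal ≤ K := ENNReal.toReal_le_of_le_ofReal hK.le (hRb x)
        have h2 : 0 ≤ (Rf N s μ y).toReal := ENNReal.toReal_nonneg
        have h3 : 1 ≤ ‖x - y‖ ^ α := Real.one_le_rpow hxy hα0.le
        nlinarith [mul_nonneg hC.le (zero_le_one.trans h3)]
    intro x y
    rw [← sub_div, abs_div, abs_of_pos hZ, div_mul_eq_mul_div]
    gcongr
    rw [abs_le]
    have h1 := hone x y
    have h2 := hone y x
    rw [norm_sub_rev y x] at h2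
    constructor <;> linarith

/-- **Regularity of local minimizers for power-law repulsion** (Carrillo–Delgadino–
Mellet).  For `W(x) = |x|^a/a − |x|^{2s−N}/(2s−N)`, `a > 0`, `0 < s ≤ 1`, `2s < N`,
every `d₂`-local minimizer of the interaction energy is absolutely continuous, with
density in `L^∞_loc` if `s = 1` and with a `C^α_loc` representative if `0 < s < 1`. -/
theorem regularity_of_local_minimizers
    (N : ℕ) (hN : 1 ≤ N) (s a : ℝ) (hs0 : 0 < s) (hs1 : s ≤ 1) (hsN : 2 * s < (N : ℝ))
    (ha : 0 < a)
    (μ : Measure (Euc N)) (hmin : IsLocalMin2 N (powerLawW N s a) μ) :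
    μ ≪ (volume : Measure (Euc N)) ∧
    ∃ ρ : Euc N → ℝ, (∀ x, 0 ≤ ρ x) ∧
      μ = (volume : Measure (Euc N)).withDensity (fun x => ENNReal.ofReal (ρ x)) ∧
      -- for s = 1 the density is locally essentially bounded
      (s = 1 → ∀ K : Set (Euc N), IsCompact K → ∃ M : ℝ,
        ∀ᵐ x : Euc N ∂(volume : Measure (Euc N)), x ∈ K → ρ x ≤ M) ∧
      -- for 0 < s < 1 the density has a locally Hölder continuous representative
      (s < 1 → ∃ α : ℝ, α ∈ Ioo (0 : ℝ) 1 ∧ ∃ v : Euc N → ℝ,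
        (∀ᵐ x : Euc N ∂(volume : Measure (Euc N)), ρ x = v x) ∧
        ∀ K : Set (Euc N), IsCompact K → ∃ C : ℝ,
          ∀ x ∈ K, ∀ y ∈ K, |v x - v y| ≤ C * ‖x - y‖ ^ α) := by
  have hS := SU_of_min hN hs0 hs1 hsN ha hmin
  rcases eq_or_lt_of_le hs1 with h1 | h1
  · obtain ⟨ρ, C, hC, _, hρ0, hρC, _, hμ⟩ := density hS
    refine ⟨?_, ρ, hρ0, hμ, fun _ K _ => ⟨C, Eventually.of_forall fun x _ => hρC x⟩, fun h2 => absurd h1 h2.ne⟩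
    rw [hμ]; exact withDensity_absolutelyContinuous _ _
  · obtain ⟨β, V, hB⟩ := SB_of_SU hS h1
    obtain ⟨ρ, hρ0, hμ, α, C, hα, hH⟩ := hB.dens
    refine ⟨?_, ρ, hρ0, hμ, fun h2 => absurd h2 h1.ne, fun _ => ⟨α, hα, ρ, Eventually.of_forall fun x => rfl,
      fun K _ => ⟨C, fun x _ y _ => hH x y⟩⟩⟩
    rw [hμ]; exact withDensity_absolutelyContinuous _ _
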